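/- Fix λ > 0 and ε ∈ (0,1). Set A = N·e^{-ε√(log N)}, Q = (log N)^λ, τ = A²·N^{-1}·Q^{-1}. There is a constant c₄ > 0 such that for all sufficiently large even N, for every q with 1 ≤ q ≤ Q, every a with 0 ≤ a ≤ q−1 and gcd(a,q) = 1, and every real α with |α − a/q| ≤ 1/τ, writing β = α − a/q, one has F(α,A) = (μ(q)/φ(q)) · Σ_{N/2 − A < n ≤ N/2 + A} e^{2πiβn} + O(A·e^{-c₄√(log N)}). -/

import Mathlib

open Finset Real
open scoped BigOperators Classical

/-- `e(x) = exp(2πix)`. -/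
noncomputable def e (x : ℝ) : ℂ := Complex.exp (2 * Real.pi * Complex.I * x)

/-- `A = N·e^{−ε√(log N)}`. -/
noncomputable def Aof (ε : ℝ) (N : ℕ) : ℝ := (N : ℝ) * Real.exp (-ε * Real.sqrt (Real.log N))

/-- `Q = (log N)^λ`. -/
noncomputable def Qof (lam : ℝ) (N : ℕ) : ℝ := Real.log N ^ (lam : ℝ)

/-- `τ = A²·N⁻¹·Q⁻¹`. -/
noncomputable def tauof (ε lam : ℝ) (N : ℕ) : ℝ := Aof ε N ^ 2 * (N : ℝ)⁻¹ * (Qof lam N)⁻¹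

/-- `F(α,A) = Σ_{N/2−A < p ≤ N/2+A} (log p)·e(αp)`, sum over primes `p`. -/
noncomputable def F (N : ℕ) (A α : ℝ) : ℂ :=
  ∑ p ∈ (Finset.range (2 * N + 2)).filter
      (fun p => Nat.Prime p ∧ (N : ℝ) / 2 - A < (p : ℝ) ∧ (p : ℝ) ≤ (N : ℝ) / 2 + A),
    (Real.log p : ℂ) * e (α * p)

/-- `u(β,A) = Σ_{N/2−A < n ≤ N/2+A} e(βn)`. -/
noncomputable def u (N : ℕ) (A β : ℝ) : ℂ :=
  ∑ n ∈ (Finset.range (2 * N + 2)).filter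
      (fun n => (N : ℝ) / 2 - A < (n : ℝ) ∧ (n : ℝ) ≤ (N : ℝ) / 2 + A),
    e (β * n)

namespace SiegelWalfisz

open Metric Complex

/-- Logarithmic derivative bound for a non-vanishing function. -/
lemma norm_logDeriv_le_of_ne_zero {f : ℂ → ℂ} (hf : Differentiable ℂ f) {c : ℂ} {r U : ℝ}
    (hr : 0 < r) (hU : 0 < U) (h0 : ∀ z ∈ ball c r, f z ≠ 0)
    (hb : ∀ z ∈ ball c r, ‖f z‖ ≤ Real.exp U * ‖f c‖) {z : ℂ} (hz : z ∈ closedBall c (r / 2)) :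
    ‖deriv f z / f z‖ ≤ 24 * U / r := by
  have hd : DifferentiableOn ℂ (fun z => deriv f z / f z) (ball c r) :=
    (hf.deriv.differentiableOn).div hf.differentiableOn h0
  obtain ⟨g, hg0, hg⟩ := (hd.isExactOn_ball).with_val_at c 0
  have hcm : c ∈ ball c r := mem_ball_self hr
  have hexp : ∀ z ∈ ball c r, f z = f c * exp (g z) := by
    have hconst : ∀ z ∈ ball c r, f z * exp (-g z) = f c := by
      intro z hz
      have hderiv : ∀ y ∈ ball c r, HasDerivAt (fun y => f y * exp (-g y)) 0 y := by
        intro y hy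
        have h1 := (hf y).hasDerivAt.mul ((hg y hy).neg.cexp)
        refine h1.congr_deriv ?_
        have := h0 y hy
        field_simp
        ring
      have := (convex_ball c r).is_const_of_fderivWithin_eq_zero (𝕜 := ℂ)
        (f := fun y => f y * exp (-g y))
        (fun y hy => (hderiv y hy).differentiableAt.differentiableWithinAt)
        (fun y hy => by
          rw [fderivWithin_of_isOpen isOpen_ball hy]
          ext
          simp [(hderiv y hy).deriv]) hz hcm
      simpa [hg0] using this
    intro z hz
    rw [← hconst z hz, mul_assoc, ← Complex.exp_add]; simp
  have hre : ∀ z ∈ ball c r, (g z).re ≤ U := by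
    intro z hz
    have h1 := hb z hz
    rw [hexp z hz, norm_mul, Complex.norm_exp, mul_comm] at h1
    have h2 : 0 < ‖f c‖ := norm_pos_iff.2 (h0 c hcm)
    exact Real.exp_le_exp.1 (le_of_mul_le_mul_right h1 h2)
  have hgd : DifferentiableOn ℂ g (ball c r) :=
    fun z hz => (hg z hz).differentiableAt.differentiableWithinAt
  have hbound : ∀ w ∈ ball c (3 * r / 4), ‖g w‖ ≤ 6 * U := by
    intro w hw
    have hw' : ‖w - c‖ < 3 * r / 4 := by simpa [dist_eq_norm] using hw
    have := borelCaratheodory_zero (f := fun x => g (x + c)) (M := U) (R := r) (z := w - c) hU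
      (hgd.comp (by fun_prop) (fun x hx => by simpa [dist_eq_norm] using hx))
      (fun x hx => hre _ (by simpa [dist_eq_norm] using hx)) hr
      (by simp only [mem_ball, dist_zero_right]; linarith) (by simpa using hg0)
    simp only [sub_add_cancel] at this
    refine this.trans ?_
    rw [div_le_iff₀ (by linarith)]
    nlinarith
  have hz' : ‖z - c‖ ≤ r / 2 := by simpa [dist_eq_norm] using hz
  have hzm : z ∈ ball c r := by simp only [mem_ball, dist_eq_norm]; linarith
  have hsub : ∀ w ∈ closedBall z (r / 5), w ∈ ball c (3 * r / 4) := by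
    intro w hw
    simp only [mem_ball, mem_closedBall, dist_eq_norm] at *
    calc ‖w - c‖ = ‖(w - z) + (z - c)‖ := by ring_nf
      _ ≤ ‖w - z‖ + ‖z - c‖ := norm_add_le _ _
      _ < _ := by linarith
  have hsub4 : ∀ w ∈ ball z (r / 4), w ∈ ball c (3 * r / 4) := by
    intro w hw
    simp only [mem_ball, mem_closedBall, dist_eq_norm] at *
    calc ‖w - c‖ = ‖(w - z) + (z - c)‖ := by ring_nf
      _ ≤ ‖w - z‖ + ‖z - c‖ := norm_add_le _ _
      _ < _ := by linarith
  have hsubr : ball c (3 * r / 4) ⊆ ball c r := ball_subset_ball (by linarith)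
  rw [← (hg z hzm).deriv]
  have key : ∀ ρ : ℝ, 0 < ρ → ρ < r / 4 → ‖deriv g z‖ ≤ 6 * U / ρ := by
    intro ρ hρ hρ'
    refine norm_deriv_le_of_forall_mem_sphere_norm_le hρ ?_ ?_
    · refine DifferentiableOn.diffContOnCl (hgd.mono ?_)
      rw [closure_ball _ hρ.ne']
      exact fun w hw => hsubr (hsub4 w (closedBall_subset_ball hρ' hw))
    · intro w hw
      exact hbound w (hsub4 w (closedBall_subset_ball hρ' (sphere_subset_closedBall hw)))
  have h4 : ∀ ρ : ℝ, 0 < ρ → ρ < r / 4 → ‖deriv g z‖ * ρ ≤ 6 * U := fun ρ h1 h2 =>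
    (le_div_iff₀ h1).1 (key ρ h1 h2)
  rw [le_div_iff₀ hr]
  by_contra! hcon
  have hpos : 0 < ‖deriv g z‖ := by
    by_contra! hneg
    have : ‖deriv g z‖ = 0 := le_antisymm hneg (norm_nonneg _)
    rw [this] at hcon; nlinarith
  have hρ1 : 6 * U / ‖deriv g z‖ < r / 4 := by
    rw [div_lt_iff₀ hpos]; linarith
  obtain ⟨ρ, hρa, hρb⟩ := exists_between hρ1
  have hρ0 : 0 < ρ := lt_of_le_of_lt (by positivity) hρa
  have := h4 ρ hρ0 hρb
  rw [div_lt_iff₀ hpos] at hρa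
  linarith

/-- Removing a zero by a Blaschke factor. -/
lemma exists_blaschke_quotient {f : ℂ → ℂ} (hf : Differentiable ℂ f) {r M : ℝ} (hr : 0 < r)
    (hM : ∀ z ∈ closedBall (0 : ℂ) r, ‖f z‖ ≤ M) {ρ : ℂ} (hρ0 : ρ ≠ 0) (hρ : ‖ρ‖ < r)
    (hfρ : f ρ = 0) (hf0 : f 0 ≠ 0) :
    ∃ g : ℂ → ℂ, Differentiable ℂ g ∧ (∀ z ∈ closedBall (0 : ℂ) r, ‖g z‖ ≤ M) ∧
      ‖g 0‖ = ‖f 0‖ * (r / ‖ρ‖) ∧ (∀ z ∈ ball (0 : ℂ) r, g z = 0 → f z = 0) ∧ g 0 ≠ 0 ∧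
      (deriv f 0 / f 0).re =
        (deriv g 0 / g 0).re + ρ.re * (1 / r ^ 2 - 1 / ‖ρ‖ ^ 2) := by
  set k : ℂ → ℂ := fun z => ((r : ℂ) ^ 2 - (starRingEnd ℂ) ρ * z) / r with hk
  have hrC : (r : ℂ) ≠ 0 := by exact_mod_cast hr.ne'
  have hds : Differentiable ℂ (dslope f ρ) := by
    rw [← differentiableOn_univ]
    exact (Complex.differentiableOn_dslope Filter.univ_mem).2 hf.differentiableOn
  have hkd : Differentiable ℂ k := by simp only [hk]; fun_prop
  have hfd : ∀ z, f z = (z - ρ) * dslope f ρ z := by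
    intro z
    have := sub_smul_dslope f ρ z
    simp only [smul_eq_mul, hfρ, sub_zero] at this
    exact this.symm
  have hcirc : ∀ z : ℂ, ‖z‖ = r → ‖k z‖ = ‖z - ρ‖ := by
    intro z hz
    have h1 : (r : ℂ) ^ 2 - (starRingEnd ℂ) ρ * z = z * (starRingEnd ℂ) (z - ρ) := by
      have : (r : ℂ) ^ 2 = z * (starRingEnd ℂ) z := by
        rw [mul_conj, normSq_eq_norm_sq, hz]; push_cast; rfl
      rw [this, map_sub]; ring
    simp only [hk]
    rw [h1, norm_div, norm_mul, RCLike.norm_conj, hz, norm_real, Real.norm_of_nonneg hr.le]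
    field_simp
  have hk0 : ∀ z ∈ ball (0 : ℂ) r, k z ≠ 0 := by
    intro z hz h
    simp only [hk, div_eq_zero_iff, hrC, or_false, sub_eq_zero] at h
    have h2 := congrArg norm h
    simp only [norm_pow, norm_real, norm_mul, RCLike.norm_conj, Real.norm_of_nonneg hr.le] at h2
    have hz' : ‖z‖ < r := by simpa using hz
    nlinarith [norm_nonneg z, norm_nonneg ρ]
  have hρn : 0 < ‖ρ‖ := norm_pos_iff.2 hρ0
  have hd0 : dslope f ρ 0 ≠ 0 := by
    intro h; apply hf0; rw [hfd 0, h, mul_zero]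
  have hk00 : k 0 ≠ 0 := hk0 0 (mem_ball_self hr)
  refine ⟨fun z => dslope f ρ z * k z, hds.mul hkd, ?_, ?_, ?_, mul_ne_zero hd0 hk00, ?_⟩
  · intro z hz
    have hfr : ∀ w ∈ frontier (ball (0 : ℂ) r), ‖dslope f ρ w * k w‖ ≤ M := by
      intro w hw
      rw [frontier_ball _ hr.ne'] at hw
      have hw' : ‖w‖ = r := by simpa using hw
      rw [norm_mul, hcirc w hw', mul_comm, ← norm_mul, ← hfd]
      exact hM w (sphere_subset_closedBall hw)
    refine Complex.norm_le_of_forall_mem_frontier_norm_le isBounded_ball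
      (hds.mul hkd).diffContOnCl hfr ?_
    rwa [closure_ball _ hr.ne']
  · have : k 0 = r := by simp only [hk]; field_simp; simp
    simp only [this, norm_mul, hfd 0, zero_sub, norm_neg, norm_real, Real.norm_of_nonneg hr.le]
    field_simp
  · intro z hz h
    rcases mul_eq_zero.1 h with h | h
    · rw [hfd z, h, mul_zero]
    · exact absurd h (hk0 z hz)
  · have h1 : deriv f 0 / f 0 = 1 / (0 - ρ) + deriv (dslope f ρ) 0 / dslope f ρ 0 := by
      have : deriv f 0 = dslope f ρ 0 + (0 - ρ) * deriv (dslope f ρ) 0 := by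
        have h := (((hasDerivAt_id (0 : ℂ)).sub_const ρ).mul (hds 0).hasDerivAt).deriv
        have h' : (fun z => id z - ρ) * dslope f ρ = f := by ext z; simp [hfd z]
        rw [h'] at h
        simpa using h
      have hρ' : (0 - ρ) ≠ 0 := by simpa using hρ0
      rw [this, hfd 0, add_div]
      congr 1 <;> field_simp
    have h2 : deriv (fun z => dslope f ρ z * k z) 0 / (dslope f ρ 0 * k 0) =
        deriv (dslope f ρ) 0 / dslope f ρ 0 + -(starRingEnd ℂ) ρ / r ^ 2 := by
      have hk' : HasDerivAt k (-(starRingEnd ℂ) ρ / r) 0 := by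
        have := (((hasDerivAt_id (0 : ℂ)).const_mul ((starRingEnd ℂ) ρ)).const_sub
          ((r : ℂ) ^ 2)).div_const (r : ℂ)
        simpa using this
      have : k 0 = r := by simp only [hk]; field_simp; simp
      have h' : deriv (fun z => dslope f ρ z * k z) 0 = _ := ((hds 0).hasDerivAt.mul hk').deriv
      rw [h', this]
      field_simp
    rw [h1]
    simp only [h2, add_re]
    have h3 : (1 / (0 - ρ)).re = - ρ.re / ‖ρ‖ ^ 2 := by
      rw [zero_sub, one_div, inv_re, normSq_neg, normSq_eq_norm_sq]; simp
    have h4 : (-(starRingEnd ℂ) ρ / (r : ℂ) ^ 2).re = -ρ.re / r ^ 2 := by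
      rw [← ofReal_pow, div_ofReal_re]; simp
    rw [h3, h4]; ring

lemma neg_re_logDeriv_le_aux {r V : ℝ} (hr : 0 < r) (hV : 0 < V) (n : ℕ) :
    ∀ (f : ℂ → ℂ) (U : ℝ), Differentiable ℂ f → U ≤ V → U ≤ n * Real.log 2 → f 0 ≠ 0 →
      (∀ z ∈ closedBall (0 : ℂ) r, ‖f z‖ ≤ Real.exp U * ‖f 0‖) →
      (∀ z ∈ ball (0 : ℂ) r, f z = 0 → z.re ≤ 0) →
      -(deriv f 0 / f 0).re ≤ 48 * V / r := by
  induction n with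
  | zero =>
    intro f U hf hUV hUn hf0 hb hz
    by_cases hex : ∃ ρ ∈ ball (0 : ℂ) (r / 2), f ρ = 0
    · obtain ⟨ρ, hρ, hfρ⟩ := hex
      have hρ0 : ρ ≠ 0 := by rintro rfl; exact hf0 hfρ
      have hρn : ‖ρ‖ < r / 2 := by simpa using hρ
      obtain ⟨g, -, hg1, hg2, -, -, -⟩ :=
        exists_blaschke_quotient hf hr hb hρ0 (by linarith) hfρ hf0
      have h1 := hg1 0 (mem_closedBall_self hr.le)
      have hρp : 0 < ‖ρ‖ := norm_pos_iff.2 hρ0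
      have hfp : 0 < ‖f 0‖ := norm_pos_iff.2 hf0
      rw [hg2, mul_comm] at h1
      have h2 := le_of_mul_le_mul_right h1 hfp
      have h3 : 2 < r / ‖ρ‖ := by rw [lt_div_iff₀ hρp]; linarith
      have h4 : Real.exp U ≤ 1 := by
        rw [Real.exp_le_one_iff]; simpa using hUn
      linarith
    · push Not at hex
      have := norm_logDeriv_le_of_ne_zero hf (c := 0) (half_pos hr) hV hex (fun z hz => by
        refine (hb z (ball_subset_closedBall (ball_subset_ball (by linarith) hz))).trans ?_
        gcongr) (mem_closedBall_self (by positivity))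
      have h2 := (abs_le.1 (abs_re_le_norm (deriv f 0 / f 0))).1
      calc _ ≤ ‖deriv f 0 / f 0‖ := by linarith
        _ ≤ _ := this
        _ = _ := by field_simp; ring
  | succ n ih =>
    intro f U hf hUV hUn hf0 hb hz
    by_cases hex : ∃ ρ ∈ ball (0 : ℂ) (r / 2), f ρ = 0
    · obtain ⟨ρ, hρ, hfρ⟩ := hex
      have hρ0 : ρ ≠ 0 := by rintro rfl; exact hf0 hfρ
      have hρn : ‖ρ‖ < r / 2 := by simpa using hρ
      obtain ⟨g, hgd, hg1, hg2, hg3, hg4, hg5⟩ :=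
        exists_blaschke_quotient hf hr hb hρ0 (by linarith) hfρ hf0
      have hρp : 0 < ‖ρ‖ := norm_pos_iff.2 hρ0
      have h3 : 2 < r / ‖ρ‖ := by rw [lt_div_iff₀ hρp]; linarith
      have hl2 : 0 < Real.log 2 := Real.log_pos (by norm_num)
      have hih := ih g (U - Real.log 2) hgd (by linarith) (by push_cast at hUn; linarith) hg4
        (fun z hz' => by
          refine (hg1 z hz').trans ?_
          rw [hg2, Real.exp_sub, Real.exp_log (by norm_num)]
          have : 0 ≤ Real.exp U * ‖f 0‖ := by positivity
          calc Real.exp U * ‖f 0‖ = (Real.exp U * ‖f 0‖) * 1 := by ring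
            _ ≤ (Real.exp U * ‖f 0‖) * (r / ‖ρ‖ / 2) := by gcongr; linarith
            _ = _ := by ring)
        (fun z hz' h => hz z hz' (hg3 z hz' h))
      have hre : ρ.re ≤ 0 := hz ρ (by simp only [mem_ball, dist_zero_right]; linarith) hfρ
      have h5 : 1 / r ^ 2 - 1 / ‖ρ‖ ^ 2 ≤ 0 := by
        rw [sub_nonpos]
        gcongr; linarith
      rw [hg5]
      nlinarith [mul_nonneg_of_nonpos_of_nonpos hre h5]
    · push Not at hex
      have := norm_logDeriv_le_of_ne_zero hf (c := 0) (half_pos hr) hV hex (fun z hz => by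
        refine (hb z (ball_subset_closedBall (ball_subset_ball (by linarith) hz))).trans ?_
        gcongr) (mem_closedBall_self (by positivity))
      have h2 := (abs_le.1 (abs_re_le_norm (deriv f 0 / f 0))).1
      calc _ ≤ ‖deriv f 0 / f 0‖ := by linarith
        _ ≤ _ := this
        _ = _ := by field_simp; ring

/-- Landau's local bound for the real part of a logarithmic derivative. -/
lemma neg_re_logDeriv_le {f : ℂ → ℂ} (hf : Differentiable ℂ f) {c : ℂ} {r U : ℝ}
    (hr : 0 < r) (hU : 0 < U) (hc : f c ≠ 0)
    (hb : ∀ z ∈ closedBall c r, ‖f z‖ ≤ Real.exp U * ‖f c‖)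
    (hz : ∀ z ∈ ball c r, f z = 0 → z.re ≤ c.re) :
    -(deriv f c / f c).re ≤ 48 * U / r := by
  obtain ⟨n, hn⟩ := exists_nat_ge (U / Real.log 2)
  have hl2 : 0 < Real.log 2 := Real.log_pos (by norm_num)
  have := neg_re_logDeriv_le_aux hr hU n (fun z => f (z + c)) U (by fun_prop) le_rfl
    ((div_le_iff₀ hl2).1 hn) (by simpa using hc)
    (fun z hz' => by simpa using hb (z + c) (by simpa [dist_eq_norm] using hz'))
    (fun z hz' h => by
      have := hz (z + c) (by simpa [dist_eq_norm] using hz') h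
      simpa using this)
  simpa [deriv_comp_add_const] using this

/-- Landau's local bound in the presence of a zero straight to the left of the centre. -/
lemma neg_re_logDeriv_le_of_zero {f : ℂ → ℂ} (hf : Differentiable ℂ f) {c : ℂ} {r U x : ℝ}
    (hr : 0 < r) (hU : 0 < U) (hc : f c ≠ 0)
    (hb : ∀ z ∈ closedBall c r, ‖f z‖ ≤ Real.exp U * ‖f c‖)
    (hz : ∀ z ∈ ball c r, f z = 0 → z.re ≤ c.re) (hx : 0 < x) (hxr : x < r)
    (hfx : f (c - x) = 0) :
    -(deriv f c / f c).re ≤ 48 * U / r + x / r ^ 2 - 1 / x := by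
  have hne : (-(x : ℂ)) ≠ 0 := by simpa using hx.ne'
  have hnx : ‖(-(x : ℂ))‖ = x := by simp [abs_of_pos hx]
  obtain ⟨g, hgd, hg1, hg2, hg3, hg4, hg5⟩ :=
    exists_blaschke_quotient (f := fun z => f (z + c)) (by fun_prop) hr
      (fun z hz' => by simpa using hb (z + c) (by simpa [dist_eq_norm] using hz'))
      hne (by rwa [hnx]) (by rw [neg_add_eq_sub]; exact hfx) (by simpa using hc)
  have h1 := neg_re_logDeriv_le hgd (c := 0) hr hU hg4 (fun z hz' => by
      refine (hg1 z hz').trans ?_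
      rw [hg2, hnx]
      have h1 : 1 ≤ r / x := by rw [le_div_iff₀ hx]; linarith
      have h2 : 0 ≤ ‖f c‖ := norm_nonneg _
      simp only [zero_add]
      gcongr
      nlinarith)
    (fun z hz' h => by
      have := hz (z + c) (by simpa [dist_eq_norm] using hz') (hg3 z hz' h)
      simpa using this)
  have h2 : -(deriv f c / f c).re =
      -(deriv g 0 / g 0).re + x * (1 / r ^ 2 - 1 / x ^ 2) := by
    rw [hnx] at hg5
    simp only [deriv_comp_add_const, zero_add, neg_re, ofReal_re] at hg5
    rw [hg5]; ring
  rw [h2]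
  have h3 : x * (1 / r ^ 2 - 1 / x ^ 2) = x / r ^ 2 - 1 / x := by field_simp
  linarith

end SiegelWalfisz

namespace SiegelWalfisz

lemma e_add (x y : ℝ) : e (x + y) = e x * e y := by
  simp only [e, ← Complex.exp_add]; push_cast; ring_nf

lemma norm_e (x : ℝ) : ‖e x‖ = 1 := by
  have : (2 * Real.pi * Complex.I * x : ℂ) = ((2 * Real.pi * x : ℝ) : ℂ) * Complex.I := by
    push_cast; ring
  rw [e, this, Complex.norm_exp_ofReal_mul_I]

lemma conj_e (x : ℝ) : (starRingEnd ℂ) (e x) = e (-x) := by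
  simp only [e, ← Complex.exp_conj, map_mul, Complex.conj_ofReal, Complex.conj_I, map_ofNat]
  push_cast; ring_nf

lemma norm_e_sub_one (x : ℝ) : ‖e x - 1‖ = 2 * |Real.sin (Real.pi * x)| := by
  have h : (2 * Real.pi * Complex.I * x : ℂ) = Complex.I * ((2 * Real.pi * x : ℝ) : ℂ) := by
    push_cast; ring
  rw [e, h, Complex.norm_exp_I_mul_ofReal_sub_one]
  rw [Real.norm_eq_abs, abs_mul, abs_two]; ring_nf

lemma norm_e_sub_one_ge {x : ℝ} (h0 : 0 ≤ x) (h1 : x ≤ 1 / 2) : 4 * x ≤ ‖e x - 1‖ := by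
  rw [norm_e_sub_one]
  have h2 := Real.mul_le_sin (x := Real.pi * x) (by positivity) (by nlinarith [Real.pi_pos])
  have h3 : 2 / Real.pi * (Real.pi * x) = 2 * x := by field_simp
  rw [h3] at h2
  linarith [le_abs_self (Real.sin (Real.pi * x))]

lemma norm_e_sub_e_le (x y : ℝ) : ‖e x - e y‖ ≤ 2 * Real.pi * |x - y| := by
  have h : e x - e y = e y * (e (x - y) - 1) := by
    rw [mul_sub, ← e_add]; ring_nf
  rw [h, norm_mul, norm_e, one_mul, norm_e_sub_one]
  have := Real.abs_sin_le_abs (x := Real.pi * (x - y))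
  rw [abs_mul, abs_of_pos Real.pi_pos] at this
  linarith

/-- Discrete Kusmin–Landau inequality. -/
lemma kusmin_landau {g : ℕ → ℝ} {lam : ℝ} (hlam : 0 < lam) (L : ℕ)
    (h1 : ∀ n < L, lam ≤ g (n + 1) - g n) (h2 : ∀ n < L, g (n + 1) - g n ≤ 1 / 2)
    (hanti : ∀ n, n + 1 < L → g (n + 2) - g (n + 1) ≤ g (n + 1) - g n) :
    ‖∑ n ∈ range L, e (g n)‖ ≤ 2 / lam := by
  set d : ℕ → ℝ := fun n => g (n + 1) - g n with hd
  set w : ℕ → ℂ := fun n => (e (d n) - 1)⁻¹ with hw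
  have hd0 : ∀ n < L, 0 < d n := fun n hn => lt_of_lt_of_le hlam (h1 n hn)
  have hnorm : ∀ n < L, 4 * d n ≤ ‖e (d n) - 1‖ := fun n hn =>
    norm_e_sub_one_ge (hd0 n hn).le (h2 n hn)
  have hne : ∀ n < L, e (d n) - 1 ≠ 0 := fun n hn => by
    rw [← norm_pos_iff]; linarith [hnorm n hn, hd0 n hn]
  have hwb : ∀ n < L, ‖w n‖ ≤ 1 / (4 * lam) := fun n hn => by
    rw [hw]; simp only [norm_inv]
    rw [← one_div]
    apply one_div_le_one_div_of_le (by positivity)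
    linarith [hnorm n hn, h1 n hn]
  have hE : ∀ n < L, e (g n) = w n * (e (g (n + 1)) - e (g n)) := fun n hn => by
    have : g (n + 1) = g n + d n := by simp [hd]
    rw [this, e_add, ← mul_sub_one, hw]
    have := hne n hn
    field_simp
  -- partial summation by induction, tracking the total variation
  have key : ∀ m, m < L → ‖∑ n ∈ range (m + 1), e (g n) - w m * e (g (m + 1))‖ ≤
      1 / (4 * lam) + Real.pi / 8 * (1 / d m - 1 / d 0) := by
    intro m
    induction m with
    | zero =>
      intro h0
      simp only [zero_add, range_one, sum_singleton, sub_self, mul_zero, add_zero]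
      rw [hE 0 h0]
      have : w 0 * (e (g (0 + 1)) - e (g 0)) - w 0 * e (g 1) = -(w 0 * e (g 0)) := by ring
      rw [this, norm_neg, norm_mul, norm_e, mul_one]
      exact hwb 0 h0
    | succ m ih =>
      intro hm
      have ih' := ih (by omega)
      have hdm := hd0 m (by omega)
      have hdm1 := hd0 (m + 1) hm
      have hle : d (m + 1) ≤ d m := hanti m hm
      have hwd : ‖w m - w (m + 1)‖ ≤ Real.pi / 8 * (1 / d (m + 1) - 1 / d m) := by
        have h3 : w m - w (m + 1) = (e (d (m + 1)) - e (d m)) * (w m * w (m + 1)) := by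
          rw [hw]
          have := hne m (by omega)
          have := hne (m + 1) hm
          field_simp; ring
        have h4 : ‖w m‖ ≤ 1 / (4 * d m) := by
          rw [hw]; simp only [norm_inv]; rw [← one_div]
          exact one_div_le_one_div_of_le (by positivity) (hnorm m (by omega))
        have h5 : ‖w (m + 1)‖ ≤ 1 / (4 * d (m + 1)) := by
          rw [hw]; simp only [norm_inv]; rw [← one_div]
          exact one_div_le_one_div_of_le (by positivity) (hnorm (m + 1) hm)
        have h6 := norm_e_sub_e_le (d (m + 1)) (d m)
        rw [abs_of_nonpos (by linarith)] at h6
        rw [h3, norm_mul, norm_mul]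
        calc _ ≤ (2 * Real.pi * -(d (m + 1) - d m)) * (1 / (4 * d m) * (1 / (4 * d (m + 1)))) := by
              gcongr
              · have := Real.pi_pos
                nlinarith
          _ = _ := by field_simp; ring
      rw [sum_range_succ]
      have h7 : ∑ n ∈ range (m + 1), e (g n) + e (g (m + 1)) - w (m + 1) * e (g (m + 1 + 1)) =
          (∑ n ∈ range (m + 1), e (g n) - w m * e (g (m + 1))) +
          (w m - w (m + 1)) * e (g (m + 1)) := by
        have h8 := hE (m + 1) hm
        linear_combination h8
      rw [h7]
      calc _ ≤ _ := norm_add_le _ _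
        _ ≤ (1 / (4 * lam) + Real.pi / 8 * (1 / d m - 1 / d 0)) +
            Real.pi / 8 * (1 / d (m + 1) - 1 / d m) := by
            rw [norm_mul, norm_e, mul_one]; gcongr
        _ = _ := by ring
  rcases Nat.eq_zero_or_pos L with rfl | hL
  · simp; positivity
  · obtain ⟨m, rfl⟩ : ∃ m, L = m + 1 := ⟨L - 1, by omega⟩
    have h3 := key m (by omega)
    have h4 := hwb m (by omega)
    have h5 : 1 / d m ≤ 1 / lam := one_div_le_one_div_of_le hlam (h1 m (by omega))
    have h6 : 0 < 1 / d 0 := one_div_pos.2 (hd0 0 (by omega))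
    have h7 : ‖∑ n ∈ range (m + 1), e (g n)‖ ≤
        ‖∑ n ∈ range (m + 1), e (g n) - w m * e (g (m + 1))‖ + ‖w m‖ := by
      have := norm_add_le (∑ n ∈ range (m + 1), e (g n) - w m * e (g (m + 1)))
        (w m * e (g (m + 1)))
      rwa [sub_add_cancel, norm_mul, norm_e, mul_one] at this
    have h8 : Real.pi / 8 * (1 / d m - 1 / d 0) ≤ 4 / 8 * (1 / lam) := by
      have := Real.pi_le_four
      have := Real.pi_pos
      have h9 : 0 < 1 / lam := by positivity
      nlinarith
    have h10 : 1 / (4 * lam) = 1 / 4 * (1 / lam) := by field_simp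
    have h11 : 2 / lam = 2 * (1 / lam) := by field_simp
    have h12 : 0 < 1 / lam := by positivity
    linarith

/-- The van der Corput inequality. -/
lemma van_der_corput_ineq (z : ℕ → ℂ) (hz : ∀ n, ‖z n‖ ≤ 1) {L H : ℕ} (hH : 1 ≤ H) (hHL : H ≤ L) :
    ‖∑ n ∈ range L, z n‖ ^ 2 ≤ 2 * L / H * (L + 2 * ∑ h ∈ Ico 1 H,
      ‖∑ n ∈ range (L - h), z (n + h) * (starRingEnd ℂ) (z n)‖) := by
  set T : ℕ → ℝ := fun h => ‖∑ n ∈ range (L - h), z (n + h) * (starRingEnd ℂ) (z n)‖ with hT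
  set y : ℕ → ℕ → ℂ := fun m h => if h ≤ m ∧ m < L + h then z (m - h) else 0 with hy
  have hfilter : ∀ h < H, (range (L + H)).filter (fun m => h ≤ m ∧ m < L + h) = Ico h (L + h) := by
    intro h hh; ext m; simp only [mem_filter, mem_range, mem_Ico]; omega
  have hS : ∀ h < H, ∑ m ∈ range (L + H), y m h = ∑ n ∈ range L, z n := by
    intro h hh
    simp only [hy]
    rw [← sum_filter, hfilter h hh, sum_Ico_eq_sum_range]
    simp
  have hcorr1 : ∀ h1 < H, ∀ h2 < H, h1 ≤ h2 →
      ∑ m ∈ range (L + H), y m h1 * (starRingEnd ℂ) (y m h2) =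
        ∑ n ∈ range (L - (h2 - h1)), z (n + (h2 - h1)) * (starRingEnd ℂ) (z n) := by
    intro h1 hh1 h2 hh2 h12
    have : ∀ m ∈ range (L + H), y m h1 * (starRingEnd ℂ) (y m h2) =
        if h2 ≤ m ∧ m < L + h1 then z (m - h1) * (starRingEnd ℂ) (z (m - h2)) else 0 := by
      intro m hm
      simp only [hy]
      split_ifs <;> first | rfl | (exfalso; omega) | simp
    rw [sum_congr rfl this, ← sum_filter]
    have hf : (range (L + H)).filter (fun m => h2 ≤ m ∧ m < L + h1) = Ico h2 (L + h1) := by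
      ext m; simp only [mem_filter, mem_range, mem_Ico]; omega
    rw [hf, sum_Ico_eq_sum_range]
    have : L + h1 - h2 = L - (h2 - h1) := by omega
    rw [this]
    refine sum_congr rfl fun n hn => ?_
    congr 3 <;> omega
  have hcorr : ∀ h1 < H, ∀ h2 < H,
      ‖∑ m ∈ range (L + H), y m h1 * (starRingEnd ℂ) (y m h2)‖ = T ((h2 - h1) + (h1 - h2)) := by
    intro h1 hh1 h2 hh2
    rcases le_total h1 h2 with h | h
    · rw [hcorr1 h1 hh1 h2 hh2 h, Nat.sub_eq_zero_of_le h, add_zero]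
    · rw [Nat.sub_eq_zero_of_le h, zero_add, hT]
      simp only
      rw [← hcorr1 h2 hh2 h1 hh1 h, ← RCLike.norm_conj]
      congr 1
      rw [map_sum]
      refine sum_congr rfl fun m _ => ?_
      rw [map_mul, Complex.conj_conj, mul_comm]
  have hT0 : T 0 ≤ L := by
    simp only [hT]
    refine (norm_sum_le _ _).trans ?_
    calc _ ≤ ∑ n ∈ range (L - 0), (1 : ℝ) := by
          refine sum_le_sum fun n _ => ?_
          rw [norm_mul, RCLike.norm_conj]
          exact mul_le_one₀ (hz _) (norm_nonneg _) (hz _)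
      _ = L := by simp
  have hTnn : ∀ h, 0 ≤ T h := fun h => norm_nonneg _
  have hrow : ∀ h1 < H, ∑ h2 ∈ range H, T ((h2 - h1) + (h1 - h2)) ≤
      L + 2 * ∑ h ∈ Ico 1 H, T h := by
    intro h1 hh1
    rw [range_eq_Ico, ← sum_Ico_consecutive _ (Nat.zero_le h1) hh1.le,
      sum_eq_sum_Ico_succ_bot hh1]
    have ha : ∑ i ∈ Ico 0 h1, T ((i - h1) + (h1 - i)) ≤ ∑ h ∈ Ico 1 H, T h := by
      have : ∑ i ∈ Ico 0 h1, T ((i - h1) + (h1 - i)) = ∑ h ∈ Ico 1 (h1 + 1), T h := by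
        refine sum_bij' (fun i _ => h1 - i) (fun i _ => h1 - i) ?_ ?_ ?_ ?_ ?_
        all_goals intro i hi; simp only [mem_Ico] at hi ⊢
        any_goals omega
        congr 1; omega
      rw [this]
      refine sum_le_sum_of_subset_of_nonneg ?_ fun _ _ _ => hTnn _
      intro i hi; simp only [mem_Ico] at hi ⊢; omega
    have hb : ∑ i ∈ Ico (h1 + 1) H, T ((i - h1) + (h1 - i)) ≤ ∑ h ∈ Ico 1 H, T h := by
      have : ∑ i ∈ Ico (h1 + 1) H, T ((i - h1) + (h1 - i)) = ∑ h ∈ Ico 1 (H - h1), T h := by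
        refine sum_bij' (fun i _ => i - h1) (fun i _ => i + h1) ?_ ?_ ?_ ?_ ?_
        all_goals intro i hi; simp only [mem_Ico] at hi ⊢
        any_goals omega
        congr 1; omega
      rw [this]
      refine sum_le_sum_of_subset_of_nonneg ?_ fun _ _ _ => hTnn _
      intro i hi; simp only [mem_Ico] at hi ⊢; omega
    simp only [Nat.sub_self, add_zero]
    linarith
  have hHS : (H : ℂ) * ∑ n ∈ range L, z n = ∑ m ∈ range (L + H), ∑ h ∈ range H, y m h := by
    rw [sum_comm, sum_congr rfl fun h hh => hS h (mem_range.1 hh)]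
    simp
  have hCS : ‖(H : ℂ) * ∑ n ∈ range L, z n‖ ^ 2 ≤
      (L + H) * ∑ m ∈ range (L + H), ‖∑ h ∈ range H, y m h‖ ^ 2 := by
    rw [hHS]
    calc _ ≤ (∑ m ∈ range (L + H), ‖∑ h ∈ range H, y m h‖) ^ 2 := by
          gcongr; exact norm_sum_le _ _
      _ ≤ _ := by
          have := sq_sum_le_card_mul_sum_sq (s := range (L + H))
            (f := fun m => ‖∑ h ∈ range H, y m h‖)
          simpa using this
  have hexp : ∑ m ∈ range (L + H), ‖∑ h ∈ range H, y m h‖ ^ 2 ≤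
      ∑ h1 ∈ range H, ∑ h2 ∈ range H, T ((h2 - h1) + (h1 - h2)) := by
    have h1 : ((∑ m ∈ range (L + H), ‖∑ h ∈ range H, y m h‖ ^ 2 : ℝ) : ℂ) =
        ∑ h1 ∈ range H, ∑ h2 ∈ range H,
          ∑ m ∈ range (L + H), y m h1 * (starRingEnd ℂ) (y m h2) := by
      push_cast
      rw [sum_congr rfl fun h1 _ => sum_comm, sum_comm]
      refine sum_congr rfl fun m _ => ?_
      rw [← Complex.mul_conj', map_sum, sum_mul_sum]
    have h2 : ∑ m ∈ range (L + H), ‖∑ h ∈ range H, y m h‖ ^ 2 =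
        ‖((∑ m ∈ range (L + H), ‖∑ h ∈ range H, y m h‖ ^ 2 : ℝ) : ℂ)‖ := by
      rw [Complex.norm_real, Real.norm_of_nonneg (by positivity)]
    rw [h2, h1]
    refine (norm_sum_le _ _).trans (sum_le_sum fun h1 hh1 => ?_)
    refine (norm_sum_le _ _).trans (sum_le_sum fun h2 hh2 => ?_)
    exact (hcorr h1 (mem_range.1 hh1) h2 (mem_range.1 hh2)).le
  have hfin : ∑ h1 ∈ range H, ∑ h2 ∈ range H, T ((h2 - h1) + (h1 - h2)) ≤
      H * (L + 2 * ∑ h ∈ Ico 1 H, T h) := by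
    calc _ ≤ ∑ h1 ∈ range H, (L + 2 * ∑ h ∈ Ico 1 H, T h) :=
          sum_le_sum fun h1 hh1 => hrow h1 (mem_range.1 hh1)
      _ = _ := by rw [sum_const, card_range, nsmul_eq_mul]
  have hHpos : (0 : ℝ) < H := by exact_mod_cast hH
  have hLH : (H : ℝ) ≤ L := by exact_mod_cast hHL
  have hB : 0 ≤ (L : ℝ) + 2 * ∑ h ∈ Ico 1 H, T h := by
    have : 0 ≤ ∑ h ∈ Ico 1 H, T h := sum_nonneg fun _ _ => hTnn _
    positivity
  rw [norm_mul, mul_pow, Complex.norm_natCast] at hCS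
  have h3 : (H : ℝ) ^ 2 * ‖∑ n ∈ range L, z n‖ ^ 2 ≤
      (2 * L) * (H * (L + 2 * ∑ h ∈ Ico 1 H, T h)) := by
    refine hCS.trans ?_
    have := hexp.trans hfin
    have h4 : 0 ≤ H * (L + 2 * ∑ h ∈ Ico 1 H, T h) := by positivity
    calc _ ≤ ((L : ℝ) + H) * (H * (L + 2 * ∑ h ∈ Ico 1 H, T h)) := by gcongr
      _ ≤ _ := by gcongr; linarith
  have h5 : 2 * L / H * (L + 2 * ∑ h ∈ Ico 1 H, T h) =
      (2 * L) * (H * (L + 2 * ∑ h ∈ Ico 1 H, T h)) / H ^ 2 := by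
    field_simp
  rw [h5, le_div_iff₀ (by positivity)]
  linarith

end SiegelWalfisz

namespace SiegelWalfisz

/-- `G j` is, up to sign, the `j`-th derivative of `G 0`, with two-sided bounds of the same type as
those of `x ↦ x⁻ⁿ`. -/
structure IsMonomialLike (n : ℕ) (a b s : ℝ) (G : ℕ → ℝ → ℝ) : Prop where
  deriv : ∀ j x, 0 < x → HasDerivAt (G j) (-(G (j + 1) x)) x
  lower : ∀ j x, 0 < x → a * n.ascFactorial j / (x + s) ^ (n + j) ≤ G j x
  upper : ∀ j x, 0 < x → G j x ≤ b * n.ascFactorial j / x ^ (n + j)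

lemma IsMonomialLike.sub_shift {n : ℕ} {a b s : ℝ} {G : ℕ → ℝ → ℝ} (hG : IsMonomialLike n a b s G)
    (ha : 0 ≤ a) (hb : 0 ≤ b) (hs : 0 ≤ s) {h : ℝ} (hh : 0 < h) :
    IsMonomialLike (n + 1) (a * h * n) (b * h * n) (s + h) (fun j x => G j x - G j (x + h)) := by
  have mvt : ∀ j x, 0 < x → ∃ ξ ∈ Set.Ioo x (x + h), G j x - G j (x + h) = h * G (j + 1) ξ := by
    intro j x hx
    obtain ⟨ξ, hξ, h1⟩ := exists_hasDerivAt_eq_slope (G j) (fun y => -(G (j + 1) y))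
      (show x < x + h by linarith)
      (fun y hy => (hG.deriv j y (by linarith [hy.1])).continuousAt.continuousWithinAt)
      (fun y hy => hG.deriv j y (by linarith [hy.1]))
    refine ⟨ξ, hξ, ?_⟩
    have h2 : x + h - x = h := by ring
    rw [h2, eq_div_iff hh.ne'] at h1
    linarith
  have hasc : ∀ j, (n.ascFactorial (j + 1) : ℝ) = n * (n + 1).ascFactorial j := by
    intro j
    rw [Nat.ascFactorial_succ, ← Nat.succ_ascFactorial]
    push_cast
    rfl
  refine ⟨fun j x hx => ?_, fun j x hx => ?_, fun j x hx => ?_⟩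
  · have h1 := hG.deriv j x hx
    have h2 := (hG.deriv j (x + h) (by linarith)).comp_add_const x h
    exact (h1.sub h2).congr_deriv (by ring)
  · obtain ⟨ξ, hξ, h1⟩ := mvt j x hx
    have h0 : 0 < ξ := by linarith [hξ.1]
    rw [h1]
    refine le_trans ?_ (mul_le_mul_of_nonneg_left (hG.lower (j + 1) ξ h0) hh.le)
    rw [hasc, show n + 1 + j = n + (j + 1) by ring]
    calc _ = h * (a * (n * (n + 1).ascFactorial j) / (x + (s + h)) ^ (n + (j + 1))) := by ring
      _ ≤ _ := by
        have := hξ.2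
        gcongr ?_ * (_ / ?_ ^ _)
        · linarith
  · obtain ⟨ξ, hξ, h1⟩ := mvt j x hx
    have h0 : 0 < ξ := by linarith [hξ.1]
    rw [h1]
    refine le_trans (mul_le_mul_of_nonneg_left (hG.upper (j + 1) ξ h0) hh.le) ?_
    rw [hasc, show n + 1 + j = n + (j + 1) by ring]
    calc _ ≤ h * (b * (n * (n + 1).ascFactorial j) / x ^ (n + (j + 1))) := by
          gcongr
          exact hξ.1.le
      _ = _ := by ring

lemma IsMonomialLike.antitone {n : ℕ} {a b s : ℝ} {G : ℕ → ℝ → ℝ} (hG : IsMonomialLike n a b s G)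
    (ha : 0 ≤ a) (hs : 0 ≤ s) {x y : ℝ} (hx : 0 < x) (hxy : x ≤ y) : G 0 y ≤ G 0 x := by
  have : AntitoneOn (G 0) (Set.Ioi 0) := by
    refine antitoneOn_of_deriv_nonpos (convex_Ioi 0)
      (fun y hy => (hG.deriv 0 y hy).continuousAt.continuousWithinAt)
      (fun y hy => ?_) (fun y hy => ?_)
    · rw [interior_Ioi] at hy
      exact (hG.deriv 0 y hy).differentiableAt.differentiableWithinAt
    · rw [interior_Ioi] at hy
      have hy' : (0 : ℝ) < y := hy
      rw [(hG.deriv 0 y hy).deriv]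
      have := hG.lower 1 y hy
      have h2 : 0 ≤ a * n.ascFactorial 1 / (y + s) ^ (n + 1) := by positivity
      linarith
  exact this (show x ∈ Set.Ioi 0 from hx) (show y ∈ Set.Ioi 0 from hx.trans_le hxy) hxy

lemma sum_inv_sqrt_le (H : ℕ) : ∑ h ∈ Ico 1 H, 1 / √(h : ℝ) ≤ 2 * √(H : ℝ) := by
  have key : ∑ h ∈ Ico 1 (H + 1), 1 / √(h : ℝ) ≤ 2 * √(H : ℝ) := by
    induction H with
    | zero => simp
    | succ H ih =>
      rw [sum_Ico_succ_top (by omega)]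
      have h1 : 0 < √((H + 1 : ℕ) : ℝ) := Real.sqrt_pos.2 (by positivity)
      have h2 : √(H : ℝ) ^ 2 = H := Real.sq_sqrt (by positivity)
      have h3 : √((H + 1 : ℕ) : ℝ) ^ 2 = H + 1 := by
        rw [Real.sq_sqrt (by positivity)]; push_cast; ring
      have h4 : 0 ≤ √(H : ℝ) := Real.sqrt_nonneg _
      have h5 : 1 / √((H + 1 : ℕ) : ℝ) ≤ 2 * √((H + 1 : ℕ) : ℝ) - 2 * √(H : ℝ) := by
        rw [div_le_iff₀ h1]
        nlinarith [sq_nonneg (√((H + 1 : ℕ) : ℝ) - √(H : ℝ))]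
      linarith
  refine le_trans (sum_le_sum_of_subset_of_nonneg (Ico_subset_Ico_right (by omega)) ?_) key
  intros; positivity

lemma sum_div_rpow_le (H : ℕ) {β : ℝ} (hβ : β ≤ 1 / 2) :
    ∑ h ∈ Ico 1 H, ((H : ℝ) / h) ^ β ≤ 2 * H := by
  calc ∑ h ∈ Ico 1 H, ((H : ℝ) / h) ^ β ≤ ∑ h ∈ Ico 1 H, √(H : ℝ) * (1 / √(h : ℝ)) := by
        refine sum_le_sum fun h hh => ?_
        rw [mem_Ico] at hh
        have h0 : (0 : ℝ) < h := by exact_mod_cast hh.1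
        have h1 : (h : ℝ) ≤ H := by exact_mod_cast hh.2.le
        rw [mul_one_div, ← Real.sqrt_div (by positivity), Real.sqrt_eq_rpow]
        exact Real.rpow_le_rpow_of_exponent_le ((one_le_div h0).2 h1) hβ
    _ = √(H : ℝ) * ∑ h ∈ Ico 1 H, 1 / √(h : ℝ) := by rw [mul_sum]
    _ ≤ √(H : ℝ) * (2 * √(H : ℝ)) := by gcongr; exact sum_inv_sqrt_le H
    _ = 2 * H := by
        have : √(H : ℝ) * √(H : ℝ) = H := Real.mul_self_sqrt (by positivity)
        linear_combination 2 * this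

lemma norm_sum_e_le (g : ℕ → ℝ) (L : ℕ) : ‖∑ m ∈ range L, e (g m)‖ ≤ L := by
  refine (norm_sum_le _ _).trans ?_
  simp [norm_e]

/-- Weyl differencing combined with the Kusmin-Landau inequality. -/
theorem weyl_sum_le (k n : ℕ) : ∃ C : ℝ, 1 ≤ C ∧ ∀ (a b s : ℝ) (G : ℕ → ℝ → ℝ) (φ : ℝ → ℝ)
    (X : ℝ) (L H : ℕ), IsMonomialLike n a b s G → 0 < a → 0 < b → 0 ≤ s → 1 ≤ n → 1 ≤ H →
    H ^ 2 ≤ L → (L : ℝ) ≤ X → s + k * H ≤ X →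
    b * n.ascFactorial k * H ^ k / X ^ (n + k) ≤ 1 / 2 →
    (∀ x, 0 < x → φ (x + 1) - φ x = G 0 x) → ∀ L' ≤ L,
    ‖∑ m ∈ range L', e (φ (X + m))‖ ≤ C * L * ((H : ℝ) ^ (-((1 / 2 : ℝ) ^ k)) +
      (X ^ (n + k) / (a * L * H ^ k)) ^ ((1 / 2 : ℝ) ^ (k + 1))) := by
  induction k generalizing n with
  | zero =>
    refine ⟨2 * 3 ^ n, ?_, ?_⟩
    · have : (1 : ℝ) ≤ 3 ^ n := one_le_pow₀ (by norm_num)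
      linarith
    intro a b s G φ X L H hG ha hb hs hn hH hHL hLX hsX hle hφ L' hL'
    have hL1 : 1 ≤ L := le_trans (Nat.one_le_pow _ _ hH) hHL
    have hL0 : (1 : ℝ) ≤ L := by exact_mod_cast hL1
    have hX0 : 0 < X := by linarith
    have hL'X : (L' : ℝ) ≤ X := le_trans (by exact_mod_cast hL') hLX
    simp only [CharP.cast_eq_zero, zero_mul, add_zero, pow_zero, mul_one, Nat.ascFactorial_zero,
      Nat.cast_one, zero_add, pow_one] at hsX hle ⊢
    set Y := X ^ n / (a * L) with hY
    have hY0 : 0 < Y := by positivity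
    have hKL : ‖∑ m ∈ range L', e (φ (X + m))‖ ≤ 2 * 3 ^ n * (L * Y) := by
      have hd : ∀ m : ℕ, φ (X + (m + 1 : ℕ)) - φ (X + m) = G 0 (X + m) := by
        intro m
        rw [← hφ (X + m) (by positivity)]
        push_cast; ring_nf
      have := kusmin_landau (g := fun m => φ (X + m)) (lam := a / (3 * X) ^ n) (by positivity) L'
        (fun m hm => ?_) (fun m hm => ?_) (fun m hm => ?_)
      · refine this.trans (le_of_eq ?_)
        rw [hY]; field_simp; ring
      · rw [hd]
        refine le_trans ?_ (hG.lower 0 _ (by positivity))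
        simp only [Nat.ascFactorial_zero, Nat.cast_one, mul_one, add_zero]
        have : (m : ℝ) ≤ L' := by exact_mod_cast hm.le
        gcongr
        linarith
      · rw [hd]
        refine (hG.upper 0 _ (by positivity)).trans ?_
        simp only [Nat.ascFactorial_zero, Nat.cast_one, mul_one, add_zero]
        refine le_trans ?_ hle
        gcongr
        have : (0 : ℝ) ≤ m := by positivity
        linarith
      · rw [hd, hd]
        exact hG.antitone ha.le hs (by positivity) (by push_cast; linarith)
    have htriv : ‖∑ m ∈ range L', e (φ (X + m))‖ ≤ L :=
      (norm_sum_e_le (fun m => φ (X + m)) L').trans (by exact_mod_cast hL')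
    have h3 : (1 : ℝ) ≤ 3 ^ n := one_le_pow₀ (by norm_num)
    have hH0 : 0 ≤ (H : ℝ) ^ (-1 : ℝ) := by positivity
    rcases le_total Y 1 with hY1 | hY1
    · have : Y ≤ Y ^ (1 / 2 : ℝ) := by
        conv_lhs => rw [← Real.rpow_one Y]
        exact Real.rpow_le_rpow_of_exponent_ge hY0 hY1 (by norm_num)
      calc _ ≤ 2 * 3 ^ n * (L * Y) := hKL
        _ = 2 * 3 ^ n * L * (0 + Y) := by ring
        _ ≤ _ := by gcongr
    · have : 1 ≤ Y ^ (1 / 2 : ℝ) := Real.one_le_rpow hY1 (by norm_num)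
      calc _ ≤ (L : ℝ) := htriv
        _ = 1 * L * (0 + 1) := by ring
        _ ≤ _ := by gcongr; linarith
  | succ k ih =>
    obtain ⟨C, hC1, hC⟩ := ih (n + 1)
    refine ⟨2 + 8 * C, by linarith, ?_⟩
    intro a b s G φ X L H hG ha hb hs hn hH hHL hLX hsX hle hφ L' hL'
    have hL1 : 1 ≤ L := le_trans (Nat.one_le_pow _ _ hH) hHL
    have hL0 : (1 : ℝ) ≤ L := by exact_mod_cast hL1
    have hX0 : 0 < X := by linarith
    have hH1 : (1 : ℝ) ≤ H := by exact_mod_cast hH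
    have hH0 : (0 : ℝ) < H := by linarith
    have hn1 : (1 : ℝ) ≤ n := by exact_mod_cast hn
    set θ : ℝ := (1 / 2 : ℝ) ^ k with hθ
    have hθ0 : 0 < θ := by positivity
    have hθ1 : θ ≤ 1 := pow_le_one₀ (by norm_num) (by norm_num)
    set Y := X ^ (n + (k + 1)) / (a * L * H ^ (k + 1)) with hY
    have hY0 : 0 < Y := by positivity
    have e1 : (1 / 2 : ℝ) ^ (k + 1) = θ / 2 := by rw [pow_succ]; ring
    have e2 : (1 / 2 : ℝ) ^ (k + 1 + 1) = θ / 4 := by rw [pow_succ, pow_succ]; ring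
    rw [e1, e2]
    have hHr0 : 0 < (H : ℝ) ^ (-(θ / 2)) := by positivity
    have hYr0 : 0 < Y ^ (θ / 4) := by positivity
    rcases lt_or_ge L' H with hLH | hLH
    · calc _ ≤ (L' : ℝ) := norm_sum_e_le (fun m => φ (X + m)) L'
        _ ≤ L * (H : ℝ) ^ (-1 : ℝ) := by
          rw [Real.rpow_neg_one, ← div_eq_mul_inv, le_div_iff₀ hH0]
          have : L' * H ≤ L := le_trans (Nat.mul_le_mul_right _ hLH.le) (by rwa [← sq])
          exact_mod_cast this
        _ ≤ L * (H : ℝ) ^ (-(θ / 2)) := by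
          refine mul_le_mul_of_nonneg_left ?_ (by positivity)
          exact Real.rpow_le_rpow_of_exponent_le hH1 (by linarith)
        _ = 1 * L * ((H : ℝ) ^ (-(θ / 2)) + 0) := by ring
        _ ≤ _ := by gcongr; linarith
    · have hv := van_der_corput_ineq (fun m => e (φ (X + m))) (fun m => (norm_e _).le) hH hLH
      have hSh : ∀ h ∈ Ico 1 H, ‖∑ m ∈ range (L' - h),
          e (φ (X + (m + h : ℕ))) * (starRingEnd ℂ) (e (φ (X + m)))‖ ≤
          C * L * ((H : ℝ) ^ (-θ) + ((H : ℝ) / h) ^ (θ / 2) * Y ^ (θ / 2)) := by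
        intro h hh
        rw [mem_Ico] at hh
        have h0 : (0 : ℝ) < h := by exact_mod_cast hh.1
        have h1 : (h : ℝ) ≤ H := by exact_mod_cast hh.2.le
        have hasc : (n.ascFactorial (k + 1) : ℝ) = n * (n + 1).ascFactorial k := by
          rw [Nat.ascFactorial_succ, ← Nat.succ_ascFactorial]; push_cast; rfl
        have := hC (a * h * n) (b * h * n) (s + h) _ (fun x => φ x - φ (x + h)) X L H
          (hG.sub_shift ha.le hb.le hs h0) (by positivity) (by positivity) (by positivity)
          (by omega) hH hHL hLX (by push_cast at hsX; linarith) ?_ ?_ (L' - h) (by omega)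
        · rw [← RCLike.norm_conj, map_sum]
          have h5 : ∀ m ∈ range (L' - h), (starRingEnd ℂ) (e (φ (X + (m + h : ℕ))) *
              (starRingEnd ℂ) (e (φ (X + m)))) = e (φ (X + m) - φ (X + m + h)) := by
            intro m _
            rw [map_mul, Complex.conj_conj, conj_e, ← e_add]
            push_cast; ring_nf
          rw [sum_congr rfl h5]
          refine this.trans ?_
          rw [e1, ← Real.mul_rpow (by positivity) hY0.le]
          gcongr
          rw [hY, show n + 1 + k = n + (k + 1) by ring]
          calc _ ≤ X ^ (n + (k + 1)) / (a * h * 1 * L * H ^ k) := by gcongr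
            _ = _ := by rw [pow_succ (H : ℝ)]; field_simp
        · refine le_trans ?_ hle
          rw [hasc, show n + 1 + k = n + (k + 1) by ring, pow_succ]
          calc _ = b * (n * (n + 1).ascFactorial k) * (H ^ k * h) / X ^ (n + (k + 1)) := by ring
            _ ≤ _ := by gcongr
        · intro x hx
          have h6 := hφ x hx
          have h7 := hφ (x + h) (by positivity)
          rw [show x + 1 + h = x + h + 1 by ring]
          linarith
      have hsum : ∑ h ∈ Ico 1 H, ‖∑ m ∈ range (L' - h),
          e (φ (X + (m + h : ℕ))) * (starRingEnd ℂ) (e (φ (X + m)))‖ ≤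
          C * L * H * ((H : ℝ) ^ (-θ) + 2 * Y ^ (θ / 2)) := by
        refine (sum_le_sum hSh).trans ?_
        rw [← mul_sum, sum_add_distrib, ← sum_mul]
        have h8 := sum_div_rpow_le H (β := θ / 2) (by linarith)
        have h9 : ∑ h ∈ Ico 1 H, (H : ℝ) ^ (-θ) ≤ H * (H : ℝ) ^ (-θ) := by
          rw [sum_const, Nat.card_Ico, nsmul_eq_mul]
          gcongr
          exact_mod_cast Nat.sub_le H 1
        calc _ ≤ C * L * (H * (H : ℝ) ^ (-θ) + 2 * H * Y ^ (θ / 2)) := by gcongr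
          _ = _ := by ring
      have hHH : 1 / (H : ℝ) ≤ (H : ℝ) ^ (-θ) := by
        rw [one_div, ← Real.rpow_neg_one]
        exact Real.rpow_le_rpow_of_exponent_le hH1 (by linarith)
      have hHsq : (H : ℝ) ^ (-θ) = ((H : ℝ) ^ (-(θ / 2))) ^ 2 := by
        rw [← Real.rpow_natCast, ← Real.rpow_mul hH0.le]; norm_num
      have hYsq : Y ^ (θ / 2) = (Y ^ (θ / 4)) ^ 2 := by
        rw [← Real.rpow_natCast, ← Real.rpow_mul hY0.le]; congr 1; push_cast; ring
      set A := (H : ℝ) ^ (-(θ / 2)) with hA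
      set B := Y ^ (θ / 4) with hB
      have hL'r : (L' : ℝ) ≤ L := by exact_mod_cast hL'
      refine le_of_sq_le_sq (hv.trans ?_) (by positivity)
      calc _ ≤ 2 * L / H * (L + 2 * (C * L * H * ((H : ℝ) ^ (-θ) + 2 * Y ^ (θ / 2)))) := by gcongr
        _ = L ^ 2 * (2 * (1 / H) + 4 * C * ((H : ℝ) ^ (-θ) + 2 * Y ^ (θ / 2))) := by
          field_simp; ring
        _ ≤ L ^ 2 * (2 * A ^ 2 + 4 * C * (A ^ 2 + 2 * B ^ 2)) := by
          rw [← hHsq, hYsq]; gcongr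
        _ ≤ L ^ 2 * ((2 + 8 * C) ^ 2 * (A + B) ^ 2) := by
          gcongr
          have : 0 ≤ A * B := by positivity
          have : A ^ 2 + B ^ 2 ≤ (A + B) ^ 2 := by nlinarith
          have hCC : 2 + 8 * C ≤ (2 + 8 * C) ^ 2 := by
            rw [sq]; exact le_mul_of_one_le_left (by linarith) (by linarith)
          have hA2 : 0 ≤ C * A ^ 2 := by positivity
          have hB2 : 0 ≤ B ^ 2 := by positivity
          calc _ ≤ (2 + 8 * C) * (A ^ 2 + B ^ 2) := by linarith
            _ ≤ (2 + 8 * C) ^ 2 * (A + B) ^ 2 := by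
              refine mul_le_mul hCC this (by positivity) (by positivity)
        _ = _ := by ring

end SiegelWalfisz

namespace SiegelWalfisz

lemma isMonomialLike_log {c : ℝ} (hc : 0 ≤ c) : ∃ G : ℕ → ℝ → ℝ, IsMonomialLike 1 c c 1 G ∧
    ∀ x, 0 < x → c * Real.log (x + 1) - c * Real.log x = G 0 x := by
  set F : ℕ → ℝ → ℝ := fun j x => if j = 0 then -(c * Real.log x) else c * (j - 1).factorial / x ^ j
    with hF
  have hder : ∀ j x, 0 < x → HasDerivAt (F j) (-(F (j + 1) x)) x := by
    intro j x hx
    rcases j with _ | j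
    · have := ((Real.hasDerivAt_log hx.ne').const_mul c).neg
      have h2 : F 0 = -fun y => c * Real.log y := by funext y; simp [hF]
      rw [h2]
      refine this.congr_deriv ?_
      simp [hF, div_eq_mul_inv]
    · have h1 := ((hasDerivAt_pow (j + 1) x).inv (pow_ne_zero _ hx.ne')).const_mul
        (c * (j.factorial : ℝ))
      have h2 : F (j + 1) = fun x => c * (j.factorial : ℝ) * (x ^ (j + 1))⁻¹ := by
        funext y; simp [hF, div_eq_mul_inv]
      rw [h2]
      refine h1.congr_deriv ?_
      simp only [hF, Nat.add_eq_zero_iff, one_ne_zero, and_false, if_false, Nat.add_sub_cancel,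
        Nat.factorial_succ]
      push_cast
      field_simp
      ring
  have mvt : ∀ j x, 0 < x → ∃ ξ ∈ Set.Ioo x (x + 1), F j x - F j (x + 1) = F (j + 1) ξ := by
    intro j x hx
    obtain ⟨ξ, hξ, h1⟩ := exists_hasDerivAt_eq_slope (F j) (fun y => -(F (j + 1) y))
      (show x < x + 1 by linarith)
      (fun y hy => (hder j y (by linarith [hy.1])).continuousAt.continuousWithinAt)
      (fun y hy => hder j y (by linarith [hy.1]))
    refine ⟨ξ, hξ, ?_⟩
    have h2 : x + 1 - x = 1 := by ring
    rw [h2, div_one] at h1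
    linarith
  refine ⟨fun j x => F j x - F j (x + 1), ⟨fun j x hx => ?_, fun j x hx => ?_, fun j x hx => ?_⟩,
    ?_⟩
  · have h1 := hder j x hx
    have h2 := (hder j (x + 1) (by linarith)).comp_add_const x 1
    exact (h1.sub h2).congr_deriv (by ring)
  · obtain ⟨ξ, hξ, h1⟩ := mvt j x hx
    have h0 : 0 < ξ := by linarith [hξ.1]
    have h3 := hξ.2
    rw [h1]
    simp only [hF, Nat.add_eq_zero_iff, one_ne_zero, and_false, if_false, Nat.add_sub_cancel,
      Nat.one_ascFactorial]
    rw [add_comm 1 j]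
    gcongr
  · obtain ⟨ξ, hξ, h1⟩ := mvt j x hx
    have h0 : 0 < ξ := by linarith [hξ.1]
    have h3 := hξ.1
    rw [h1]
    simp only [hF, Nat.add_eq_zero_iff, one_ne_zero, and_false, if_false, Nat.add_sub_cancel,
      Nat.one_ascFactorial]
    rw [add_comm 1 j]
    gcongr
  · intro x hx
    simp [hF]; ring

/-- Weyl's bound for the sums `∑ (X + m)^{it}`, uniform in ranges `t ≤ X ^ M`. -/
theorem weyl_log_sum_le (M : ℝ) : ∃ δ : ℝ, 0 < δ ∧ δ ≤ 1 / 32 ∧ ∃ C : ℝ, 1 ≤ C ∧ ∀ t X : ℝ,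
    1 ≤ t → 1 ≤ X → t ≤ X ^ M → X ≤ t ^ 3 → ∀ L : ℕ, (L : ℝ) ≤ X →
    ‖∑ m ∈ range L, e (t / (2 * π) * Real.log (X + m))‖ ≤ C * X ^ (1 - δ) := by
  set K : ℕ := ⌈2 * M⌉₊ with hK
  choose C hC1 hC using fun k => weyl_sum_le k 1
  obtain ⟨W, hW⟩ : ∃ W : ℝ, W = (K.factorial : ℝ) + K + 2 := ⟨_, rfl⟩
  have hW1 : 1 < W := by
    have : (0 : ℝ) ≤ K.factorial := by positivity
    have : (0 : ℝ) ≤ K := by positivity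
    linarith
  set X0 : ℝ := W ^ 32 with hX0
  set B : ℝ := 2 * π * 2 ^ K with hB
  have hX01 : 1 ≤ X0 := one_le_pow₀ hW1.le
  set θ : ℝ := (1 / 2 : ℝ) ^ K with hθ
  have hθ0 : 0 < θ := by positivity
  have hθ1 : θ ≤ 1 := pow_le_one₀ (by norm_num) (by norm_num)
  have hB1 : 1 ≤ B := by
    have h1 : (1 : ℝ) ≤ 2 ^ K := one_le_pow₀ (by norm_num)
    have h2 : 1 ≤ 2 * π := by linarith [Real.pi_gt_three]
    exact one_le_mul_of_one_le_of_one_le h2 h1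
  set D : ℝ := ∑ k ∈ range (K + 1), C k with hD
  have hCD : ∀ k ≤ K, C k ≤ D := fun k hk =>
    single_le_sum (f := C) (fun i _ => by linarith [hC1 i]) (mem_range.2 (by omega))
  have hD1 : 1 ≤ D := (hC1 0).trans (hCD 0 (by omega))
  refine ⟨θ / 32, by positivity, by linarith, X0 + D * (2 + B), ?_, ?_⟩
  · have : 0 ≤ D * (2 + B) := by positivity
    linarith
  intro t X ht hX htX hXt L hLX
  have hXpos : 0 < X := by linarith
  have htriv := norm_sum_e_le (fun m => t / (2 * π) * Real.log (X + m)) L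
  have hXr : 1 ≤ X ^ (1 - θ / 32) := Real.one_le_rpow hX (by linarith)
  have hDB : 0 ≤ D * (2 + B) := by positivity
  rcases lt_or_ge X X0 with hXX | hXX
  · calc _ ≤ (L : ℝ) := htriv
      _ ≤ X0 * 1 := by linarith
      _ ≤ _ := by gcongr; linarith
  rcases lt_or_ge (L : ℝ) (X ^ (31 / 32 : ℝ)) with hL | hL
  · calc _ ≤ (L : ℝ) := htriv
      _ ≤ X ^ (31 / 32 : ℝ) := hL.le
      _ ≤ X ^ (1 - θ / 32) := Real.rpow_le_rpow_of_exponent_le hX (by linarith)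
      _ = 1 * X ^ (1 - θ / 32) := by ring
      _ ≤ _ := by gcongr; linarith
  have hXgt : 1 < X := (one_lt_pow₀ hW1 (by norm_num)).trans_le hXX
  have hlogX : 0 < Real.log X := Real.log_pos hXgt
  set τ : ℝ := Real.log t / Real.log X with hτ
  have hXτ : X ^ τ = t := by
    rw [Real.rpow_def_of_pos hXpos, hτ, mul_div_cancel₀ _ hlogX.ne', Real.exp_log (by linarith)]
  have hτM : τ ≤ M := by
    rw [hτ, div_le_iff₀ hlogX, ← Real.log_rpow hXpos]
    exact Real.log_le_log (by linarith) htX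
  have hτ3 : 1 / 3 ≤ τ := by
    have := Real.log_le_log hXpos hXt
    rw [Real.log_pow] at this
    rw [hτ, le_div_iff₀ hlogX]
    push_cast at this
    linarith
  set k : ℕ := ⌈(τ - 31 / 32) * (8 / 7)⌉₊ with hk
  have hk1 : τ - 31 / 32 ≤ 7 * k / 8 := by
    have := Nat.le_ceil ((τ - 31 / 32) * (8 / 7))
    rw [← hk] at this
    linarith
  have hk2 : 7 * (k : ℝ) / 8 - τ ≤ -(3 / 32) := by
    rcases Nat.eq_zero_or_pos k with h0 | h0
    · rw [h0]; push_cast; linarith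
    · have h1 : 0 < (τ - 31 / 32) * (8 / 7) := Nat.ceil_pos.1 (hk ▸ h0)
      have := Nat.ceil_lt_add_one h1.le
      rw [← hk] at this
      linarith
  have hkK : k ≤ K := by
    refine Nat.ceil_le_ceil ?_
    linarith
  set H : ℕ := ⌊X ^ (1 / 8 : ℝ)⌋₊ with hH
  have hX8 : 1 ≤ X ^ (1 / 8 : ℝ) := Real.one_le_rpow hX (by norm_num)
  have hHle : (H : ℝ) ≤ X ^ (1 / 8 : ℝ) := Nat.floor_le (by positivity)
  have hH1 : 1 ≤ H := Nat.one_le_floor_iff _ |>.2 hX8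
  have hHge : X ^ (1 / 8 : ℝ) / 2 ≤ H := by
    have := Nat.lt_floor_add_one (X ^ (1 / 8 : ℝ))
    rw [← hH] at this
    have : (1 : ℝ) ≤ H := by exact_mod_cast hH1
    linarith
  have hH0 : (0 : ℝ) < H := by exact_mod_cast hH1
  have hX32 : (K.factorial : ℝ) + K + 2 ≤ X ^ (1 / 32 : ℝ) := by
    rw [← hW]
    have := Real.rpow_le_rpow (by positivity) hXX (show (0 : ℝ) ≤ 1 / 32 by norm_num)
    refine le_trans (le_of_eq ?_) this
    rw [hX0, ← Real.rpow_natCast, ← Real.rpow_mul (by positivity)]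
    norm_num
  have hL0 : (0 : ℝ) < L := lt_of_lt_of_le (by positivity) hL
  have hHL : H ^ 2 ≤ L := by
    have : (H : ℝ) ^ 2 ≤ L := by
      calc (H : ℝ) ^ 2 ≤ (X ^ (1 / 8 : ℝ)) ^ 2 := by gcongr
        _ = X ^ (1 / 4 : ℝ) := by
          rw [← Real.rpow_natCast, ← Real.rpow_mul hXpos.le]; norm_num
        _ ≤ X ^ (31 / 32 : ℝ) := Real.rpow_le_rpow_of_exponent_le hX (by norm_num)
        _ ≤ L := hL
    exact_mod_cast this
  have hkKr : (k : ℝ) ≤ K := by exact_mod_cast hkK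
  have hKf : (0 : ℝ) ≤ K.factorial := by positivity
  have hsX : 1 + (k : ℝ) * H ≤ X := by
    calc 1 + (k : ℝ) * H ≤ X ^ (1 / 8 : ℝ) + K * X ^ (1 / 8 : ℝ) := by gcongr
      _ = (1 + K) * X ^ (1 / 8 : ℝ) := by ring
      _ ≤ X ^ (1 / 32 : ℝ) * X ^ (1 / 8 : ℝ) := by gcongr; linarith
      _ = X ^ (5 / 32 : ℝ) := by rw [← Real.rpow_add hXpos]; norm_num
      _ ≤ X ^ (1 : ℝ) := Real.rpow_le_rpow_of_exponent_le hX (by norm_num)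
      _ = X := Real.rpow_one X
  have hpi := Real.pi_gt_three
  have hle : t / (2 * π) * (1 : ℕ).ascFactorial k * H ^ k / X ^ (1 + k) ≤ 1 / 2 := by
    rw [Nat.one_ascFactorial, ← hXτ]
    have hkf : (k.factorial : ℝ) ≤ K.factorial := by exact_mod_cast Nat.factorial_le hkK
    have h1 : (H : ℝ) ^ k ≤ X ^ (k / 8 : ℝ) := by
      calc _ ≤ (X ^ (1 / 8 : ℝ)) ^ k := by gcongr
        _ = _ := by rw [← Real.rpow_natCast, ← Real.rpow_mul hXpos.le]; congr 1; ring
    have h2 : X ^ τ * X ^ (k / 8 : ℝ) / X ^ (1 + k) ≤ X ^ (-(1 / 32) : ℝ) := by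
      rw [← Real.rpow_natCast, ← Real.rpow_add hXpos, ← Real.rpow_sub hXpos]
      refine Real.rpow_le_rpow_of_exponent_le hX ?_
      push_cast; linarith
    have h3 : X ^ (-(1 / 32) : ℝ) * K.factorial ≤ 1 := by
      rw [Real.rpow_neg hXpos.le, inv_mul_le_iff₀ (by positivity)]
      linarith
    calc _ ≤ X ^ τ / (2 * 3) * K.factorial * X ^ (k / 8 : ℝ) / X ^ (1 + k) := by gcongr
      _ = (X ^ τ * X ^ (k / 8 : ℝ) / X ^ (1 + k)) * K.factorial / 6 := by ring
      _ ≤ X ^ (-(1 / 32) : ℝ) * K.factorial / 6 := by gcongr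
      _ ≤ 1 / 2 := by linarith
  obtain ⟨G, hG, hG0⟩ := isMonomialLike_log (c := t / (2 * π)) (by positivity)
  have hmain := hC k (t / (2 * π)) (t / (2 * π)) 1 G (fun x => t / (2 * π) * Real.log x) X L H hG
    (by positivity) (by positivity) zero_le_one le_rfl hH1 hHL hLX hsX hle hG0 L le_rfl
  set θk : ℝ := (1 / 2 : ℝ) ^ k with hθk
  have hθk0 : 0 < θk := by positivity
  have hθk1 : θk ≤ 1 := pow_le_one₀ (by norm_num) (by norm_num)
  have hθθ : θ ≤ θk := pow_le_pow_of_le_one (by norm_num) (by norm_num) hkK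
  have e1 : (1 / 2 : ℝ) ^ (k + 1) = θk / 2 := by rw [pow_succ]; ring
  rw [e1] at hmain
  have hY : X ^ (1 + k) / (t / (2 * π) * L * H ^ k) ≤ B * X ^ (-(1 / 16) : ℝ) := by
    have h1 : X ^ (k / 8 : ℝ) / 2 ^ K ≤ (H : ℝ) ^ k := by
      calc X ^ (k / 8 : ℝ) / 2 ^ K ≤ X ^ (k / 8 : ℝ) / 2 ^ k := by
            gcongr
            norm_num
        _ = (X ^ (1 / 8 : ℝ) / 2) ^ k := by
            rw [div_pow]
            congr 1
            rw [← Real.rpow_natCast (X ^ (1 / 8 : ℝ)), ← Real.rpow_mul hXpos.le]; congr 1; ring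
        _ ≤ _ := by gcongr
    calc _ ≤ X ^ (1 + k) / (t / (2 * π) * X ^ (31 / 32 : ℝ) * (X ^ (k / 8 : ℝ) / 2 ^ K)) := by
          gcongr
      _ = B * (X ^ (1 + k) / (X ^ τ * X ^ (31 / 32 : ℝ) * X ^ (k / 8 : ℝ))) := by
          rw [hXτ, hB]; field_simp
      _ ≤ _ := by
          gcongr
          rw [← Real.rpow_natCast, ← Real.rpow_add hXpos, ← Real.rpow_add hXpos,
            ← Real.rpow_sub hXpos]
          refine Real.rpow_le_rpow_of_exponent_le hX ?_
          push_cast; linarith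
  have hP1 : (H : ℝ) ^ (-θk) ≤ 2 * X ^ (-(θ / 32)) := by
    calc (H : ℝ) ^ (-θk) ≤ (X ^ (1 / 8 : ℝ) / 2) ^ (-θk) :=
          Real.rpow_le_rpow_of_nonpos (by positivity) hHge (by linarith)
      _ = 2 ^ θk * X ^ (1 / 8 * -θk) := by
          rw [Real.div_rpow (by positivity) (by norm_num), ← Real.rpow_mul hXpos.le,
            Real.rpow_neg (by norm_num : (0 : ℝ) ≤ 2)]
          field_simp
      _ ≤ 2 ^ (1 : ℝ) * X ^ (-(θ / 32)) := by
          gcongr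
          · norm_num
          · linarith
      _ = _ := by rw [Real.rpow_one]
  have hP2 : (X ^ (1 + k) / (t / (2 * π) * L * H ^ k)) ^ (θk / 2) ≤ B * X ^ (-(θ / 32)) := by
    calc _ ≤ (B * X ^ (-(1 / 16) : ℝ)) ^ (θk / 2) :=
          Real.rpow_le_rpow (by positivity) hY (by positivity)
      _ = B ^ (θk / 2) * X ^ (-(1 / 16) * (θk / 2)) := by
          rw [Real.mul_rpow (by positivity) (by positivity), ← Real.rpow_mul hXpos.le]
      _ ≤ B ^ (1 : ℝ) * X ^ (-(θ / 32)) := by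
          gcongr
          · linarith
          · linarith
      _ = _ := by rw [Real.rpow_one]
  calc _ ≤ _ := hmain
    _ ≤ D * X * (2 * X ^ (-(θ / 32)) + B * X ^ (-(θ / 32))) := by
      have := hCD k hkK
      gcongr
    _ = D * (2 + B) * X ^ (1 - θ / 32) := by
      rw [sub_eq_add_neg, Real.rpow_add hXpos, Real.rpow_one]; ring
    _ ≤ _ := by gcongr; linarith

end SiegelWalfisz

namespace SiegelWalfisz

open MeasureTheory

section Truncation

variable {f : ℕ → ℂ} {l : ℂ} {B : ℝ}

/-- The oscillating part of the summatory function of `f` beyond `Z`. -/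
noncomputable def tailRemainder (f : ℕ → ℂ) (l : ℂ) (Z : ℕ) (u : ℝ) : ℂ :=
  if (Z : ℝ) < u then (∑ k ∈ Icc 1 ⌊u⌋₊, f k - l * u) - (∑ k ∈ Icc 1 Z, f k - l * Z) else 0

lemma norm_tailRemainder_le (hB : ∀ u : ℝ, 1 ≤ u → ‖∑ k ∈ Icc 1 ⌊u⌋₊, f k - l * u‖ ≤ B) {Z : ℕ}
    (hZ : 1 ≤ Z) (u : ℝ) : ‖tailRemainder f l Z u‖ ≤ 2 * B := by
  have hZ1 : (1 : ℝ) ≤ Z := by exact_mod_cast hZ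
  have h1 := hB Z hZ1
  rw [Nat.floor_natCast] at h1
  push_cast at h1
  have hB0 : 0 ≤ B := (norm_nonneg _).trans h1
  rw [tailRemainder]
  split_ifs with h
  · have h2 := hB u (by linarith)
    refine (norm_sub_le _ _).trans ?_
    linarith
  · rw [norm_zero]; positivity

lemma measurable_tailRemainder (f : ℕ → ℂ) (l : ℂ) (Z : ℕ) : Measurable (tailRemainder f l Z) := by
  unfold tailRemainder
  refine Measurable.ite measurableSet_Ioi ?_ measurable_const
  refine Measurable.sub (Measurable.sub ?_ ?_) measurable_const
  · exact (measurable_from_nat (f := fun n => ∑ k ∈ Icc 1 n, f k)).comp Nat.measurable_floor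
  · exact measurable_const.mul Complex.measurable_ofReal

lemma locallyIntegrableOn_tailRemainder
    (hB : ∀ u : ℝ, 1 ≤ u → ‖∑ k ∈ Icc 1 ⌊u⌋₊, f k - l * u‖ ≤ B) {Z : ℕ} (hZ : 1 ≤ Z) :
    LocallyIntegrableOn (tailRemainder f l Z) (Set.Ioi 0) := by
  refine LocallyIntegrable.locallyIntegrableOn ?_ _
  intro x
  refine ⟨Set.Icc (x - 1) (x + 1), Icc_mem_nhds (by linarith) (by linarith), ?_⟩
  refine Measure.integrableOn_of_bounded (M := 2 * B) measure_Icc_lt_top.ne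
    (measurable_tailRemainder f l Z).aestronglyMeasurable ?_
  exact Filter.Eventually.of_forall fun u => norm_tailRemainder_le hB hZ u

/-- The analytic continuation of the oscillating part of the tail of a Dirichlet series. -/
noncomputable def tailTransform (f : ℕ → ℂ) (l : ℂ) (Z : ℕ) (s : ℂ) : ℂ :=
  s * mellin (tailRemainder f l Z) (-s)

lemma differentiableAt_tailTransform
    (hB : ∀ u : ℝ, 1 ≤ u → ‖∑ k ∈ Icc 1 ⌊u⌋₊, f k - l * u‖ ≤ B) {Z : ℕ} (hZ : 1 ≤ Z) {s : ℂ}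
    (hs : 0 < s.re) : DifferentiableAt ℂ (tailTransform f l Z) s := by
  have hm : DifferentiableAt ℂ (mellin (tailRemainder f l Z)) (-s) := by
    refine mellin_differentiableAt_of_isBigO_rpow (a := 0) (b := -s.re - 1)
      (locallyIntegrableOn_tailRemainder hB hZ) ?_ (by simpa using hs) ?_ (by simp)
    · simp only [neg_zero, Real.rpow_zero]
      exact Asymptotics.IsBigO.of_bound (2 * B) (Filter.Eventually.of_forall fun u => by
        simpa using norm_tailRemainder_le hB hZ u)
    · refine Asymptotics.IsBigO.of_bound 1 ?_
      have : Set.Ioo (0 : ℝ) 1 ∈ nhdsWithin (0 : ℝ) (Set.Ioi 0) := Ioo_mem_nhdsGT one_pos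
      filter_upwards [this] with u hu
      have hZ1 : (1 : ℝ) ≤ Z := by exact_mod_cast hZ
      rw [tailRemainder, if_neg (by linarith [hu.2]), norm_zero]
      positivity
  exact differentiableAt_id.mul (hm.comp s differentiableAt_id.neg)

lemma mellin_tailRemainder (f : ℕ → ℂ) (l : ℂ) (Z : ℕ) (s : ℂ) : mellin (tailRemainder f l Z) (-s) =
    ∫ u in Set.Ioi (Z : ℝ), (u : ℂ) ^ (-(s + 1)) * tailRemainder f l Z u := by
  rw [mellin]
  have h : ∀ u : ℝ, u ∉ Set.Ioi (Z : ℝ) → (u : ℂ) ^ (-(s + 1)) * tailRemainder f l Z u = 0 := by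
    intro u hu
    rw [tailRemainder, if_neg (show ¬ (Z : ℝ) < u from hu), mul_zero]
  have hsub : Set.Ioi (Z : ℝ) ⊆ Set.Ioi 0 := Set.Ioi_subset_Ioi (by positivity)
  refine Eq.trans ?_ (setIntegral_eq_of_subset_of_forall_sdiff_eq_zero measurableSet_Ioi hsub
    (f := fun u : ℝ => (u : ℂ) ^ (-(s + 1)) * tailRemainder f l Z u) (fun u hu => h u hu.2))
  refine setIntegral_congr_fun measurableSet_Ioi fun u _ => ?_
  simp only [smul_eq_mul]
  congr 2; ring

lemma norm_tailTransform_le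
    (hB : ∀ u : ℝ, 1 ≤ u → ‖∑ k ∈ Icc 1 ⌊u⌋₊, f k - l * u‖ ≤ B) {Z : ℕ} (hZ : 1 ≤ Z) {s : ℂ}
    (hs : 0 < s.re) :
    ‖tailTransform f l Z s‖ ≤ ‖s‖ * (2 * B * (Z : ℝ) ^ (-s.re) / s.re) := by
  have hZ1 : (1 : ℝ) ≤ Z := by exact_mod_cast hZ
  rw [tailTransform, mellin_tailRemainder, norm_mul]
  gcongr
  have h1 : ∫ u in Set.Ioi (Z : ℝ), 2 * B * u ^ (-(s.re + 1)) =
      2 * B * (Z : ℝ) ^ (-s.re) / s.re := by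
    rw [integral_const_mul, integral_Ioi_rpow_of_lt (by linarith) (by linarith)]
    rw [show -(s.re + 1) + 1 = -s.re by ring]
    field_simp
  rw [← h1]
  refine norm_integral_le_of_norm_le
    ((integrableOn_Ioi_rpow_of_lt (by linarith) (by linarith)).const_mul _) ?_
  refine (ae_restrict_iff' measurableSet_Ioi).2 (Filter.Eventually.of_forall fun u hu => ?_)
  have hu0 : 0 < u := by have : (Z : ℝ) < u := hu; linarith
  rw [norm_mul, Complex.norm_cpow_eq_rpow_re_of_pos hu0, mul_comm]
  simp only [Complex.neg_re, Complex.add_re, Complex.one_re]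
  gcongr
  exact norm_tailRemainder_le hB hZ u

lemma LSeries_eq_sum_add_tail (hf : ∀ n, ‖f n‖ ≤ 1)
    (hB : ∀ u : ℝ, 1 ≤ u → ‖∑ k ∈ Icc 1 ⌊u⌋₊, f k - l * u‖ ≤ B) {Z : ℕ} (hZ : 1 ≤ Z) {s : ℂ}
    (hs : 1 < s.re) :
    LSeries f s = ∑ k ∈ Icc 1 Z, f k / (k : ℂ) ^ s + l * (Z : ℂ) ^ (1 - s) / (s - 1) +
      tailTransform f l Z s := by
  have hZ1 : (1 : ℝ) ≤ Z := by exact_mod_cast hZ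
  set f1 : ℕ → ℂ := fun n => if n ≤ Z then f n else 0 with hf1
  set f2 : ℕ → ℂ := fun n => if Z < n then f n else 0 with hf2
  have hff : f = f1 + f2 := by
    funext n
    simp only [hf1, hf2, Pi.add_apply]
    by_cases h : n ≤ Z
    · simp [h]
    · simp [h, not_le.1 h]
  have hb1 : ∀ n, ‖f1 n‖ ≤ 1 := fun n => by
    simp only [hf1]; split_ifs; exacts [hf n, by simp]
  have hb2 : ∀ n, ‖f2 n‖ ≤ 1 := fun n => by
    simp only [hf2]; split_ifs; exacts [hf n, by simp]
  have hS1 : LSeriesSummable f1 s := LSeriesSummable_of_bounded_of_one_lt_re (fun n _ => hb1 n) hs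
  have hS2 : LSeriesSummable f2 s := LSeriesSummable_of_bounded_of_one_lt_re (fun n _ => hb2 n) hs
  have hL1 : LSeries f1 s = ∑ k ∈ Icc 1 Z, f k / (k : ℂ) ^ s := by
    rw [LSeries, tsum_eq_sum (s := Icc 1 Z)]
    · refine sum_congr rfl fun k hk => ?_
      rw [mem_Icc] at hk
      rw [LSeries.term_def, if_neg (by omega), hf1]
      simp only
      rw [if_pos hk.2]
    · intro k hk
      rw [mem_Icc] at hk
      rw [LSeries.term_def]
      split_ifs with h
      · rfl
      · simp only [hf1]
        rw [if_neg (by omega), zero_div]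
  have hO : (fun n : ℕ => ∑ k ∈ Icc 1 n, ‖f2 k‖) =O[Filter.atTop] fun n => (n : ℝ) ^ (1 : ℝ) := by
    refine Asymptotics.IsBigO.of_bound 1 (Filter.Eventually.of_forall fun n => ?_)
    rw [Real.norm_of_nonneg (by positivity), Real.rpow_one, Real.norm_of_nonneg (by positivity),
      one_mul]
    calc _ ≤ ∑ k ∈ Icc 1 n, (1 : ℝ) := sum_le_sum fun k _ => hb2 k
      _ = n := by simp
  have hL2 := LSeries_eq_mul_integral' f2 zero_le_one hs hO
  have hsum2 : ∀ u : ℝ, 1 < u → ∑ k ∈ Icc 1 ⌊u⌋₊, f2 k =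
      if (Z : ℝ) < u then l * (u - Z) + tailRemainder f l Z u else 0 := by
    intro u hu
    split_ifs with h
    · rw [tailRemainder, if_pos h]
      have hZu : Z ≤ ⌊u⌋₊ := Nat.le_floor h.le
      have h3 : ∑ k ∈ Icc 1 ⌊u⌋₊, f2 k = ∑ k ∈ Icc 1 ⌊u⌋₊, f k - ∑ k ∈ Icc 1 ⌊u⌋₊, f1 k := by
        rw [← sum_sub_distrib]
        refine sum_congr rfl fun k _ => ?_
        rw [hff]; simp
      have h4 : ∑ k ∈ Icc 1 ⌊u⌋₊, f1 k = ∑ k ∈ Icc 1 Z, f k := by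
        rw [hf1, ← sum_filter]
        refine sum_congr ?_ fun _ _ => rfl
        ext k; simp only [mem_filter, mem_Icc]; omega
      rw [h3, h4]; ring
    · refine sum_eq_zero fun k hk => ?_
      rw [mem_Icc] at hk
      have : (k : ℝ) ≤ u := (Nat.cast_le.2 hk.2).trans (Nat.floor_le (by linarith))
      simp only [hf2]
      rw [if_neg]
      intro h5
      have : (Z : ℝ) < k := by exact_mod_cast h5
      linarith
  have hsub : Set.Ioi (Z : ℝ) ⊆ Set.Ioi 1 := Set.Ioi_subset_Ioi hZ1
  have hInt : ∫ u in Set.Ioi (1 : ℝ), (∑ k ∈ Icc 1 ⌊u⌋₊, f2 k) * (u : ℂ) ^ (-(s + 1)) =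
      ∫ u in Set.Ioi (Z : ℝ), (l * ((u : ℂ) ^ (-s) - Z * (u : ℂ) ^ (-(s + 1))) +
        (u : ℂ) ^ (-(s + 1)) * tailRemainder f l Z u) := by
    refine (setIntegral_eq_of_subset_of_forall_sdiff_eq_zero measurableSet_Ioi hsub ?_).trans ?_
    · intro u hu
      rw [hsum2 u hu.1, if_neg (show ¬ (Z : ℝ) < u from hu.2), zero_mul]
    · refine setIntegral_congr_fun measurableSet_Ioi fun u hu => ?_
      have hu1 : 1 < u := hsub hu
      have hu' : (Z : ℝ) < u := hu
      rw [hsum2 u hu1, if_pos hu']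
      have hu0 : (u : ℂ) ≠ 0 := by exact_mod_cast (by linarith : u ≠ 0)
      have : (u : ℂ) ^ (-s) = u * (u : ℂ) ^ (-(s + 1)) := by
        rw [show -s = 1 + -(s + 1) by ring, Complex.cpow_add _ _ hu0, Complex.cpow_one]
      rw [this]; ring
  have hI1 : IntegrableOn (fun u : ℝ => (u : ℂ) ^ (-s)) (Set.Ioi (Z : ℝ)) :=
    integrableOn_Ioi_cpow_of_lt (by simpa using hs) (by linarith)
  have hI2 : IntegrableOn (fun u : ℝ => (u : ℂ) ^ (-(s + 1))) (Set.Ioi (Z : ℝ)) :=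
    integrableOn_Ioi_cpow_of_lt (by simp; linarith) (by linarith)
  have hI3 : IntegrableOn (fun u : ℝ => (u : ℂ) ^ (-(s + 1)) * tailRemainder f l Z u)
      (Set.Ioi (Z : ℝ)) := by
    refine hI2.mul_bdd (c := 2 * B) (measurable_tailRemainder f l Z).aestronglyMeasurable ?_
    exact Filter.Eventually.of_forall fun u => norm_tailRemainder_le hB hZ u
  have hs0 : s ≠ 0 := by
    intro h; rw [h] at hs; simp at hs; linarith
  have hs1 : s - 1 ≠ 0 := by
    intro h
    have : s.re - 1 = 0 := by simpa using congrArg Complex.re h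
    linarith
  have hs2 : 1 - s ≠ 0 := by rw [← neg_sub]; exact neg_ne_zero.2 hs1
  have hZc : (Z : ℂ) ≠ 0 := by exact_mod_cast (by omega : Z ≠ 0)
  have hI4 : IntegrableOn (fun u : ℝ => l * ((u : ℂ) ^ (-s) - Z * (u : ℂ) ^ (-(s + 1))))
      (Set.Ioi (Z : ℝ)) := (hI1.sub (hI2.const_mul _)).const_mul _
  have hLS : LSeries f s = LSeries f1 s + LSeries f2 s := by rw [← LSeries_add hS1 hS2, ← hff]
  rw [hLS, hL1, hL2, hInt, integral_add hI4 hI3, integral_const_mul,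
    integral_sub hI1 (hI2.const_mul _), integral_const_mul,
    integral_Ioi_cpow_of_lt (by simpa using hs) (by linarith),
    integral_Ioi_cpow_of_lt (by simp; linarith) (by linarith), tailTransform,
    mellin_tailRemainder, mul_add, ← add_assoc]
  congr 2
  have e1 : -(s + 1) + 1 = -s := by ring
  have e2 : -s + 1 = 1 - s := by ring
  have e3 : (Z : ℂ) ^ (1 - s) = Z * (Z : ℂ) ^ (-s) := by
    rw [sub_eq_add_neg, Complex.cpow_add _ _ hZc, Complex.cpow_one]
  rw [e1, e2]
  push_cast
  rw [e3]
  field_simp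
  ring

/-- A function continuing `(s - 1) ∑ f(n) n⁻ˢ` is given by the truncated formula in `0 < re s`. -/
lemma eq_sum_add_tail_of_entire (hf : ∀ n, ‖f n‖ ≤ 1)
    (hB : ∀ u : ℝ, 1 ≤ u → ‖∑ k ∈ Icc 1 ⌊u⌋₊, f k - l * u‖ ≤ B) {Z : ℕ} (hZ : 1 ≤ Z)
    {h : ℂ → ℂ} (hh : Differentiable ℂ h) (hL : ∀ s : ℂ, 1 < s.re → h s = (s - 1) * LSeries f s)
    {s : ℂ} (hs : 0 < s.re) :
    h s = (s - 1) * (∑ k ∈ Icc 1 Z, f k / (k : ℂ) ^ s + tailTransform f l Z s) +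
      l * (Z : ℂ) ^ (1 - s) := by
  have hopen : IsOpen {z : ℂ | 0 < z.re} := isOpen_lt continuous_const Complex.continuous_re
  have hopen1 : IsOpen {z : ℂ | 1 < z.re} := isOpen_lt continuous_const Complex.continuous_re
  have hZc : (Z : ℂ) ≠ 0 := by exact_mod_cast (by omega : Z ≠ 0)
  have hd : DifferentiableOn ℂ (fun s => (s - 1) * (∑ k ∈ Icc 1 Z, f k / (k : ℂ) ^ s +
      tailTransform f l Z s) + l * (Z : ℂ) ^ (1 - s)) {z : ℂ | 0 < z.re} := by
    intro z hz
    refine DifferentiableAt.differentiableWithinAt ?_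
    have h1 := differentiableAt_tailTransform hB hZ (s := z) hz
    have h2 : DifferentiableAt ℂ (fun s => ∑ k ∈ Icc 1 Z, f k / (k : ℂ) ^ s) z := by
      refine DifferentiableAt.fun_sum fun k hk => ?_
      rw [mem_Icc] at hk
      have hk0 : (k : ℂ) ≠ 0 := by exact_mod_cast (by omega : k ≠ 0)
      refine (differentiableAt_const _).div (differentiableAt_id.const_cpow (Or.inl hk0)) ?_
      exact (Complex.cpow_ne_zero_iff_of_exponent_ne_zero (by rintro rfl; simp at hz)).2 hk0
    have h3 : DifferentiableAt ℂ (fun s => (Z : ℂ) ^ (1 - s)) z :=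
      ((differentiableAt_const _).sub differentiableAt_id).const_cpow (Or.inl hZc)
    exact (((differentiableAt_id.sub_const 1).mul (h2.add h1)).add (h3.const_mul l))
  have := (hh.differentiableOn.analyticOnNhd hopen).eqOn_of_preconnected_of_eventuallyEq
    (hd.analyticOnNhd hopen) (convex_halfSpace_re_gt 0).isPreconnected (z₀ := 2) (by simp) ?_
  · exact this hs
  · filter_upwards [hopen1.mem_nhds (show (2 : ℂ) ∈ {z : ℂ | 1 < z.re} by simp)] with z hz
    have hz' : 1 < z.re := hz
    have hs1 : z - 1 ≠ 0 := by
      intro h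
      have : z.re - 1 = 0 := by simpa using congrArg Complex.re h
      linarith
    rw [hL z hz, LSeries_eq_sum_add_tail hf hB hZ hz]
    field_simp
    ring

end Truncation

end SiegelWalfisz

namespace SiegelWalfisz

open MeasureTheory

/-- Abel's inequality for decreasing weights. -/
lemma norm_sum_antitone_mul_le {a : ℕ → ℝ} {b : ℕ → ℂ} {B : ℝ} (L : ℕ) (ha : ∀ m, 0 ≤ a m)
    (ha' : Antitone a) (hb : ∀ l, l ≤ L → ‖∑ m ∈ range l, b m‖ ≤ B) :
    ‖∑ m ∈ range L, (a m : ℂ) * b m‖ ≤ a 0 * B := by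
  have hB : 0 ≤ B := (norm_nonneg _).trans (hb 0 (Nat.zero_le _))
  have key : ∀ l, l ≤ L → ∑ m ∈ range l, (a m : ℂ) * b m = a l * ∑ m ∈ range l, b m +
      ∑ j ∈ range l, ((a j - a (j + 1) : ℝ) : ℂ) * ∑ m ∈ range (j + 1), b m := by
    intro l
    induction l with
    | zero => simp
    | succ l ih =>
      intro hl
      rw [sum_range_succ, ih (by omega), sum_range_succ (fun j => _ * ∑ m ∈ range (j + 1), b m),
        sum_range_succ b]
      push_cast; ring
  rw [key L le_rfl]
  have h1 : ‖∑ j ∈ range L, ((a j - a (j + 1) : ℝ) : ℂ) * ∑ m ∈ range (j + 1), b m‖ ≤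
      ∑ j ∈ range L, (a j - a (j + 1)) * B := by
    refine (norm_sum_le _ _).trans (sum_le_sum fun j hj => ?_)
    rw [mem_range] at hj
    have h0 : 0 ≤ a j - a (j + 1) := sub_nonneg.2 (ha' (Nat.le_succ j))
    rw [norm_mul, Complex.norm_real, Real.norm_of_nonneg h0]
    exact mul_le_mul_of_nonneg_left (hb _ hj) h0
  rw [← sum_mul, sum_range_sub'] at h1
  have h2 : ‖(a L : ℂ) * ∑ m ∈ range L, b m‖ ≤ a L * B := by
    rw [norm_mul, Complex.norm_real, Real.norm_of_nonneg (ha L)]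
    exact mul_le_mul_of_nonneg_left (hb L le_rfl) (ha L)
  refine (norm_add_le _ _).trans ?_
  linarith

lemma cpow_neg_eq_rpow_mul_e {x : ℝ} (hx : 0 < x) (s : ℂ) :
    (x : ℂ) ^ (-s) = ((x ^ (-s.re) : ℝ) : ℂ) * e (-s.im / (2 * π) * Real.log x) := by
  rw [Complex.cpow_def_of_ne_zero (by exact_mod_cast hx.ne'), Real.rpow_def_of_pos hx, e,
    Complex.ofReal_exp, ← Complex.exp_add, ← Complex.ofReal_log hx.le]
  congr 1
  have hpi : (π : ℂ) ≠ 0 := by exact_mod_cast pi_ne_zero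
  push_cast
  nth_rewrite 1 [← Complex.re_add_im s]
  field_simp
  ring

lemma norm_sum_cpow_conj (X : ℝ) (hX : 0 < X) (L : ℕ) (s : ℂ) :
    ‖∑ m ∈ range L, ((X + m : ℝ) : ℂ) ^ (-(starRingEnd ℂ s))‖ =
      ‖∑ m ∈ range L, ((X + m : ℝ) : ℂ) ^ (-s)‖ := by
  rw [← Complex.norm_conj (∑ m ∈ range L, ((X + m : ℝ) : ℂ) ^ (-s)), map_sum]
  congr 1
  refine sum_congr rfl fun m _ => ?_
  have h0 : 0 < X + m := by positivity
  rw [← map_neg, Complex.cpow_conj, Complex.conj_ofReal]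
  rw [Complex.arg_ofReal_of_nonneg h0.le]
  exact pi_ne_zero.symm

/-- Weyl bound for a dyadic block of the Hurwitz zeta function near the line `re s = 1`. -/
lemma norm_sum_cpow_block_le (M : ℝ) : ∃ δ, 0 < δ ∧ δ ≤ 1 / 32 ∧ ∃ C, 1 ≤ C ∧ ∀ (s : ℂ) (X : ℝ),
    0 ≤ s.re → 1 ≤ |s.im| → 1 ≤ X → |s.im| ≤ X ^ M → X ≤ |s.im| ^ 3 → ∀ L : ℕ, (L : ℝ) ≤ X →
    ‖∑ m ∈ range L, ((X + m : ℝ) : ℂ) ^ (-s)‖ ≤ C * X ^ (1 - δ - s.re) := by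
  obtain ⟨δ, hδ, hδ', C, hC, hW⟩ := weyl_log_sum_le M
  refine ⟨δ, hδ, hδ', C, hC, ?_⟩
  have main : ∀ (s : ℂ) (X : ℝ), s.im ≤ 0 →
    0 ≤ s.re → 1 ≤ |s.im| → 1 ≤ X → |s.im| ≤ X ^ M → X ≤ |s.im| ^ 3 → ∀ L : ℕ, (L : ℝ) ≤ X →
    ‖∑ m ∈ range L, ((X + m : ℝ) : ℂ) ^ (-s)‖ ≤ C * X ^ (1 - δ - s.re) := by
    intro s X him hre h1 hX h2 h3 L hL
    have hX0 : 0 < X := by linarith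
    rw [abs_of_nonpos him] at h1 h2 h3
    have h4 := norm_sum_antitone_mul_le (a := fun m : ℕ => (X + m) ^ (-s.re))
      (b := fun m : ℕ => e (-s.im / (2 * π) * Real.log (X + m))) (B := C * X ^ (1 - δ)) L
      (fun m => by positivity) ?_ ?_
    · simp only [Nat.cast_zero, add_zero] at h4
      have h5 : ∑ m ∈ range L, ((X + m : ℝ) : ℂ) ^ (-s) = ∑ m ∈ range L,
          (((X + m) ^ (-s.re) : ℝ) : ℂ) * e (-s.im / (2 * π) * Real.log (X + m)) :=
        sum_congr rfl fun m _ => cpow_neg_eq_rpow_mul_e (by positivity) s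
      rw [h5]
      refine h4.trans (le_of_eq ?_)
      rw [sub_eq_add_neg (1 - δ), Real.rpow_add hX0]
      ring
    · intro m n hmn
      have : (m : ℝ) ≤ n := by exact_mod_cast hmn
      exact Real.rpow_le_rpow_of_nonpos (by positivity) (by linarith) (by linarith)
    · intro l hl
      exact hW _ _ h1 hX h2 h3 l ((Nat.cast_le.2 hl).trans hL)
  intro s X hre h1 hX h2 h3 L hL
  rcases le_total s.im 0 with him | him
  · exact main s X him hre h1 hX h2 h3 L hL
  · have := main (starRingEnd ℂ s) X (by simpa using him) (by simpa using hre) (by simpa using h1)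
      hX (by simpa using h2) (by simpa using h3) L hL
    rw [norm_sum_cpow_conj X (by linarith)] at this
    simpa using this

/-- A union of dyadic blocks of the Hurwitz zeta function is bounded near the line `re s = 1`. -/
lemma norm_sum_cpow_dyadic_le (M : ℝ) : ∃ η, 0 < η ∧ η ≤ 1 / 64 ∧ ∃ C, 1 ≤ C ∧
    ∀ (s : ℂ) (ρ : ℝ) (m₀ J : ℕ), 1 - η ≤ s.re → 2 ≤ |s.im| → 0 ≤ ρ → ρ ≤ 1 → 1 ≤ m₀ →
    |s.im| ≤ (m₀ : ℝ) ^ M → 0 ≤ M → (∀ i < J, (m₀ : ℝ) * 2 ^ i ≤ s.im ^ 2) →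
    ‖∑ m ∈ Ico m₀ (m₀ * 2 ^ J), ((ρ + m : ℝ) : ℂ) ^ (-s)‖ ≤ C := by
  obtain ⟨δ, hδ, hδ', C, hC, hW⟩ := norm_sum_cpow_block_le M
  set r : ℝ := 2 ^ (-(δ / 2)) with hr
  have hr0 : 0 < r := by positivity
  have hr1 : r < 1 := Real.rpow_lt_one_of_one_lt_of_neg one_lt_two (by linarith)
  have hr2 : 1 ≤ (1 - r)⁻¹ := by
    rw [one_le_inv₀ (by linarith)]; linarith
  refine ⟨δ / 2, by positivity, by linarith, C * (1 - r)⁻¹, by nlinarith, ?_⟩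
  intro s ρ m₀ J hs him hρ hρ' hm₀ hM hM0 hJ
  have hm₀' : (1 : ℝ) ≤ m₀ := by exact_mod_cast hm₀
  have key : ∀ j, j ≤ J → ‖∑ m ∈ Ico m₀ (m₀ * 2 ^ j), ((ρ + m : ℝ) : ℂ) ^ (-s)‖ ≤
      C * ∑ i ∈ range j, r ^ i := by
    intro j
    induction j with
    | zero => simp
    | succ j ih =>
      intro hj
      have ih := ih (by omega)
      have h1 : m₀ ≤ m₀ * 2 ^ j := Nat.le_mul_of_pos_right _ (by positivity)
      have h2 : m₀ * 2 ^ j ≤ m₀ * 2 ^ (j + 1) := by gcongr <;> omega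
      rw [← sum_Ico_consecutive _ h1 h2, sum_range_succ, mul_add]
      refine (norm_add_le _ _).trans (add_le_add ih ?_)
      rw [sum_Ico_eq_sum_range]
      have hcast : ((m₀ * 2 ^ j : ℕ) : ℝ) = m₀ * 2 ^ j := by push_cast; ring
      have h2j : (1 : ℝ) ≤ 2 ^ j := one_le_pow₀ one_le_two
      have hge : (1 : ℝ) ≤ m₀ * 2 ^ j := by nlinarith
      have hsq := hJ j (by omega)
      have h3 := hW s (ρ + m₀ * 2 ^ j) (by linarith) (by linarith) (by linarith)
        (hM.trans (Real.rpow_le_rpow (by positivity) (by nlinarith) hM0)) (by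
          rw [← sq_abs] at hsq
          nlinarith [mul_nonneg (sub_nonneg.2 him) (sq_nonneg |s.im|)])
        (m₀ * 2 ^ (j + 1) - m₀ * 2 ^ j) (by
          rw [pow_succ, ← mul_assoc, mul_two, Nat.add_sub_cancel, hcast]; linarith)
      have h4 : ∑ k ∈ range (m₀ * 2 ^ (j + 1) - m₀ * 2 ^ j),
          ((ρ + (m₀ * 2 ^ j + k : ℕ) : ℝ) : ℂ) ^ (-s) =
          ∑ k ∈ range (m₀ * 2 ^ (j + 1) - m₀ * 2 ^ j),
          ((ρ + m₀ * 2 ^ j + k : ℝ) : ℂ) ^ (-s) := by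
        refine sum_congr rfl fun k _ => ?_
        push_cast
        rw [add_assoc]
      rw [h4]
      refine h3.trans ?_
      gcongr
      have hrj : r ^ j = ((2 : ℝ) ^ j) ^ (-(δ / 2)) := by
        rw [hr, ← Real.rpow_natCast, ← Real.rpow_mul two_pos.le, mul_comm,
          Real.rpow_mul two_pos.le, Real.rpow_natCast]
      rw [hrj]
      refine (Real.rpow_le_rpow_of_exponent_le (by linarith)
        (?_ : 1 - δ - s.re ≤ -(δ / 2))).trans ?_
      · linarith
      · exact Real.rpow_le_rpow_of_nonpos (by positivity) (by nlinarith) (by linarith)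
  refine (key J le_rfl).trans ?_
  gcongr
  rw [geom_sum_eq hr1.ne, ← neg_div_neg_eq, div_eq_mul_inv, neg_sub, neg_sub]
  have : 0 ≤ r ^ J := by positivity
  have h0 : 0 ≤ (1 - r)⁻¹ := by linarith
  nlinarith

lemma norm_sum_cpow_initial_le {f : ℕ → ℂ} (hf : ∀ n, ‖f n‖ ≤ 1) {η : ℝ} (hη : 0 < η) {n : ℕ}
    (hn : 1 ≤ n) {s : ℂ} (hs : 1 - η ≤ s.re) :
    ‖∑ k ∈ Icc 1 n, f k / (k : ℂ) ^ s‖ ≤ (1 + 1 / η) * (n : ℝ) ^ (2 * η) := by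
  have hn1 : (1 : ℝ) ≤ n := by exact_mod_cast hn
  have h1 : ‖∑ k ∈ Icc 1 n, f k / (k : ℂ) ^ s‖ ≤ ∑ k ∈ Icc 1 n, (k : ℝ)⁻¹ * (n : ℝ) ^ η := by
    refine (norm_sum_le _ _).trans (sum_le_sum fun k hk => ?_)
    rw [mem_Icc] at hk
    have hk1 : (1 : ℝ) ≤ k := by exact_mod_cast hk.1
    have hkn : (k : ℝ) ≤ n := by exact_mod_cast hk.2
    have hk0 : (0 : ℝ) < k := by linarith
    rw [norm_div, Complex.norm_natCast_cpow_of_pos hk.1, div_eq_mul_inv, ← Real.rpow_neg hk0.le]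
    calc ‖f k‖ * (k : ℝ) ^ (-s.re) ≤ 1 * (k : ℝ) ^ (-1 + η) := by
          refine mul_le_mul (hf k) (Real.rpow_le_rpow_of_exponent_le hk1 (by linarith))
            (by positivity) (by norm_num)
      _ = (k : ℝ)⁻¹ * (k : ℝ) ^ η := by
          rw [one_mul, Real.rpow_add hk0, Real.rpow_neg_one]
      _ ≤ _ := by gcongr
  rw [← sum_mul] at h1
  have h2 : ∑ k ∈ Icc 1 n, (k : ℝ)⁻¹ ≤ 1 + Real.log n := by
    have := harmonic_le_one_add_log n
    rw [harmonic_eq_sum_Icc] at this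
    push_cast at this
    exact this
  have h3 : Real.log n ≤ (n : ℝ) ^ η / η := Real.log_le_rpow_div (by linarith) hη
  have h4 : (1 : ℝ) ≤ (n : ℝ) ^ η := Real.one_le_rpow hn1 hη.le
  refine h1.trans ?_
  rw [two_mul, Real.rpow_add (by linarith), ← mul_assoc]
  gcongr
  refine h2.trans ?_
  rw [add_mul, one_div, inv_mul_eq_div, one_mul]
  linarith

lemma sum_Icc_eq_sum_residues {q : ℕ} (hq : 1 ≤ q) {f : ℕ → ℂ} (hper : ∀ n, f (n + q) = f n)
    {a b : ℕ} (hab : a ≤ b) (s : ℂ) :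
    ∑ k ∈ Icc 1 (q * b), f k / (k : ℂ) ^ s = ∑ k ∈ Icc 1 (q * a), f k / (k : ℂ) ^ s +
      ∑ r ∈ Icc 1 q, f r * ((q : ℂ) ^ (-s) *
        ∑ m ∈ Ico a b, ((((r : ℝ) / q + m : ℝ)) : ℂ) ^ (-s)) := by
  have hq0 : (0 : ℝ) < q := by exact_mod_cast hq
  have hfm : ∀ (m r : ℕ), f (q * m + r) = f r := by
    intro m r
    induction m with
    | zero => simp
    | succ m ih => rw [← ih, ← hper (q * m + r)]; congr 1; ring
  induction b, hab using Nat.le_induction with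
  | base => simp
  | succ b hb ih =>
    have h1 : ∑ k ∈ Icc 1 (q * (b + 1)), f k / (k : ℂ) ^ s =
        ∑ k ∈ Icc 1 (q * b), f k / (k : ℂ) ^ s +
        ∑ r ∈ Icc 1 q, f (q * b + r) / ((q * b + r : ℕ) : ℂ) ^ s := by
      have e1 : ∀ n, Icc 1 n = Ico 1 (n + 1) := fun n => rfl
      rw [e1, e1, e1, ← sum_Ico_consecutive _ (show 1 ≤ q * b + 1 by omega)
        (show q * b + 1 ≤ q * (b + 1) + 1 by rw [mul_add]; omega)]
      congr 1
      rw [sum_Ico_eq_sum_range, sum_Ico_eq_sum_range,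
        show q * (b + 1) + 1 - (q * b + 1) = q + 1 - 1 by rw [mul_add]; omega]
      exact sum_congr rfl fun r _ => by rw [add_assoc]
    rw [h1, ih, add_assoc, ← sum_add_distrib]
    congr 1
    refine sum_congr rfl fun r hr => ?_
    rw [mem_Icc] at hr
    have hr0 : (0 : ℝ) < r := by exact_mod_cast hr.1
    rw [sum_Ico_succ_top hb, mul_add, mul_add, hfm, add_right_inj, div_eq_mul_inv,
      ← Complex.cpow_neg]
    congr 1
    have e2 : ((q * b + r : ℕ) : ℂ) = ((q : ℝ) : ℂ) * (((r : ℝ) / q + b : ℝ) : ℂ) := by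
      rw [← Complex.ofReal_mul, ← Complex.ofReal_natCast]
      congr 1
      push_cast; field_simp; ring
    rw [e2, Complex.mul_cpow_ofReal_nonneg hq0.le (by positivity), Complex.ofReal_natCast]

set_option maxHeartbeats 1000000 in
/-- Polynomial growth with small exponent, just to the left of `re s = 1`, of functions continuing
`(s - 1) ∑ f(n) n⁻ˢ` for a periodic `f`. -/
lemma growth_of_periodic {M : ℝ} (hM : 1 ≤ M) : ∃ η, 0 < η ∧ η ≤ 1 / 64 ∧ ∃ C, 1 ≤ C ∧
    ∀ (q : ℕ) (f : ℕ → ℂ) (l : ℂ) (h : ℂ → ℂ), 1 ≤ q → (∀ n, f (n + q) = f n) → (∀ n, ‖f n‖ ≤ 1) →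
      ‖l‖ ≤ 1 → (∀ u : ℝ, 1 ≤ u → ‖∑ k ∈ Icc 1 ⌊u⌋₊, f k - l * u‖ ≤ q) → Differentiable ℂ h →
      (∀ s : ℂ, 1 < s.re → h s = (s - 1) * LSeries f s) → ∀ s : ℂ, 1 - η ≤ s.re → s.re ≤ 4 →
      ‖h s‖ ≤ C * q * (‖s - 1‖ + ‖l‖) * (|s.im| + 2) ^ (η / M) := by
  obtain ⟨η, hη, hη', C, hC, hW⟩ := norm_sum_cpow_dyadic_le (2 * M)
  refine ⟨η, hη, hη', 2 * (1 + 1 / η) + C + 20, by have := one_div_pos.2 hη; linarith, ?_⟩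
  intro q f l h hq hper hf hl hB hh hL s hs hs2
  have hq1 : (1 : ℝ) ≤ q := by exact_mod_cast hq
  have hη0 := one_div_pos.2 hη
  have hM0 : 0 < M := by linarith
  have hsre : 0 < s.re := by linarith
  have hns : ‖s‖ ≤ 4 + |s.im| := by
    refine (Complex.norm_le_abs_re_add_abs_im s).trans ?_
    gcongr
    rw [abs_of_nonneg (by linarith)]; exact hs2
  have hT : 1 ≤ (|s.im| + 2) ^ (η / M) :=
    Real.one_le_rpow (by linarith [abs_nonneg s.im]) (by positivity)
  rcases le_total |s.im| 2 with him | him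
  · have hfor := eq_sum_add_tail_of_entire hf hB hq hh hL (s := s) (by linarith)
    have htail := norm_tailTransform_le hB hq (s := s) (by linarith)
    have hsum := norm_sum_cpow_initial_le hf hη hq hs
    have h1 : (q : ℝ) ^ (2 * η) ≤ q := by
      simpa using Real.rpow_le_rpow_of_exponent_le hq1 (show 2 * η ≤ 1 by linarith)
    have h2 : (q : ℝ) ^ (-s.re) ≤ 1 := Real.rpow_le_one_of_one_le_of_nonpos hq1 (by linarith)
    have h3 : ‖(q : ℂ) ^ (1 - s)‖ ≤ q := by
      rw [Complex.norm_natCast_cpow_of_pos hq]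
      simpa using Real.rpow_le_rpow_of_exponent_le hq1 (show (1 - s).re ≤ 1 by simp; linarith)
    have h4 : ‖s‖ * (2 * q * (q : ℝ) ^ (-s.re) / s.re) ≤ 6 * (2 * q * 1 / (3 / 4)) := by
      gcongr
      · linarith
      · linarith [hs]
    have h5 : ‖h s‖ ≤ ‖s - 1‖ * ((1 + 1 / η) * q + 16 * q) + ‖l‖ * q := by
      rw [hfor]
      refine (norm_add_le _ _).trans ?_
      rw [norm_mul, norm_mul]
      gcongr
      refine (norm_add_le _ _).trans
        (add_le_add (hsum.trans (by gcongr)) (htail.trans (h4.trans ?_)))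
      linarith
    calc _ ≤ _ := h5
      _ ≤ (2 * (1 + 1 / η) + C + 20) * q * (‖s - 1‖ + ‖l‖) * 1 := by
          have a1 := mul_nonneg (norm_nonneg (s - 1)) (by linarith : (0 : ℝ) ≤ q)
          have a2 := mul_nonneg (norm_nonneg l) (by linarith : (0 : ℝ) ≤ q)
          have a3 : 0 ≤ 1 + 1 / η + C + 4 := by linarith
          have a4 : 0 ≤ 2 * (1 + 1 / η) + C + 19 := by linarith
          nlinarith [mul_nonneg a3 a1, mul_nonneg a4 a2]
      _ ≤ _ := by gcongr
  · set t := |s.im| with ht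
    set m₀ := ⌈t ^ (1 / (2 * M))⌉₊ with hm₀
    have h1t : 1 ≤ t ^ (1 / (2 * M)) := Real.one_le_rpow (by linarith) (by positivity)
    have hm₀ge : t ^ (1 / (2 * M)) ≤ m₀ := Nat.le_ceil _
    have hm₀le : (m₀ : ℝ) ≤ 2 * t ^ (1 / (2 * M)) := by
      have := Nat.ceil_lt_add_one (show 0 ≤ t ^ (1 / (2 * M)) by positivity)
      linarith
    have hm₀1 : 1 ≤ m₀ := by
      have : (1 : ℝ) ≤ m₀ := h1t.trans hm₀ge
      exact_mod_cast this
    have hex : ∃ J, t ^ 2 < m₀ * 2 ^ J := by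
      obtain ⟨J, hJ⟩ := pow_unbounded_of_one_lt (t ^ 2) (one_lt_two (α := ℝ))
      refine ⟨J, hJ.trans_le ?_⟩
      have : (1 : ℝ) ≤ m₀ := by exact_mod_cast hm₀1
      have h2 : (0 : ℝ) < 2 ^ J := by positivity
      nlinarith
    obtain ⟨J, hJ, hJmin⟩ : ∃ J, t ^ 2 < m₀ * 2 ^ J ∧ ∀ i < J, (m₀ : ℝ) * 2 ^ i ≤ t ^ 2 :=
      ⟨Nat.find hex, Nat.find_spec hex, fun i hi => not_lt.1 (Nat.find_min hex hi)⟩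
    set m₁ := m₀ * 2 ^ J with hm₁
    have hm₁c : (m₁ : ℝ) = m₀ * 2 ^ J := by rw [hm₁]; push_cast; ring
    have hm₁1 : 1 ≤ m₁ := Nat.one_le_iff_ne_zero.2 (by positivity)
    have hm₁le : (m₁ : ℝ) ≤ 2 * t ^ 2 := by
      rcases J with _ | J
      · have : t ^ (1 / (2 * M)) ≤ t ^ (1 : ℝ) := by
          refine Real.rpow_le_rpow_of_exponent_le (by linarith) ?_
          rw [div_le_one (by positivity)]; linarith
        rw [Real.rpow_one] at this
        rw [hm₁c]
        nlinarith
      · have := hJmin J (by omega)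
        rw [hm₁c, pow_succ]; linarith
    have hZ : 1 ≤ q * m₁ := Nat.mul_pos hq hm₁1
    have hfor := eq_sum_add_tail_of_entire hf hB hZ hh hL (s := s) (by linarith)
    have htail := norm_tailTransform_le hB hZ (s := s) (by linarith)
    have hZc : ((q * m₁ : ℕ) : ℝ) = q * m₁ := by push_cast; ring
    have hinit := norm_sum_cpow_initial_le hf hη (show 1 ≤ q * m₀ from Nat.mul_pos hq hm₀1) hs
    have hts : t ≤ ‖s - 1‖ := by
      have := Complex.abs_im_le_norm (s - 1)
      simpa using this
    have hlo : t ^ 2 ≤ ((q * m₁ : ℕ) : ℝ) := by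
      rw [hZc, hm₁c]
      nlinarith
    have h1 : ((q * m₁ : ℕ) : ℝ) ^ (-s.re) ≤ t⁻¹ := by
      calc ((q * m₁ : ℕ) : ℝ) ^ (-s.re) ≤ ((q * m₁ : ℕ) : ℝ) ^ (-(1 / 2) : ℝ) :=
            Real.rpow_le_rpow_of_exponent_le (by exact_mod_cast hZ) (by linarith)
        _ ≤ (t ^ 2) ^ (-(1 / 2) : ℝ) :=
            Real.rpow_le_rpow_of_nonpos (by positivity) hlo (by norm_num)
        _ = t⁻¹ := by
            rw [← Real.rpow_natCast, ← Real.rpow_mul (by positivity)]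
            norm_num
            exact Real.rpow_neg_one t
    have h2 : ‖s‖ * (2 * q * ((q * m₁ : ℕ) : ℝ) ^ (-s.re) / s.re) ≤ 8 * q := by
      calc _ ≤ (3 * t) * (2 * q * t⁻¹ / (3 / 4)) := by
            gcongr
            · linarith
            · linarith
        _ = 8 * q := by
            have : t ≠ 0 := by linarith
            field_simp; norm_num
        _ ≤ _ := le_rfl
    have h3 : ‖((q * m₁ : ℕ) : ℂ) ^ (1 - s)‖ ≤ 2 * q * ‖s - 1‖ := by
      rw [Complex.norm_natCast_cpow_of_pos hZ]
      calc ((q * m₁ : ℕ) : ℝ) ^ (1 - s).re ≤ ((q * m₁ : ℕ) : ℝ) ^ (1 / 2 : ℝ) :=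
            Real.rpow_le_rpow_of_exponent_le (by exact_mod_cast hZ) (by simp; linarith)
        _ ≤ ((2 * q * t) ^ 2) ^ (1 / 2 : ℝ) := by
            refine Real.rpow_le_rpow (by positivity) ?_ (by norm_num)
            rw [hZc]
            have hq0 : (0 : ℝ) ≤ q := by linarith
            calc (q : ℝ) * m₁ ≤ q * (2 * t ^ 2) := by gcongr
              _ ≤ (2 * q * t) ^ 2 := by
                  have a1 := mul_nonneg hq0 (sq_nonneg t)
                  have a2 := mul_nonneg (mul_nonneg hq0 (sub_nonneg.2 hq1)) (sq_nonneg t)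
                  nlinarith
        _ = 2 * q * t := by
            rw [← Real.sqrt_eq_rpow, Real.sqrt_sq (by positivity)]
        _ ≤ _ := by gcongr
    have h4 : ((q * m₀ : ℕ) : ℝ) ^ (2 * η) ≤ 2 * q * (t + 2) ^ (η / M) := by
      push_cast
      rw [Real.mul_rpow (by positivity) (by positivity)]
      have e1 : (q : ℝ) ^ (2 * η) ≤ q := by
        simpa using Real.rpow_le_rpow_of_exponent_le hq1 (show 2 * η ≤ 1 by linarith)
      have e2 : (m₀ : ℝ) ^ (2 * η) ≤ 2 * (t + 2) ^ (η / M) := by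
        calc (m₀ : ℝ) ^ (2 * η) ≤ (2 * t ^ (1 / (2 * M))) ^ (2 * η) := by gcongr
          _ = 2 ^ (2 * η) * t ^ (η / M) := by
              rw [Real.mul_rpow (by positivity) (by positivity), ← Real.rpow_mul (by linarith)]
              congr 2; field_simp
          _ ≤ 2 * (t + 2) ^ (η / M) := by
              gcongr
              · simpa using Real.rpow_le_rpow_of_exponent_le one_le_two (show 2 * η ≤ 1 by linarith)
              · linarith
      calc _ ≤ (q : ℝ) * (2 * (t + 2) ^ (η / M)) := by gcongr
        _ = _ := by ring
    have h5 : ‖∑ r ∈ Icc 1 q, f r * ((q : ℂ) ^ (-s) *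
        ∑ m ∈ Ico m₀ m₁, ((((r : ℝ) / q + m : ℝ)) : ℂ) ^ (-s))‖ ≤ q * C := by
      have : ∀ r ∈ Icc 1 q, ‖f r * ((q : ℂ) ^ (-s) *
          ∑ m ∈ Ico m₀ m₁, ((((r : ℝ) / q + m : ℝ)) : ℂ) ^ (-s))‖ ≤ C := by
        intro r hr
        rw [mem_Icc] at hr
        have hrq : (r : ℝ) / q ≤ 1 := by
          rw [div_le_one (by linarith)]; exact_mod_cast hr.2
        have h7 := hW s (r / q) m₀ J hs him (by positivity) hrq hm₀1 (by
          calc t = (t ^ (1 / (2 * M))) ^ (2 * M) := by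
                rw [← Real.rpow_mul (by linarith), one_div, inv_mul_cancel₀ (by positivity),
                  Real.rpow_one]
            _ ≤ _ := by gcongr) (by positivity) (by rwa [ht, sq_abs] at hJmin)
        have h8 : ‖(q : ℂ) ^ (-s)‖ ≤ 1 := by
          rw [Complex.norm_natCast_cpow_of_pos hq]
          exact Real.rpow_le_one_of_one_le_of_nonpos hq1 (by simp; linarith)
        rw [norm_mul, norm_mul]
        calc _ ≤ 1 * (1 * C) := by
              gcongr
              exact hf r
          _ = C := by ring
      calc _ ≤ ∑ r ∈ Icc 1 q, C := norm_sum_le_of_le _ this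
        _ = q * C := by simp
    have h6 : ‖∑ k ∈ Icc 1 (q * m₁), f k / (k : ℂ) ^ s‖ ≤
        (1 + 1 / η) * (2 * q * (t + 2) ^ (η / M)) + q * C := by
      rw [sum_Icc_eq_sum_residues hq hper
        (show m₀ ≤ m₁ from Nat.le_mul_of_pos_right _ (by positivity))]
      refine (norm_add_le _ _).trans (add_le_add (hinit.trans (by gcongr)) h5)
    have h9 : ‖h s‖ ≤ ‖s - 1‖ * ((1 + 1 / η) * (2 * q * (t + 2) ^ (η / M)) + q * C + 8 * q) +
        1 * (2 * q * ‖s - 1‖) := by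
      rw [hfor]
      refine (norm_add_le _ _).trans ?_
      rw [norm_mul, norm_mul]
      gcongr
      exact (norm_add_le _ _).trans (add_le_add h6 (htail.trans h2))
    set T := (t + 2) ^ (η / M) with hTd
    calc _ ≤ _ := h9
      _ = ‖s - 1‖ * q * ((1 + 1 / η) * (2 * T) + (C + 10) * 1) := by ring
      _ ≤ ‖s - 1‖ * q * ((1 + 1 / η) * (2 * T) + (C + 20) * T) := by gcongr; norm_num
      _ = (2 * (1 + 1 / η) + C + 20) * q * ‖s - 1‖ * T := by ring
      _ ≤ _ := by
          gcongr
          linarith [norm_nonneg l]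

/-- Small growth in `q` near the point `1` of `∑ f(n) n⁻ˢ` for periodic `f` of mean zero. -/
lemma growth_near_one {ε : ℝ} (hε : 0 < ε) : ∃ η, 0 < η ∧ η ≤ 1 / 64 ∧ ∃ C, 1 ≤ C ∧
    ∀ (q : ℕ) (f : ℕ → ℂ) (h : ℂ → ℂ), 1 ≤ q → (∀ n, ‖f n‖ ≤ 1) →
      (∀ u : ℝ, 1 ≤ u → ‖∑ k ∈ Icc 1 ⌊u⌋₊, f k - 0 * u‖ ≤ q) → Differentiable ℂ h →
      (∀ s : ℂ, 1 < s.re → h s = (s - 1) * LSeries f s) → ∀ s : ℂ, ‖s - 1‖ ≤ η →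
      ‖h s‖ ≤ C * (q : ℝ) ^ ε * ‖s - 1‖ := by
  set η := min (ε / 4) (1 / 64) with hηd
  have hη : 0 < η := lt_min (by linarith) (by norm_num)
  have hη' : η ≤ 1 / 64 := min_le_right _ _
  have hηε : η ≤ ε / 4 := min_le_left _ _
  have hη0 := one_div_pos.2 hη
  refine ⟨η, hη, hη', 1 + 1 / η + 8, by linarith, ?_⟩
  intro q f h hq hf hB hh hL s hs
  have hq1 : (1 : ℝ) ≤ q := by exact_mod_cast hq
  have hre := (Complex.abs_re_le_norm (s - 1)).trans hs
  rw [Complex.sub_re, Complex.one_re, abs_le] at hre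
  have hsre : 0 < s.re := by linarith
  have hns : ‖s‖ ≤ 2 := by
    have := norm_add_le (s - 1) 1
    rw [sub_add_cancel, norm_one] at this
    linarith
  have hZ : 1 ≤ q ^ 2 := Nat.one_le_pow _ _ hq
  have hZc : ((q ^ 2 : ℕ) : ℝ) = (q : ℝ) ^ (2 : ℝ) := by push_cast; norm_cast
  have hfor := eq_sum_add_tail_of_entire hf hB hZ hh hL (s := s) hsre
  have htail := norm_tailTransform_le hB hZ (s := s) hsre
  have hsum := norm_sum_cpow_initial_le hf hη hZ (s := s) (by linarith)
  have hT : 1 ≤ (q : ℝ) ^ ε := Real.one_le_rpow hq1 hε.le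
  have h1 : ((q ^ 2 : ℕ) : ℝ) ^ (2 * η) ≤ (q : ℝ) ^ ε := by
    rw [hZc, ← Real.rpow_mul (by linarith)]
    exact Real.rpow_le_rpow_of_exponent_le hq1 (by linarith)
  have h2 : ((q ^ 2 : ℕ) : ℝ) ^ (-s.re) ≤ (q : ℝ)⁻¹ := by
    rw [hZc, ← Real.rpow_mul (by linarith), ← Real.rpow_neg_one]
    exact Real.rpow_le_rpow_of_exponent_le hq1 (by linarith)
  have h4 : ‖s‖ * (2 * q * ((q ^ 2 : ℕ) : ℝ) ^ (-s.re) / s.re) ≤ 8 * (q : ℝ) ^ ε := by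
    calc _ ≤ 2 * (2 * q * (q : ℝ)⁻¹ / (3 / 4)) := by
          gcongr
          linarith
      _ ≤ 8 * 1 := by
          rw [mul_assoc 2, mul_inv_cancel₀ (by linarith)]; norm_num
      _ ≤ _ := by gcongr
  rw [hfor, zero_mul, add_zero, norm_mul, mul_comm]
  gcongr
  calc _ ≤ (1 + 1 / η) * (q : ℝ) ^ ε + 8 * (q : ℝ) ^ ε :=
        (norm_add_le _ _).trans (add_le_add (hsum.trans (by gcongr)) (htail.trans h4))
    _ = _ := by ring

end SiegelWalfisz

namespace SiegelWalfisz

open DirichletCharacter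

/-- The entire function `(s - 1) ζ(s)`. -/
noncomputable def zetaOne : ℂ → ℂ := LFunctionTrivChar₁ 1

lemma differentiable_zetaOne : Differentiable ℂ zetaOne := differentiable_LFunctionTrivChar₁ 1

lemma zetaOne_one : zetaOne 1 = 1 := by
  simp [zetaOne, LFunctionTrivChar₁]

lemma zetaOne_eq {s : ℂ} (hs : s ≠ 1) : zetaOne s = (s - 1) * riemannZeta s := by
  rw [zetaOne, LFunctionTrivChar₁, Function.update_of_ne hs, LFunctionTrivChar,
    LFunction_modOne_eq]

lemma ne_one_of_one_lt_re {s : ℂ} (hs : 1 < s.re) : s ≠ 1 := by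
  rintro rfl
  simp at hs

lemma zetaOne_eq_mul_LSeries {s : ℂ} (hs : 1 < s.re) : zetaOne s = (s - 1) * LSeries 1 s := by
  rw [zetaOne_eq (ne_one_of_one_lt_re hs), LSeries_one_eq_riemannZeta hs]

lemma character_periodic {q : ℕ} (χ : DirichletCharacter ℂ q) (n : ℕ) :
    χ ((n + q : ℕ) : ZMod q) = χ n := by
  simp

section Characters

variable {q : ℕ} [NeZero q] {χ : DirichletCharacter ℂ q}

lemma sum_range_character (hχ : χ ≠ 1) : ∑ k ∈ range q, χ k = 0 := by
  rw [← MulChar.sum_eq_zero_of_ne_one hχ]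
  refine sum_nbij' (fun k : ℕ => (k : ZMod q)) ZMod.val ?_ ?_ ?_ ?_ ?_
  · intro k _; simp
  · intro a _; rw [mem_range]; exact ZMod.val_lt a
  · intro k hk; rw [mem_range] at hk; exact ZMod.val_cast_of_lt hk
  · intro a _; exact ZMod.natCast_zmod_val a
  · intro k _; rfl

lemma norm_sum_character_le (hχ : χ ≠ 1) (n : ℕ) : ‖∑ k ∈ Icc 1 n, χ k‖ ≤ q := by
  have h1 : ∀ n, ‖∑ k ∈ range n, χ k‖ ≤ min (n : ℝ) q := by
    intro n
    induction n using Nat.strong_induction_on with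
    | _ n ih =>
      rcases lt_or_ge n q with h | h
      · rw [min_eq_left (by exact_mod_cast h.le)]
        calc _ ≤ ∑ k ∈ range n, (1 : ℝ) := norm_sum_le_of_le _ fun k _ => χ.norm_le_one k
          _ = n := by simp
      · have hq : 0 < q := NeZero.pos q
        have := ih (n - q) (by omega)
        rw [min_eq_right (by exact_mod_cast h : (q : ℝ) ≤ n)]
        obtain ⟨m, rfl⟩ := Nat.exists_eq_add_of_le h
        rw [sum_range_add, sum_range_character hχ, zero_add]
        rw [Nat.add_sub_cancel_left] at this
        simp only [Nat.cast_add, CharP.cast_eq_zero, zero_add]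
        exact this.trans (min_le_right _ _)
  have h2 : ∑ k ∈ Icc 1 n, χ k = ∑ k ∈ range (n + 1), χ k - χ 0 := by
    rw [range_eq_Ico, sum_eq_sum_Ico_succ_bot (Nat.succ_pos n)]
    simp
    rfl
  have hq1 : q ≠ 1 := by
    rintro rfl
    exact hχ (level_one χ)
  have : Nontrivial (ZMod q) := ZMod.nontrivial_iff.2 hq1
  rw [h2, MulChar.map_zero, sub_zero]
  exact (h1 _).trans (min_le_right _ _)

lemma LFunction_eq_mul_LSeries (χ : DirichletCharacter ℂ q) {s : ℂ} (hs : 1 < s.re) :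
    (s - 1) * LFunction χ s = (s - 1) * LSeries (fun n : ℕ => χ n) s := by
  rw [LFunction_eq_LSeries χ hs]

/-- A bound for `(s - 1) L(s, χ)` of the shape `b(s) |s - 1|` near `1` gives one for `L(s, χ)`. -/
lemma norm_LFunction_le_of_mul (hχ : χ ≠ 1) {b : ℂ → ℝ} (hb : Continuous b) {S : Set ℂ}
    (hS : IsOpen S) (h : ∀ s ∈ S, ‖(s - 1) * LFunction χ s‖ ≤ b s * ‖s - 1‖) :
    ∀ s ∈ S, ‖LFunction χ s‖ ≤ b s := by
  have key : ∀ s ∈ S, s ≠ 1 → ‖LFunction χ s‖ ≤ b s := by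
    intro s hs h1
    have h2 : 0 < ‖s - 1‖ := norm_pos_iff.2 (sub_ne_zero.2 h1)
    have := h s hs
    rw [norm_mul, mul_comm] at this
    exact le_of_mul_le_mul_right this h2
  intro s hs
  by_cases h1 : s = 1
  · subst h1
    have c1 : Continuous fun s => ‖LFunction χ s‖ := (differentiable_LFunction hχ).continuous.norm
    have t1 := (c1.tendsto 1).mono_left (nhdsWithin_le_nhds (s := {1}ᶜ))
    have t2 := (hb.tendsto 1).mono_left (nhdsWithin_le_nhds (s := {1}ᶜ))
    refine le_of_tendsto_of_tendsto t1 t2 ?_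
    filter_upwards [self_mem_nhdsWithin, nhdsWithin_le_nhds (hS.mem_nhds hs)] with z hz hz'
    exact key z hz' hz
  · exact key s hs h1

lemma norm_sum_character_floor_le (hχ : χ ≠ 1) (u : ℝ) :
    ‖∑ k ∈ Icc 1 ⌊u⌋₊, χ k - 0 * u‖ ≤ q := by
  rw [zero_mul, sub_zero]
  exact norm_sum_character_le hχ _

end Characters

/-- Growth of `L`-functions slightly to the left of the line `re s = 1`. -/
lemma growth_LFunction {M : ℝ} (hM : 1 ≤ M) : ∃ η, 0 < η ∧ η ≤ 1 / 64 ∧ ∃ C, 1 ≤ C ∧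
    (∀ (q : ℕ) [NeZero q] (χ : DirichletCharacter ℂ q), χ ≠ 1 → ∀ s : ℂ, 1 - η < s.re → s.re < 4 →
      ‖LFunction χ s‖ ≤ C * q * (|s.im| + 2) ^ (η / M)) ∧
    ∀ s : ℂ, 1 - η < s.re → s.re < 4 →
      ‖zetaOne s‖ ≤ C * (‖s - 1‖ + 1) * (|s.im| + 2) ^ (η / M) := by
  obtain ⟨η, hη, hη', C, hC, h⟩ := growth_of_periodic hM
  refine ⟨η, hη, hη', C, hC, ?_, ?_⟩
  · intro q _ χ hχ s hs hs4
    have hq : 1 ≤ q := NeZero.pos q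
    have hq1 : (1 : ℝ) ≤ q := by exact_mod_cast hq
    refine norm_LFunction_le_of_mul hχ (b := fun s => C * q * (|s.im| + 2) ^ (η / M)) ?_
      (S := {s | 1 - η < s.re} ∩ {s | s.re < 4}) ?_ ?_ s ⟨hs, hs4⟩
    · refine continuous_const.mul (Continuous.rpow_const ?_ fun x => Or.inl ?_)
      · exact (Complex.continuous_im.abs).add continuous_const
      · positivity
    · exact (isOpen_lt continuous_const Complex.continuous_re).inter
        (isOpen_lt Complex.continuous_re continuous_const)
    · intro s hs
      have := h q (fun n => χ n) 0 (fun s => (s - 1) * LFunction χ s) hq (character_periodic χ)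
        (fun n => χ.norm_le_one n) (by simp) (fun u _ => norm_sum_character_floor_le hχ u)
        ((differentiable_id.sub_const 1).mul (differentiable_LFunction hχ))
        (fun s hs => LFunction_eq_mul_LSeries χ hs) s hs.1.le (le_of_lt hs.2)
      refine this.trans (le_of_eq ?_)
      rw [norm_zero]
      ring
  · intro s hs hs4
    have := h 1 (fun _ => 1) 1 zetaOne le_rfl (fun _ => rfl) (by simp) (by simp) ?_
      differentiable_zetaOne (fun s hs => zetaOne_eq_mul_LSeries hs) s hs.le hs4.le
    · simpa using this
    · intro u hu
      rw [sum_const, Nat.card_Icc, Nat.add_sub_cancel, nsmul_eq_mul, mul_one, one_mul,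
        ← Complex.ofReal_natCast, ← Complex.ofReal_sub, Complex.norm_real, Real.norm_eq_abs,
        abs_le]
      have h1 := Nat.floor_le (show 0 ≤ u by linarith)
      have h2 := Nat.lt_floor_add_one u
      constructor <;> push_cast <;> linarith

/-- Near `1`, an `L`-function of modulus `q` is bounded by an arbitrarily small power of `q`. -/
lemma growth_LFunction_near_one {ε : ℝ} (hε : 0 < ε) : ∃ η, 0 < η ∧ η ≤ 1 / 64 ∧ ∃ C, 1 ≤ C ∧
    ∀ (q : ℕ) [NeZero q] (χ : DirichletCharacter ℂ q), χ ≠ 1 → ∀ s : ℂ, ‖s - 1‖ < η →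
      ‖LFunction χ s‖ ≤ C * (q : ℝ) ^ ε := by
  obtain ⟨η, hη, hη', C, hC, h⟩ := growth_near_one hε
  refine ⟨η, hη, hη', C, hC, ?_⟩
  intro q _ χ hχ s hs
  refine norm_LFunction_le_of_mul hχ (b := fun s => C * (q : ℝ) ^ ε) continuous_const
    (S := {s | ‖s - 1‖ < η}) ?_ ?_ s hs
  · exact isOpen_lt (continuous_id.sub continuous_const).norm continuous_const
  · intro s hs
    exact h q (fun n => χ n) (fun s => (s - 1) * LFunction χ s) (NeZero.pos q)
      (fun n => χ.norm_le_one n) (fun u _ => norm_sum_character_floor_le hχ u)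
      ((differentiable_id.sub_const 1).mul (differentiable_LFunction hχ))
      (fun s hs => LFunction_eq_mul_LSeries χ hs) s (le_of_lt hs)

end SiegelWalfisz

namespace SiegelWalfisz

open scoped ComplexOrder Topology

/-- A function whose negative logarithmic derivative has derivatives of alternating sign has
derivatives of alternating sign. -/
lemma iteratedDeriv_alternating_of_deriv_eq {F P : ℂ → ℂ} {x : ℂ} (hF : AnalyticAt ℂ F x)
    (hP : AnalyticAt ℂ P x) (hd : deriv F =ᶠ[𝓝 x] fun s => -(F s * P s)) (h0 : 0 ≤ F x)
    (hP' : ∀ n, 0 ≤ (-1) ^ n * iteratedDeriv n P x) (n : ℕ) :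
    0 ≤ (-1) ^ n * iteratedDeriv n F x := by
  induction n using Nat.strong_induction_on with
  | _ n ih =>
    rcases n with _ | n
    · simpa using h0
    · rw [iteratedDeriv_succ', hd.iteratedDeriv_eq, iteratedDeriv_fun_neg,
        iteratedDeriv_fun_mul hF.contDiffAt hP.contDiffAt, mul_neg, ← neg_mul, mul_sum]
      refine sum_nonneg fun i hi => ?_
      rw [mem_range] at hi
      have h1 := ih i hi
      have h2 := hP' (n - i)
      have h3 : (0 : ℂ) ≤ (n.choose i : ℂ) := Nat.cast_nonneg _
      have h4 := mul_nonneg h3 (mul_nonneg h1 h2)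
      convert! h4 using 1
      have h5 : -(-1 : ℂ) ^ (n + 1) = (-1) ^ i * (-1) ^ (n - i) := by
        rw [← pow_add, Nat.add_sub_cancel' (by omega), pow_succ]; ring
      rw [h5]; ring

lemma iteratedDeriv_inv_sub_one (m : ℕ) :
    iteratedDeriv m (fun s : ℂ => (s - 1)⁻¹) 2 = (-1) ^ m * m.factorial := by
  rw [iteratedDeriv_eq_iterate]
  have := congrFun (iter_deriv_inv_linear_sub m (1 : ℂ) 1) 2
  simp only [one_mul] at this
  rw [this]
  norm_num

/-- Estermann's inequality: a lower bound for `h(1)`, where `h(s) / (s - 1)` has derivatives of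
alternating sign at `2` and is nonpositive at some point `β` just below `1`. -/
lemma estermann {η c₀ : ℝ} (hη : 0 < η) (hη' : η ≤ 1) (hc₀ : 0 < c₀) (hc₁ : c₀ ≤ 1) :
    ∃ A > 0, ∃ c > 0, ∀ (h : ℂ → ℂ) (H β l : ℝ), Differentiable ℂ h →
      (∀ s, ‖s - 2‖ ≤ 1 + η → ‖h s‖ ≤ H) → 1 ≤ H → h 1 = l → 0 ≤ l →
      (∀ m, 0 ≤ (-1) ^ m * iteratedDeriv m (fun s => h s * (s - 1)⁻¹) 2) → c₀ ≤ (h 2).re →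
      1 - η / 4 ≤ β → β < 1 → 0 ≤ (h β).re → c * (1 - β) * H ^ (-(A * (1 - β))) ≤ l := by
  set ρ : ℝ := (1 + η / 4) / (1 + η) with hρ
  have hρ0 : 0 < ρ := by positivity
  have hρ1 : ρ < 1 := by rw [hρ, div_lt_one (by positivity)]; linarith
  set κ : ℝ := c₀ * η * (1 - ρ) / 4 with hκ
  have hκ0 : 0 < κ := by have : 0 < 1 - ρ := by linarith
                         positivity
  have hκ1 : κ ≤ 1 := by
    have h1 : c₀ * η ≤ 1 := by nlinarith
    have h2 : c₀ * η * (1 - ρ) ≤ 1 * 1 := by gcongr; linarith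
    rw [hκ]; linarith
  set L := -Real.log ρ with hL
  have hL0 : 0 < L := by rw [hL, neg_pos]; exact Real.log_neg hρ0 hρ1
  set K := -Real.log κ / L + 2 with hK
  refine ⟨1 / L, by positivity, c₀ / 2 * Real.exp (-K), by positivity, ?_⟩
  intro h H β l hh hH hH1 hl hl0 halt hc hβ hβ1 hhβ
  have hH0 : 0 < H := by linarith
  set y : ℝ := 2 - β with hy
  have hy1 : 1 < y := by linarith
  set g : ℂ → ℂ := dslope h 1 with hg
  have hgs : ∀ s, s ≠ 1 → g s = (h s - l) * (s - 1)⁻¹ := by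
    intro s hs
    rw [hg, dslope_of_ne _ hs, slope_def_field, hl, div_eq_mul_inv]
  have hgd : Differentiable ℂ g := by
    intro s
    have := (Complex.differentiableOn_dslope (s := Set.univ) (c := (1 : ℂ)) Filter.univ_mem).2
      hh.differentiableOn
    exact (this s (Set.mem_univ _)).differentiableAt Filter.univ_mem
  have hlH : l ≤ H := by
    have := hH 1 (by norm_num; linarith)
    rw [hl, Complex.norm_real, Real.norm_of_nonneg hl0] at this
    exact this
  have hgH : ∀ z ∈ Metric.sphere (2 : ℂ) (1 + η), ‖g z‖ ≤ 2 * H / η := by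
    intro z hz
    rw [mem_sphere_iff_norm] at hz
    have h1 : η ≤ ‖z - 1‖ := by
      have := norm_sub_norm_le (z - 2) (-1)
      rw [show z - 2 - -1 = z - 1 by ring, norm_neg, norm_one, hz] at this
      linarith
    have hz1 : z ≠ 1 := by
      rintro rfl
      simp at h1; linarith
    rw [hgs z hz1, norm_mul, norm_inv, div_eq_mul_inv]
    gcongr
    refine (norm_sub_le _ _).trans ?_
    rw [Complex.norm_real, Real.norm_of_nonneg hl0]
    linarith [hH z hz.le]
  set a : ℕ → ℝ := fun m => ((-1) ^ m * (m.factorial : ℂ)⁻¹ * iteratedDeriv m g 2).re with ha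
  have ha1 : ∀ m, -(2 * H / η / (1 + η) ^ m) ≤ a m := by
    intro m
    have h1 := Complex.norm_iteratedDeriv_le_of_forall_mem_sphere_norm_le m (by linarith)
      hgd.diffContOnCl hgH
    have h2 : ‖(-1) ^ m * (m.factorial : ℂ)⁻¹ * iteratedDeriv m g 2‖ ≤ 2 * H / η / (1 + η) ^ m := by
      rw [norm_mul, norm_mul, norm_pow, norm_neg, norm_one, one_pow, one_mul, norm_inv,
        Complex.norm_natCast, inv_mul_le_iff₀ (by positivity), ← mul_div_assoc]
      exact h1
    exact (abs_le.1 ((Complex.abs_re_le_norm _).trans h2)).1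
  have hev : g =ᶠ[𝓝 2] fun s => h s * (s - 1)⁻¹ - l * (s - 1)⁻¹ := by
    filter_upwards [isOpen_ne.mem_nhds (show (2 : ℂ) ≠ 1 by norm_num)] with s hs
    rw [hgs s hs, sub_mul]
  have han : AnalyticAt ℂ (fun s : ℂ => (s - 1)⁻¹) 2 :=
    (analyticAt_id.sub analyticAt_const).inv (by norm_num)
  have hha : AnalyticAt ℂ h 2 := hh.analyticAt 2
  have ha2 : ∀ m, -l ≤ a m := by
    intro m
    have h1 : iteratedDeriv m g 2 = iteratedDeriv m (fun s => h s * (s - 1)⁻¹) 2 -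
        l * ((-1) ^ m * m.factorial) := by
      have c1 : ContDiffAt ℂ m (fun s : ℂ => h s * (s - 1)⁻¹) 2 := (hha.mul han).contDiffAt
      have c2 : ContDiffAt ℂ m (fun s : ℂ => (l : ℂ) * (s - 1)⁻¹) 2 :=
        (analyticAt_const.mul han).contDiffAt
      rw [hev.iteratedDeriv_eq, iteratedDeriv_fun_sub c1 c2, iteratedDeriv_const_mul_field,
        iteratedDeriv_inv_sub_one]
    have h2 : (-1) ^ m * (m.factorial : ℂ)⁻¹ * iteratedDeriv m g 2 =
        ((m.factorial : ℝ)⁻¹ : ℝ) * ((-1) ^ m * iteratedDeriv m (fun s => h s * (s - 1)⁻¹) 2) -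
          (l : ℝ) := by
      have h3 : (m.factorial : ℂ) ≠ 0 := by exact_mod_cast m.factorial_ne_zero
      have h4 : ((-1 : ℂ) ^ m) * (-1) ^ m = 1 := by rw [← mul_pow]; norm_num
      rw [h1, mul_sub]
      push_cast
      have : (-1) ^ m * (m.factorial : ℂ)⁻¹ * (l * ((-1) ^ m * m.factorial)) =
        (-1) ^ m * (-1) ^ m * l * ((m.factorial : ℂ)⁻¹ * m.factorial) := by ring
      rw [this, h4, inv_mul_cancel₀ h3]; ring
    have h5 := (Complex.le_def.1 (halt m)).1
    simp only [ha]
    rw [h2, Complex.sub_re, Complex.re_ofReal_mul, Complex.ofReal_re]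
    have : 0 ≤ (m.factorial : ℝ)⁻¹ * ((-1) ^ m * iteratedDeriv m (fun s => h s * (s - 1)⁻¹) 2).re :=
      mul_nonneg (by positivity) h5
    linarith
  have ha0 : c₀ - l ≤ a 0 := by
    simp only [ha, pow_zero, Nat.factorial_zero, Nat.cast_one, inv_one, one_mul, iteratedDeriv_zero]
    rw [hgs 2 (by norm_num)]
    norm_num
    linarith
  have hsum : HasSum (fun m => a m * y ^ m) (g β).re := by
    have h1 := Complex.hasSum_taylorSeries_of_entire hgd 2 β
    have h2 := Complex.hasSum_re h1
    refine h2.congr_fun fun m => ?_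
    simp only [ha, smul_eq_mul]
    have : (β : ℂ) - 2 = -1 * (y : ℂ) := by rw [hy]; push_cast; ring
    rw [this, mul_pow]
    rw [show (m.factorial : ℂ)⁻¹ * ((-1) ^ m * (y : ℂ) ^ m * iteratedDeriv m g 2) =
      ((y ^ m : ℝ) : ℂ) * ((-1) ^ m * (m.factorial : ℂ)⁻¹ * iteratedDeriv m g 2) by push_cast; ring,
      Complex.re_ofReal_mul, mul_comm]
  have hgβ : (g β).re ≤ l / (1 - β) := by
    have hβc : (β : ℂ) ≠ 1 := by exact_mod_cast hβ1.ne
    rw [hgs _ hβc, ← Complex.ofReal_one, ← Complex.ofReal_sub, ← Complex.ofReal_inv, mul_comm,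
      Complex.re_ofReal_mul, Complex.sub_re, Complex.ofReal_re, le_div_iff₀ (by linarith)]
    have : (β - 1)⁻¹ * (1 - β) = -1 := by
      have : β - 1 ≠ 0 := by linarith
      field_simp; ring
    nlinarith
  obtain ⟨M, hM1, hM2⟩ : ∃ M : ℕ, (Real.log H - Real.log κ) / L ≤ M ∧
      (M : ℝ) + 1 ≤ (Real.log H - Real.log κ) / L + 2 := by
    refine ⟨⌈(Real.log H - Real.log κ) / L⌉₊, Nat.le_ceil _, ?_⟩
    have := Nat.ceil_lt_add_one (a := (Real.log H - Real.log κ) / L)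
      (div_nonneg (by linarith [Real.log_nonneg hH1, Real.log_nonpos hκ0.le hκ1]) hL0.le)
    linarith
  have hρM : ρ ^ (M + 1) ≤ κ / H := by
    have h1 : ρ ^ (M + 1) ≤ ρ ^ M := pow_le_pow_of_le_one hρ0.le hρ1.le (Nat.le_succ _)
    refine h1.trans ?_
    rw [← Real.log_le_log_iff (by positivity) (by positivity), Real.log_pow,
      Real.log_div hκ0.ne' hH0.ne']
    rw [div_le_iff₀ hL0] at hM1
    rw [hL] at hM1
    linarith
  have htail := (hasSum_nat_add_iff' (M + 1)).2 hsum
  have hgeom : HasSum (fun n => -(2 * H / η * ρ ^ (M + 1) * ρ ^ n))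
      (-(2 * H / η * ρ ^ (M + 1) * (1 - ρ)⁻¹)) :=
    ((hasSum_geometric_of_lt_one hρ0.le hρ1).mul_left _).neg
  have h1 := hasSum_le (fun n => ?_) hgeom htail
  swap
  · have h2 := ha1 (n + (M + 1))
    have h3 : ρ ^ (M + 1) * ρ ^ n = (1 + η / 4) ^ (n + (M + 1)) / (1 + η) ^ (n + (M + 1)) := by
      rw [← pow_add, add_comm, hρ, div_pow]
    have h4 : y ^ (n + (M + 1)) ≤ (1 + η / 4) ^ (n + (M + 1)) := by gcongr; linarith
    calc -(2 * H / η * ρ ^ (M + 1) * ρ ^ n)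
        = -(2 * H / η / (1 + η) ^ (n + (M + 1)) * (1 + η / 4) ^ (n + (M + 1))) := by
          rw [mul_assoc, h3]; ring
      _ ≤ -(2 * H / η / (1 + η) ^ (n + (M + 1)) * y ^ (n + (M + 1))) := by
          gcongr
      _ = -(2 * H / η / (1 + η) ^ (n + (M + 1))) * y ^ (n + (M + 1)) := by ring
      _ ≤ _ := by gcongr
  have h2 : c₀ - l * ∑ m ∈ range (M + 1), y ^ m ≤ ∑ m ∈ range (M + 1), a m * y ^ m := by
    rw [sum_range_succ', sum_range_succ', mul_add, mul_sum]
    have : ∑ m ∈ range M, -l * y ^ (m + 1) ≤ ∑ m ∈ range M, a (m + 1) * y ^ (m + 1) :=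
      sum_le_sum fun m _ => by gcongr; exact ha2 _
    simp only [neg_mul, sum_neg_distrib] at this
    simp only [pow_zero, mul_one]
    linarith
  rw [geom_sum_eq hy1.ne'] at h2
  have hy2 : y - 1 = 1 - β := by rw [hy]; ring
  rw [hy2] at h2
  have h3 : 2 * H / η * ρ ^ (M + 1) * (1 - ρ)⁻¹ ≤ c₀ / 2 := by
    have h5 : 0 < 1 - ρ := by linarith
    calc _ ≤ 2 * H / η * (κ / H) * (1 - ρ)⁻¹ := by gcongr
      _ = c₀ / 2 := by rw [hκ]; field_simp; norm_num
  have hβ2 : 0 < 1 - β := by linarith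
  have h4 : c₀ / 2 ≤ l * y ^ (M + 1) / (1 - β) := by
    have : l * ((y ^ (M + 1) - 1) / (1 - β)) = l * y ^ (M + 1) / (1 - β) - l / (1 - β) := by ring
    linarith
  have h6 : y ^ (M + 1) ≤ Real.exp K * H ^ (1 / L * (1 - β)) := by
    have e1 : y ≤ Real.exp (1 - β) := by
      have := Real.add_one_le_exp (1 - β); linarith
    calc y ^ (M + 1) ≤ Real.exp (1 - β) ^ (M + 1) := by gcongr
      _ = Real.exp ((1 - β) * (M + 1)) := by rw [← Real.exp_nat_mul]; congr 1; push_cast; ring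
      _ ≤ Real.exp (K + Real.log H * (1 / L * (1 - β))) := by
          gcongr
          have e2 : (1 - β) * (M + 1) ≤ (1 - β) * ((Real.log H - Real.log κ) / L + 2) := by gcongr
          have e3 : (Real.log H - Real.log κ) / L + 2 = K + Real.log H * (1 / L) := by
            rw [hK]; ring
          have hK0 : 0 ≤ K := by
            have := div_nonneg (neg_nonneg.2 (Real.log_nonpos hκ0.le hκ1)) hL0.le
            linarith
          rw [e3] at e2
          nlinarith
      _ = _ := by rw [Real.exp_add, Real.rpow_def_of_pos hH0]
  rw [le_div_iff₀ hβ2] at h4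
  have h7 : c₀ / 2 * (1 - β) ≤ l * (Real.exp K * H ^ (1 / L * (1 - β))) :=
    h4.trans (by gcongr)
  rw [Real.rpow_neg hH0.le, Real.exp_neg]
  have h8 : 0 < H ^ (1 / L * (1 - β)) := by positivity
  have h9 := Real.exp_pos K
  rw [← div_eq_mul_inv, div_le_iff₀ h8, mul_right_comm, ← div_eq_mul_inv, div_le_iff₀ h9]
  linarith

end SiegelWalfisz

namespace SiegelWalfisz

open scoped ComplexOrder Topology ComplexConjugate
open DirichletCharacter ArithmeticFunction

section Quadratic

variable {q : ℕ} {χ : DirichletCharacter ℂ q}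

lemma quadratic_apply (hχ : χ ^ 2 = 1) (a : ZMod q) : χ a = 0 ∨ χ a = 1 ∨ χ a = -1 := by
  have h1 : χ a ^ 2 = (1 : DirichletCharacter ℂ q) a := by
    rw [← hχ, MulChar.pow_apply' _ two_ne_zero]
  by_cases ha : IsUnit a
  · rw [MulChar.one_apply ha] at h1
    exact Or.inr (by simpa using h1)
  · exact Or.inl (χ.map_nonunit ha)

lemma conj_quadratic_apply (hχ : χ ^ 2 = 1) (a : ZMod q) : conj (χ a) = χ a := by
  rcases quadratic_apply hχ a with h | h | h <;> simp [h]

lemma zero_le_one_add_quadratic_apply (hχ : χ ^ 2 = 1) (a : ZMod q) : 0 ≤ 1 + χ a := by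
  rcases quadratic_apply hχ a with h | h | h
  · simp [h]
  · rw [h]; positivity
  · simp [h]

variable [NeZero q]

lemma LFunction_conj (hχ : χ ^ 2 = 1) (h1 : χ ≠ 1) (s : ℂ) :
    conj (LFunction χ (conj s)) = LFunction χ s := by
  have hd : Differentiable ℂ (LFunction χ) := differentiable_LFunction h1
  set G : ℂ → ℂ := conj ∘ LFunction χ ∘ conj with hG
  have hGd : Differentiable ℂ G := fun z => differentiableAt_conj_conj_iff.2 (hd _)
  have hev : G =ᶠ[𝓝 2] LFunction χ := by
    filter_upwards [(isOpen_lt continuous_const Complex.continuous_re).mem_nhds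
      (show (1 : ℝ) < (2 : ℂ).re by norm_num)] with z hz
    have hz' : 1 < (conj z).re := by simpa using hz
    simp only [hG, Function.comp]
    rw [LFunction_eq_LSeries χ hz, LFunction_eq_LSeries χ hz', LSeries, LSeries, Complex.conj_tsum]
    refine tsum_congr fun n => ?_
    rcases eq_or_ne n 0 with rfl | hn
    · simp
    · rw [LSeries.term_of_ne_zero hn, LSeries.term_of_ne_zero hn, map_div₀,
        conj_quadratic_apply hχ,
        Complex.cpow_conj _ _ (by simp [Complex.natCast_arg, pi_ne_zero.symm]),
        Complex.conj_conj, Complex.conj_natCast]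
  have := AnalyticOnNhd.eq_of_eventuallyEq (fun z _ => hGd.analyticAt z)
    (fun z _ => hd.analyticAt z) hev
  exact congrFun this s

lemma LFunction_im_eq_zero (hχ : χ ^ 2 = 1) (h1 : χ ≠ 1) (x : ℝ) : (LFunction χ x).im = 0 := by
  have := LFunction_conj hχ h1 x
  rw [Complex.conj_ofReal] at this
  exact Complex.conj_eq_iff_im.1 this

lemma LFunction_eq_re (hχ : χ ^ 2 = 1) (h1 : χ ≠ 1) (x : ℝ) :
    LFunction χ x = ((LFunction χ x).re : ℝ) :=
  Complex.ext rfl (by simp [LFunction_im_eq_zero hχ h1])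

lemma LFunction_two_re_ge (χ : DirichletCharacter ℂ q) : 7 / 20 ≤ (LFunction χ 2).re := by
  have h2 : (1 : ℝ) < (2 : ℂ).re := by norm_num
  have hs := (LSeriesSummable_of_one_lt_re χ h2).hasSum
  have h3 : HasSum (fun n => (LSeries.term (fun n => χ n) 2 n).re + 1 / (n : ℝ) ^ 2)
      ((LFunction χ 2).re + π ^ 2 / 6) := by
    rw [LFunction_eq_LSeries χ h2]
    exact (Complex.hasSum_re hs).add hasSum_zeta_two
  have h4 := le_hasSum h3 1 (fun n _ => ?_)
  · rw [LSeries.term_of_ne_zero one_ne_zero] at h4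
    simp at h4
    nlinarith [Real.pi_lt_d4, Real.pi_pos]
  · rcases eq_or_ne n 0 with rfl | hn
    · simp
    · have h5 : ‖LSeries.term (fun n => χ n) 2 n‖ ≤ 1 / (n : ℝ) ^ 2 := by
        rw [LSeries.term_of_ne_zero hn, norm_div]
        have : ‖((n : ℂ) ^ (2 : ℂ))‖ = (n : ℝ) ^ 2 := by norm_cast
        rw [this]
        gcongr
        exact χ.norm_le_one _
      linarith [(abs_le.1 ((Complex.abs_re_le_norm _).trans h5)).1]

lemma LFunction_re_pos (h1 : χ ≠ 1) (hχ : χ ^ 2 = 1) {β : ℝ}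
    (hβ : ∀ x : ℝ, β ≤ x → x < 1 → LFunction χ x ≠ 0) {x : ℝ} (hx : β ≤ x) (hx2 : x ≤ 2) :
    0 < (LFunction χ x).re := by
  by_contra! hneg
  have hc : ContinuousOn (fun x : ℝ => (LFunction χ x).re) (Set.Icc x 2) :=
    (Complex.continuous_re.comp
      ((differentiable_LFunction h1).continuous.comp Complex.continuous_ofReal)).continuousOn
  have h2 := LFunction_two_re_ge χ
  obtain ⟨y, hy, hy0⟩ := intermediate_value_Icc hx2 hc
    (show (0 : ℝ) ∈ Set.Icc _ _ from ⟨hneg, by push_cast; linarith⟩)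
  have hL : LFunction χ y = 0 := by
    rw [LFunction_eq_re hχ h1]
    simpa using hy0
  rcases lt_or_ge y 1 with h | h
  · exact hβ y (hx.trans hy.1) h hL
  · exact LFunction_ne_zero_of_one_le_re (s := y) χ (Or.inl h1) (by simpa using h) hL

lemma LFunction_one_re_pos (h1 : χ ≠ 1) (hχ : χ ^ 2 = 1) : 0 < (LFunction χ 1).re := by
  simpa using LFunction_re_pos h1 hχ (β := 1) (x := 1) (fun x hx hx' => absurd hx' hx.not_gt)
    le_rfl one_le_two

end Quadratic

section LogCoefficients

/-- `F` is holomorphic on `re s > 1`, where `-F' / F` is the Dirichlet series with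
coefficients `a`. -/
def HasLogCoeff (F : ℂ → ℂ) (a : ℕ → ℂ) : Prop :=
  ∀ s : ℂ, 1 < s.re → AnalyticAt ℂ F s ∧ LSeriesSummable a s ∧ deriv F s = -(F s * LSeries a s)

lemma HasLogCoeff.mul {F G : ℂ → ℂ} {a b : ℕ → ℂ} (hF : HasLogCoeff F a) (hG : HasLogCoeff G b) :
    HasLogCoeff (fun s => F s * G s) (a + b) := by
  intro s hs
  obtain ⟨h1, h2, h3⟩ := hF s hs
  obtain ⟨k1, k2, k3⟩ := hG s hs
  refine ⟨h1.mul k1, h2.add k2, ?_⟩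
  rw [deriv_fun_mul h1.differentiableAt k1.differentiableAt, h3, k3, LSeries_add h2 k2]
  ring

lemma hasLogCoeff_LFunction {q : ℕ} [NeZero q] (χ : DirichletCharacter ℂ q) :
    HasLogCoeff (LFunction χ) (fun n => χ n * vonMangoldt n) := by
  intro s hs
  have hs1 : s ≠ 1 := ne_one_of_one_lt_re hs
  refine ⟨?_, LSeriesSummable_twist_vonMangoldt χ hs, ?_⟩
  · refine DifferentiableOn.analyticAt (s := {1}ᶜ) (fun z hz => ?_)
      (isOpen_compl_singleton.mem_nhds hs1)
    exact (differentiableAt_LFunction χ z (Or.inl hz)).differentiableWithinAt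
  · have h1 := LSeries_twist_vonMangoldt_eq χ hs
    have h2 : LSeries (fun n => χ n * vonMangoldt n) s =
        -deriv (LSeries fun n => χ n) s / LSeries (fun n => χ n) s := h1
    have h3 := LSeries_ne_zero_of_one_lt_re χ hs
    rw [h2, deriv_LFunction_eq_deriv_LSeries χ hs, LFunction_eq_LSeries χ hs]
    field_simp

lemma hasLogCoeff_riemannZeta : HasLogCoeff riemannZeta (fun n => vonMangoldt n) := by
  have := hasLogCoeff_LFunction (1 : DirichletCharacter ℂ 1)
  rw [LFunction_modOne_eq] at this
  have h2 : (fun n : ℕ => (1 : DirichletCharacter ℂ 1) n * (vonMangoldt n : ℂ)) =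
      fun n => (vonMangoldt n : ℂ) := by
    ext n
    rw [MulChar.one_apply (isUnit_of_subsingleton _), one_mul]
  rwa [h2] at this

lemma HasLogCoeff.alternating {F : ℂ → ℂ} {a : ℕ → ℂ} (hF : HasLogCoeff F a) (ha : 0 ≤ a)
    (h2 : 0 ≤ F 2) (n : ℕ) : 0 ≤ (-1) ^ n * iteratedDeriv n F 2 := by
  have hlt : LSeries.abscissaOfAbsConv a < (2 : ℝ) := by
    refine (LSeries.abscissaOfAbsConv_le_of_forall_lt_LSeriesSummable (x := 1)
      fun y hy => (hF y (by simpa using hy)).2.1).trans_lt ?_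
    exact_mod_cast one_lt_two
  have h2' : (1 : ℝ) < (2 : ℂ).re := by norm_num
  refine iteratedDeriv_alternating_of_deriv_eq (P := LSeries a) (hF 2 h2').1
    (LSeries_analyticOnNhd a 2 (by simpa using hlt)) ?_ h2 (fun n => ?_) n
  · filter_upwards [(isOpen_lt continuous_const Complex.continuous_re).mem_nhds h2'] with z hz
    exact (hF z hz).2.2
  · simpa using LSeries.iteratedDeriv_alternating ha hlt n

end LogCoefficients

end SiegelWalfisz

namespace SiegelWalfisz

open scoped ComplexOrder Topology
open DirichletCharacter ArithmeticFunction

section ProductCharacter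

variable {q₁ q₂ : ℕ}

/-- The product of two Dirichlet characters, as a character modulo the product of the moduli. -/
noncomputable def prodChar (χ₁ : DirichletCharacter ℂ q₁) (χ₂ : DirichletCharacter ℂ q₂) :
    DirichletCharacter ℂ (q₁ * q₂) :=
  changeLevel (dvd_mul_right q₁ q₂) χ₁ * changeLevel (dvd_mul_left q₂ q₁) χ₂

lemma prodChar_apply (χ₁ : DirichletCharacter ℂ q₁) (χ₂ : DirichletCharacter ℂ q₂) (n : ℕ) :
    prodChar χ₁ χ₂ n = χ₁ n * χ₂ n := by
  have hz : ∀ {q : ℕ} (χ : DirichletCharacter ℂ q), ¬ n.Coprime q → χ n = 0 := fun χ h =>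
    χ.map_nonunit (by rwa [ZMod.isUnit_iff_coprime])
  by_cases h : n.Coprime (q₁ * q₂)
  · have h1 : IsCoprime (n : ℤ) ((q₁ * q₂ : ℕ) : ℤ) := Nat.isCoprime_iff_coprime.2 h
    have h2 := changeLevel_eq_cast_of_dvd' χ₁ (dvd_mul_right q₁ q₂) h1
    have h3 := changeLevel_eq_cast_of_dvd' χ₂ (dvd_mul_left q₂ q₁) h1
    rw [Int.cast_natCast, Int.cast_natCast] at h2 h3
    rw [prodChar, MulChar.mul_apply, h2, h3]
  · rw [hz _ h]
    rw [Nat.coprime_mul_iff_right, not_and_or] at h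
    rcases h with h | h
    · rw [hz _ h, zero_mul]
    · rw [hz _ h, mul_zero]

lemma prodChar_sq {χ₁ : DirichletCharacter ℂ q₁} {χ₂ : DirichletCharacter ℂ q₂} (h₁ : χ₁ ^ 2 = 1)
    (h₂ : χ₂ ^ 2 = 1) : prodChar χ₁ χ₂ ^ 2 = 1 := by
  rw [prodChar, mul_pow, ← map_pow, ← map_pow, h₁, h₂, map_one, map_one, one_mul]

end ProductCharacter

lemma alternating_of_hasLogCoeff {h F : ℂ → ℂ} {a : ℕ → ℂ} (hF : HasLogCoeff F a) (ha : 0 ≤ a)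
    (hh : ∀ s : ℂ, 1 < s.re → h s = (s - 1) * F s) (h2 : 0 ≤ F 2) (n : ℕ) :
    0 ≤ (-1) ^ n * iteratedDeriv n (fun s => h s * (s - 1)⁻¹) 2 := by
  have h2' : (1 : ℝ) < (2 : ℂ).re := by norm_num
  have hev : (fun s => h s * (s - 1)⁻¹) =ᶠ[𝓝 2] F := by
    filter_upwards [(isOpen_lt continuous_const Complex.continuous_re).mem_nhds h2'] with z hz
    have : z - 1 ≠ 0 := sub_ne_zero.2 (ne_one_of_one_lt_re hz)
    rw [hh z hz]
    field_simp
  rw [hev.iteratedDeriv_eq]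
  exact hF.alternating ha h2 n

lemma zetaOne_two : zetaOne 2 = ((π ^ 2 / 6 : ℝ) : ℂ) := by
  rw [zetaOne_eq (by norm_num), riemannZeta_two]
  push_cast
  ring

lemma LFunction_two_nonneg {q : ℕ} [NeZero q] {χ : DirichletCharacter ℂ q} (hχ : χ ^ 2 = 1)
    (h1 : χ ≠ 1) : 0 ≤ LFunction χ 2 := by
  have h := LFunction_eq_re hχ h1 2
  have h2 := LFunction_two_re_ge χ
  push_cast at h
  rw [h]
  exact_mod_cast (by linarith : 0 ≤ (LFunction χ 2).re)

lemma riemannZeta_two_nonneg : 0 ≤ riemannZeta 2 := by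
  rw [riemannZeta_two]
  have : ((π : ℂ) ^ 2 / 6) = ((π ^ 2 / 6 : ℝ) : ℂ) := by push_cast; ring
  rw [this]
  exact_mod_cast (by positivity : 0 ≤ π ^ 2 / 6)

lemma one_le_pi_sq_div_six : 1 ≤ π ^ 2 / 6 := by nlinarith [Real.pi_gt_three]

lemma vonMangoldt_complex_nonneg (n : ℕ) : (0 : ℂ) ≤ (vonMangoldt n : ℂ) := by
  exact_mod_cast vonMangoldt_nonneg

/-- Bounds on the disc `|s - 2| ≤ 1 + η`. -/
lemma exists_bound_disc : ∃ η, 0 < η ∧ η ≤ 1 ∧ ∃ D : ℝ, 1 ≤ D ∧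
    (∀ (q : ℕ) [NeZero q] (χ : DirichletCharacter ℂ q), χ ≠ 1 → ∀ s : ℂ, ‖s - 2‖ ≤ 1 + η →
      ‖LFunction χ s‖ ≤ D * q) ∧
    ∀ s : ℂ, ‖s - 2‖ ≤ 1 + η → ‖zetaOne s‖ ≤ D := by
  obtain ⟨η, hη, hη', C, hC, h1, h2⟩ := growth_LFunction le_rfl
  have hre : ∀ s : ℂ, ‖s - 2‖ ≤ 1 + η / 2 → 1 - η < s.re ∧ s.re < 4 ∧
      (|s.im| + 2) ^ (η / 1) ≤ 4 ∧ ‖s - 1‖ + 1 ≤ 4 := by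
    intro s hs
    have h3 := abs_le.1 ((Complex.abs_re_le_norm _).trans hs)
    have h4 := (Complex.abs_im_le_norm _).trans hs
    simp only [Complex.sub_re, Complex.sub_im, Complex.re_ofNat, Complex.im_ofNat,
      sub_zero] at h3 h4
    refine ⟨by linarith, by linarith, ?_, ?_⟩
    · calc (|s.im| + 2) ^ (η / 1) ≤ (4 : ℝ) ^ (1 : ℝ) := by
            refine (rpow_le_rpow (by positivity) (by linarith : |s.im| + 2 ≤ 4)
              (by positivity)).trans (rpow_le_rpow_of_exponent_le (by norm_num) (by linarith))
        _ = 4 := rpow_one 4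
    · have : ‖s - 1‖ ≤ ‖s - 2‖ + ‖(1 : ℂ)‖ := by
        have h5 := norm_add_le (s - 2) 1
        rwa [show s - 2 + 1 = s - 1 by ring] at h5
      rw [norm_one] at this
      linarith
  refine ⟨η / 2, by positivity, by linarith, 16 * C, by linarith, ?_, ?_⟩
  · intro q _ χ hχ s hs
    obtain ⟨a, b, c, -⟩ := hre s hs
    refine (h1 q χ hχ s a b).trans ?_
    calc C * q * (|s.im| + 2) ^ (η / 1) ≤ C * q * 4 := by gcongr
      _ ≤ 16 * C * q := by nlinarith [(by positivity : 0 ≤ C * q)]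
  · intro s hs
    obtain ⟨a, b, c, d⟩ := hre s hs
    refine (h2 s a b).trans ?_
    calc C * (‖s - 1‖ + 1) * (|s.im| + 2) ^ (η / 1) ≤ C * 4 * 4 := by gcongr
      _ = 16 * C := by ring

lemma exists_zetaOne_nonneg : ∃ δ > 0, ∀ x : ℝ, |x - 1| < δ → 0 ≤ (zetaOne x).re := by
  have hc : ContinuousAt (fun x : ℝ => (zetaOne x).re) 1 :=
    (Complex.continuous_re.comp
      (differentiable_zetaOne.continuous.comp Complex.continuous_ofReal)).continuousAt
  have h1 : 0 < (zetaOne ((1 : ℝ) : ℂ)).re := by simp [zetaOne_one]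
  obtain ⟨δ, hδ, h⟩ := Metric.eventually_nhds_iff.1 (hc.eventually (lt_mem_nhds h1))
  exact ⟨δ, hδ, fun x hx => (h (by rwa [Real.dist_eq])).le⟩

lemma inv_card_add_one_le_prod (S : Finset ℕ) (hS : ∀ p ∈ S, 2 ≤ p) :
    ((#S : ℝ) + 1)⁻¹ ≤ ∏ p ∈ S, (1 - (p : ℝ)⁻¹) := by
  induction S using Finset.induction_on_max with
  | empty => simp
  | insert a S ha ih =>
    have haS : a ∉ S := fun h => (ha a h).false
    rw [prod_insert haS, card_insert_of_notMem haS]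
    have h2 : #S + 2 ≤ a := by
      have h3 : S ⊆ Ico 2 a := fun p hp =>
        mem_Ico.2 ⟨hS p (mem_insert_of_mem hp), ha p hp⟩
      have h4 := card_le_card h3
      have h5 := hS a (mem_insert_self _ _)
      rw [Nat.card_Ico] at h4
      omega
    have h3 := ih fun p hp => hS p (mem_insert_of_mem hp)
    have h4 : ((#S : ℝ) + 2) ≤ a := by exact_mod_cast h2
    have h5 : (1 - ((#S : ℝ) + 2)⁻¹) ≤ 1 - (a : ℝ)⁻¹ := by gcongr
    have h6 : 0 ≤ (1 - ((#S : ℝ) + 2)⁻¹) := by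
      rw [sub_nonneg]
      exact inv_le_one_of_one_le₀ (by linarith [(#S).cast_nonneg (α := ℝ)])
    have h7 := h6.trans h5
    calc (((#S + 1 : ℕ) : ℝ) + 1)⁻¹ = (1 - ((#S : ℝ) + 2)⁻¹) * ((#S : ℝ) + 1)⁻¹ := by
          push_cast; field_simp; ring
      _ ≤ _ := by gcongr

lemma card_primeFactors_le_log {n : ℕ} (hn : n ≠ 0) : (#n.primeFactors : ℝ) ≤ 2 * Real.log n := by
  have h1 : 2 ^ #n.primeFactors ≤ n := by
    refine le_trans ?_ (Nat.le_of_dvd (Nat.pos_of_ne_zero hn) (Nat.prod_primeFactors_dvd n))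
    rw [← prod_const]
    exact prod_le_prod' fun p hp => (Nat.prime_of_mem_primeFactors hp).two_le
  have h2 : Real.log (2 ^ #n.primeFactors) ≤ Real.log n :=
    Real.log_le_log (by positivity) (by exact_mod_cast h1)
  rw [Real.log_pow] at h2
  nlinarith [Real.log_two_gt_d9, (#n.primeFactors).cast_nonneg (α := ℝ)]

end SiegelWalfisz

namespace SiegelWalfisz

open scoped ComplexOrder Topology
open DirichletCharacter ArithmeticFunction

/-- Lower bound for `L(1, χ)` when it has no real zeros in `[β, 1)`. -/
lemma siegel_of_no_zero {η D c A : ℝ} (hD : 1 ≤ D)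
    (hL : ∀ (q : ℕ) [NeZero q] (χ : DirichletCharacter ℂ q), χ ≠ 1 → ∀ s : ℂ, ‖s - 2‖ ≤ 1 + η →
      ‖LFunction χ s‖ ≤ D * q)
    (hZ : ∀ s : ℂ, ‖s - 2‖ ≤ 1 + η → ‖zetaOne s‖ ≤ D)
    (hest : ∀ (h : ℂ → ℂ) (H β l : ℝ), Differentiable ℂ h →
      (∀ s, ‖s - 2‖ ≤ 1 + η → ‖h s‖ ≤ H) → 1 ≤ H → h 1 = l → 0 ≤ l →
      (∀ m, 0 ≤ (-1) ^ m * iteratedDeriv m (fun s => h s * (s - 1)⁻¹) 2) → 1 / 100 ≤ (h 2).re →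
      1 - η / 4 ≤ β → β < 1 → 0 ≤ (h β).re → c * (1 - β) * H ^ (-(A * (1 - β))) ≤ l)
    {β : ℝ} (hβ : 1 - η / 4 ≤ β) (hβ1 : β < 1) (hZβ : 0 ≤ (zetaOne β).re)
    {q : ℕ} [NeZero q] {χ : DirichletCharacter ℂ q} (h1 : χ ≠ 1) (hχ : χ ^ 2 = 1)
    (hz : ∀ x : ℝ, β ≤ x → x < 1 → LFunction χ x ≠ 0) :
    c * (1 - β) * (D * (D * q)) ^ (-(A * (1 - β))) ≤ (LFunction χ 1).re := by
  have hq : (1 : ℝ) ≤ q := by exact_mod_cast NeZero.one_le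
  have hpos := LFunction_re_pos h1 hχ hz le_rfl (by linarith)
  have e1 : LFunction χ 1 = ((LFunction χ 1).re : ℝ) := by
    simpa using LFunction_eq_re hχ h1 1
  have e2 : LFunction χ 2 = ((LFunction χ 2).re : ℝ) := by
    simpa using LFunction_eq_re hχ h1 2
  refine hest (fun s => zetaOne s * LFunction χ s) _ β _
    (differentiable_zetaOne.mul (differentiable_LFunction h1)) ?_ ?_ ?_
    (LFunction_one_re_pos h1 hχ).le ?_ ?_ hβ hβ1 ?_
  · intro s hs
    rw [norm_mul]
    exact mul_le_mul (hZ s hs) (hL q χ h1 s hs) (norm_nonneg _) (by linarith)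
  · exact one_le_mul_of_one_le_of_one_le hD (one_le_mul_of_one_le_of_one_le hD hq)
  · simp only [zetaOne_one, one_mul]
    exact e1
  · refine alternating_of_hasLogCoeff
      (hasLogCoeff_riemannZeta.mul (hasLogCoeff_LFunction χ)) ?_ ?_ ?_
    · intro n
      have := mul_nonneg (zero_le_one_add_quadratic_apply hχ (n : ZMod q))
        (vonMangoldt_complex_nonneg n)
      simpa [add_mul] using this
    · intro s hs
      simp only [zetaOne_eq (ne_one_of_one_lt_re hs), mul_assoc]
    · exact mul_nonneg riemannZeta_two_nonneg (LFunction_two_nonneg hχ h1)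
  · simp only [zetaOne_two]
    rw [Complex.re_ofReal_mul]
    nlinarith [LFunction_two_re_ge χ, one_le_pi_sq_div_six]
  · show 0 ≤ (zetaOne β * LFunction χ β).re
    rw [LFunction_eq_re hχ h1 β, Complex.re_mul_ofReal]
    exact mul_nonneg hZβ hpos.le

/-- Lower bound for `L(1, χ₂)` when `L(s, χ₁)` vanishes at `β`. -/
lemma siegel_of_zero {η D c A : ℝ} (hD : 1 ≤ D)
    (hL : ∀ (q : ℕ) [NeZero q] (χ : DirichletCharacter ℂ q), χ ≠ 1 → ∀ s : ℂ, ‖s - 2‖ ≤ 1 + η →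
      ‖LFunction χ s‖ ≤ D * q)
    (hZ : ∀ s : ℂ, ‖s - 2‖ ≤ 1 + η → ‖zetaOne s‖ ≤ D)
    (hest : ∀ (h : ℂ → ℂ) (H β l : ℝ), Differentiable ℂ h →
      (∀ s, ‖s - 2‖ ≤ 1 + η → ‖h s‖ ≤ H) → 1 ≤ H → h 1 = l → 0 ≤ l →
      (∀ m, 0 ≤ (-1) ^ m * iteratedDeriv m (fun s => h s * (s - 1)⁻¹) 2) → 1 / 100 ≤ (h 2).re →
      1 - η / 4 ≤ β → β < 1 → 0 ≤ (h β).re → c * (1 - β) * H ^ (-(A * (1 - β))) ≤ l)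
    {β : ℝ} (hβ : 1 - η / 4 ≤ β) (hβ1 : β < 1)
    {q₁ q₂ : ℕ} [NeZero q₁] [NeZero q₂] {χ₁ : DirichletCharacter ℂ q₁}
    {χ₂ : DirichletCharacter ℂ q₂} (h₁ : χ₁ ≠ 1) (hχ₁ : χ₁ ^ 2 = 1) (h₂ : χ₂ ≠ 1)
    (hχ₂ : χ₂ ^ 2 = 1) (h₃ : prodChar χ₁ χ₂ ≠ 1) (hz : LFunction χ₁ β = 0) :
    c * (1 - β) * (D * (D * q₁) * ((D * q₂) * (D * (q₁ * q₂)))) ^ (-(A * (1 - β))) ≤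
      (LFunction χ₁ 1).re * ((LFunction χ₂ 1).re * (LFunction (prodChar χ₁ χ₂) 1).re) := by
  have hχ₃ := prodChar_sq hχ₁ hχ₂
  have hq₁ : (1 : ℝ) ≤ q₁ := by exact_mod_cast NeZero.one_le
  have hq₂ : (1 : ℝ) ≤ q₂ := by exact_mod_cast NeZero.one_le
  have e1 : ∀ {q : ℕ} [NeZero q] {χ : DirichletCharacter ℂ q}, χ ≠ 1 → χ ^ 2 = 1 →
      LFunction χ 1 = ((LFunction χ 1).re : ℝ) := fun h1 hχ => by
    simpa using LFunction_eq_re hχ h1 1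
  have e2 : ∀ {q : ℕ} [NeZero q] {χ : DirichletCharacter ℂ q}, χ ≠ 1 → χ ^ 2 = 1 →
      LFunction χ 2 = ((LFunction χ 2).re : ℝ) := fun h1 hχ => by
    simpa using LFunction_eq_re hχ h1 2
  have hD0 : 0 ≤ D := by linarith
  refine hest (fun s => (zetaOne s * LFunction χ₁ s) *
    (LFunction χ₂ s * LFunction (prodChar χ₁ χ₂) s)) _ β _
    ((differentiable_zetaOne.mul (differentiable_LFunction h₁)).mul
      ((differentiable_LFunction h₂).mul (differentiable_LFunction h₃))) ?_ ?_ ?_ ?_ ?_ ?_ hβ hβ1 ?_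
  · intro s hs
    have k3 := hL _ _ h₃ s hs
    push_cast at k3
    rw [norm_mul, norm_mul, norm_mul]
    gcongr
    · exact hZ s hs
    · exact hL _ _ h₁ s hs
    · exact hL _ _ h₂ s hs
  · exact one_le_mul_of_one_le_of_one_le
      (one_le_mul_of_one_le_of_one_le hD (one_le_mul_of_one_le_of_one_le hD hq₁))
      (one_le_mul_of_one_le_of_one_le (one_le_mul_of_one_le_of_one_le hD hq₂)
        (one_le_mul_of_one_le_of_one_le hD (one_le_mul_of_one_le_of_one_le hq₁ hq₂)))
  · simp only [zetaOne_one, one_mul]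
    rw [e1 h₁ hχ₁, e1 h₂ hχ₂, e1 h₃ hχ₃]
    simp
  · exact mul_nonneg (LFunction_one_re_pos h₁ hχ₁).le (mul_nonneg (LFunction_one_re_pos h₂ hχ₂).le
      (LFunction_one_re_pos h₃ hχ₃).le)
  · refine alternating_of_hasLogCoeff
      ((hasLogCoeff_riemannZeta.mul (hasLogCoeff_LFunction χ₁)).mul
        ((hasLogCoeff_LFunction χ₂).mul (hasLogCoeff_LFunction (prodChar χ₁ χ₂)))) ?_ ?_ ?_
    · intro n
      have := mul_nonneg (mul_nonneg (zero_le_one_add_quadratic_apply hχ₁ (n : ZMod q₁))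
        (zero_le_one_add_quadratic_apply hχ₂ (n : ZMod q₂))) (vonMangoldt_complex_nonneg n)
      refine this.trans (le_of_eq ?_)
      simp only [Pi.add_apply, prodChar_apply]
      ring
    · intro s hs
      simp only [zetaOne_eq (ne_one_of_one_lt_re hs), mul_assoc]
    · exact mul_nonneg (mul_nonneg riemannZeta_two_nonneg (LFunction_two_nonneg hχ₁ h₁))
        (mul_nonneg (LFunction_two_nonneg hχ₂ h₂) (LFunction_two_nonneg hχ₃ h₃))
  · simp only [zetaOne_two]
    rw [e2 h₁ hχ₁, e2 h₂ hχ₂, e2 h₃ hχ₃]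
    norm_cast
    have k0 := one_le_pi_sq_div_six
    have k1 := LFunction_two_re_ge χ₁
    have k2 := LFunction_two_re_ge χ₂
    have k3 := LFunction_two_re_ge (prodChar χ₁ χ₂)
    calc (1 / 100 : ℝ) ≤ (1 * (7 / 20)) * (7 / 20 * (7 / 20)) := by norm_num
      _ ≤ _ := by gcongr
  · simp [hz]

/-- Comparison of `L(1, χ₁)` and `L(1, χ₂)` for quadratic characters induced by the same
primitive character. -/
lemma siegel_of_prodChar_eq_one {q₁ q₂ : ℕ} [NeZero q₁] [NeZero q₂] {χ₁ : DirichletCharacter ℂ q₁}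
    {χ₂ : DirichletCharacter ℂ q₂} (h₁ : χ₁ ≠ 1) (h₂ : χ₂ ≠ 1)
    (hχ₂ : χ₂ ^ 2 = 1) (h₃ : prodChar χ₁ χ₂ = 1) :
    ‖LFunction χ₁ 1‖ * (2 * Real.log (q₁ * q₂) + 1)⁻¹ ≤ ‖LFunction χ₂ 1‖ * 2 ^ q₁ := by
  set P := (q₁ * q₂).primeFactors with hP
  have hn : q₁ * q₂ ≠ 0 := NeZero.ne _
  have h4 : changeLevel (dvd_mul_right q₁ q₂) χ₁ = changeLevel (dvd_mul_left q₂ q₁) χ₂ := by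
    have h5 : changeLevel (dvd_mul_left q₂ q₁) χ₂ * changeLevel (dvd_mul_left q₂ q₁) χ₂ = 1 := by
      rw [← sq, ← map_pow, hχ₂, map_one]
    exact mul_right_cancel ((h₃ : _ * _ = _).trans h5.symm)
  have h5 : LFunction χ₁ 1 * ∏ p ∈ P, (1 - χ₁ p * p ^ (-1 : ℂ)) =
      LFunction χ₂ 1 * ∏ p ∈ P, (1 - χ₂ p * p ^ (-1 : ℂ)) := by
    rw [← LFunction_changeLevel (dvd_mul_right q₁ q₂) χ₁ (Or.inl h₁), h4,
      LFunction_changeLevel (dvd_mul_left q₂ q₁) χ₂ (Or.inl h₂)]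
  have hterm : ∀ {q : ℕ} (χ : DirichletCharacter ℂ q) (p : ℕ),
      ‖χ p * (p : ℂ) ^ (-1 : ℂ)‖ ≤ (p : ℝ)⁻¹ := fun χ p => by
    rw [Complex.cpow_neg_one, norm_mul, norm_inv, Complex.norm_natCast]
    exact mul_le_of_le_one_left (by positivity) (χ.norm_le_one _)
  have h6 : (2 * Real.log (q₁ * q₂) + 1)⁻¹ ≤ ‖∏ p ∈ P, (1 - χ₁ p * (p : ℂ) ^ (-1 : ℂ))‖ := by
    rw [norm_prod]
    have h7 := card_primeFactors_le_log hn
    push_cast at h7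
    calc (2 * Real.log (q₁ * q₂) + 1)⁻¹ ≤ ((#P : ℝ) + 1)⁻¹ := by gcongr
      _ ≤ ∏ p ∈ P, (1 - (p : ℝ)⁻¹) := inv_card_add_one_le_prod P fun p hp =>
          (Nat.prime_of_mem_primeFactors hp).two_le
      _ ≤ _ := by
          refine prod_le_prod (fun p hp => ?_) fun p hp => ?_
          · have : (1 : ℝ) ≤ p := by exact_mod_cast (Nat.prime_of_mem_primeFactors hp).one_le
            linarith [inv_le_one_of_one_le₀ this]
          · have := norm_sub_norm_le (1 : ℂ) (χ₁ p * (p : ℂ) ^ (-1 : ℂ))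
            rw [norm_one] at this
            linarith [hterm χ₁ p]
  have h8 : ‖∏ p ∈ P, (1 - χ₂ p * (p : ℂ) ^ (-1 : ℂ))‖ ≤ 2 ^ q₁ := by
    rw [norm_prod]
    have hPsub : P = q₁.primeFactors ∪ q₂.primeFactors :=
      Nat.primeFactors_mul (NeZero.ne _) (NeZero.ne _)
    have h9 : ∏ p ∈ P, ‖1 - χ₂ p * (p : ℂ) ^ (-1 : ℂ)‖ ≤ ∏ p ∈ q₁.primeFactors, (2 : ℝ) := by
      have h10 : ∏ p ∈ P, ‖1 - χ₂ p * (p : ℂ) ^ (-1 : ℂ)‖ =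
          ∏ p ∈ q₁.primeFactors, ‖1 - χ₂ p * (p : ℂ) ^ (-1 : ℂ)‖ := by
        refine (prod_subset (hPsub ▸ subset_union_left) fun p hp hp' => ?_).symm
        have hp2 : p ∈ q₂.primeFactors := by
          rw [hPsub, mem_union] at hp
          exact hp.resolve_left hp'
        have hpr := Nat.prime_of_mem_primeFactors hp2
        have : χ₂ (p : ZMod q₂) = 0 := χ₂.map_nonunit (by
          rw [ZMod.isUnit_iff_coprime, hpr.coprime_iff_not_dvd, not_not]
          exact Nat.dvd_of_mem_primeFactors hp2)
        simp [this]
      rw [h10]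
      refine prod_le_prod (fun p _ => norm_nonneg _) fun p hp => ?_
      refine (norm_sub_le _ _).trans ?_
      have : (1 : ℝ) ≤ p := by exact_mod_cast (Nat.prime_of_mem_primeFactors hp).one_le
      rw [norm_one]
      linarith [hterm χ₂ p, inv_le_one_of_one_le₀ this]
    refine h9.trans ?_
    rw [prod_const]
    refine pow_le_pow_right₀ one_le_two ?_
    calc #q₁.primeFactors ≤ #(Icc 1 q₁) := card_le_card fun p hp => mem_Icc.2
          ⟨(Nat.prime_of_mem_primeFactors hp).one_le,
            Nat.le_of_dvd (NeZero.pos _) (Nat.dvd_of_mem_primeFactors hp)⟩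
      _ = q₁ := by simp
  calc ‖LFunction χ₁ 1‖ * (2 * Real.log (q₁ * q₂) + 1)⁻¹
      ≤ ‖LFunction χ₁ 1‖ * ‖∏ p ∈ P, (1 - χ₁ p * (p : ℂ) ^ (-1 : ℂ))‖ := by gcongr
    _ = ‖LFunction χ₂ 1‖ * ‖∏ p ∈ P, (1 - χ₂ p * (p : ℂ) ^ (-1 : ℂ))‖ := by
        rw [← norm_mul, h5, norm_mul]
    _ ≤ _ := by gcongr

end SiegelWalfisz

namespace SiegelWalfisz

open DirichletCharacter

/-- Siegel's theorem. -/
theorem siegel {ε : ℝ} (hε : 0 < ε) : ∃ c > 0, ∀ (q : ℕ) [NeZero q] (χ : DirichletCharacter ℂ q),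
    χ ≠ 1 → χ ^ 2 = 1 → c * (q : ℝ) ^ (-ε) ≤ ‖LFunction χ 1‖ := by
  obtain ⟨η, hη, hη', D, hD, hL, hZ⟩ := exists_bound_disc
  obtain ⟨A, hA, c, hc, hest⟩ :=
    estermann hη hη' (show (0 : ℝ) < 1 / 100 by norm_num) (by norm_num)
  obtain ⟨δ, hδ, hpos⟩ := exists_zetaOne_nonneg
  obtain ⟨ε', hε', hε1, hε2, hε3⟩ : ∃ ε' > 0, ε' ≤ η / 4 ∧ ε' < δ ∧ A * ε' ≤ ε / 4 := by
    refine ⟨min (min (η / 4) (δ / 2)) (ε / 4 / A), by positivity, ?_, ?_, ?_⟩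
    · exact (min_le_left _ _).trans (min_le_left _ _)
    · exact ((min_le_left _ _).trans (min_le_right _ _)).trans_lt (by linarith)
    · calc A * _ ≤ A * (ε / 4 / A) := by gcongr; exact min_le_right _ _
        _ = ε / 4 := by field_simp
  have hD0 : 0 < D := by linarith
  by_cases hex : ∃ (q₁ : ℕ) (_ : NeZero q₁) (χ₁ : DirichletCharacter ℂ q₁), χ₁ ≠ 1 ∧ χ₁ ^ 2 = 1 ∧
    ∃ β : ℝ, 1 - ε' ≤ β ∧ β < 1 ∧ LFunction χ₁ β = 0
  · obtain ⟨q₁, _, χ₁, h₁, hχ₁, β, hβ, hβ1, hz⟩ := hex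
    obtain ⟨η₂, hη₂, -, C, hC, hC'⟩ := growth_LFunction_near_one (half_pos hε)
    have hq₁ : (1 : ℝ) ≤ q₁ := by exact_mod_cast NeZero.one_le
    have hq₁0 : (0 : ℝ) < q₁ := by linarith
    have hL1 := LFunction_one_re_pos h₁ hχ₁
    have hL1' : 0 < ‖LFunction χ₁ 1‖ := hL1.trans_le (Complex.re_le_norm _)
    have hβ' : 0 < 1 - β := by linarith
    have hC0 : 0 < C := by linarith
    set c₁ := c * (1 - β) * (D ^ 4 * (q₁ : ℝ) ^ 2) ^ (-(ε / 4)) /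
      ((LFunction χ₁ 1).re * (C * (q₁ : ℝ) ^ (ε / 2))) with hc₁
    set c₂ := ‖LFunction χ₁ 1‖ * ((2 / ε + 1) * (q₁ : ℝ) ^ ε)⁻¹ / 2 ^ q₁ with hc₂
    have hc₁0 : 0 < c₁ := by positivity
    have hc₂0 : 0 < c₂ := by positivity
    refine ⟨min c₁ c₂, lt_min hc₁0 hc₂0, ?_⟩
    intro q₂ _ χ₂ h₂ hχ₂
    have hq₂ : (1 : ℝ) ≤ q₂ := by exact_mod_cast NeZero.one_le
    have hq₂0 : (0 : ℝ) < q₂ := by linarith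
    by_cases h₃ : prodChar χ₁ χ₂ = 1
    · have h4 := siegel_of_prodChar_eq_one h₁ h₂ hχ₂ h₃
      have h5 : 2 * Real.log (q₁ * q₂) + 1 ≤ (2 / ε + 1) * (q₁ : ℝ) ^ ε * (q₂ : ℝ) ^ ε := by
        have h6 := Real.log_le_rpow_div (by positivity : (0 : ℝ) ≤ q₁ * q₂) hε
        have h7 : 1 ≤ ((q₁ : ℝ) * q₂) ^ ε :=
          one_le_rpow (one_le_mul_of_one_le_of_one_le hq₁ hq₂) hε.le
        rw [mul_assoc, ← mul_rpow hq₁0.le hq₂0.le, add_mul, one_mul, div_mul_eq_mul_div,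
          mul_div_assoc]
        linarith
      have hlog : 0 ≤ Real.log (q₁ * q₂) := Real.log_nonneg (one_le_mul_of_one_le_of_one_le hq₁ hq₂)
      calc min c₁ c₂ * (q₂ : ℝ) ^ (-ε) ≤ c₂ * (q₂ : ℝ) ^ (-ε) := by gcongr; exact min_le_right _ _
        _ = ‖LFunction χ₁ 1‖ * ((2 / ε + 1) * (q₁ : ℝ) ^ ε * (q₂ : ℝ) ^ ε)⁻¹ / 2 ^ q₁ := by
            rw [rpow_neg hq₂0.le, hc₂]; field_simp
        _ ≤ ‖LFunction χ₁ 1‖ * (2 * Real.log (q₁ * q₂) + 1)⁻¹ / 2 ^ q₁ := by gcongr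
        _ ≤ ‖LFunction χ₂ 1‖ := by
            rw [div_le_iff₀ (by positivity)]; exact h4
    · have h4 := siegel_of_zero hD hL hZ hest (by linarith) hβ1 h₁ hχ₁ h₂ hχ₂ h₃ hz
      have h5 : (LFunction (prodChar χ₁ χ₂) 1).re ≤
          C * ((q₁ : ℝ) ^ (ε / 2) * (q₂ : ℝ) ^ (ε / 2)) := by
        have h6 := hC' _ (prodChar χ₁ χ₂) h₃ 1 (by simpa using hη₂)
        rw [← mul_rpow hq₁0.le hq₂0.le]
        push_cast at h6
        exact (Complex.re_le_norm _).trans h6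
      have hL2 := LFunction_one_re_pos h₂ hχ₂
      have h6 : (D ^ 4 * (q₁ : ℝ) ^ 2) ^ (-(ε / 4)) * (q₂ : ℝ) ^ (-(ε / 2)) ≤
          (D * (D * q₁) * ((D * q₂) * (D * (q₁ * q₂)))) ^ (-(A * (1 - β))) := by
        have e1 : D * (D * q₁) * ((D * q₂) * (D * (q₁ * q₂))) =
            (D ^ 4 * (q₁ : ℝ) ^ 2) * (q₂ : ℝ) ^ (2 : ℝ) := by
          rw [rpow_two]; ring
        have e2 : (q₂ : ℝ) ^ (-(ε / 2)) = ((q₂ : ℝ) ^ (2 : ℝ)) ^ (-(ε / 4)) := by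
          rw [← rpow_mul hq₂0.le]; congr 1; ring
        rw [e1, e2, ← mul_rpow (by positivity) (by positivity)]
        refine rpow_le_rpow_of_exponent_le ?_ ?_
        · exact one_le_mul_of_one_le_of_one_le (one_le_mul_of_one_le_of_one_le (one_le_pow₀ hD)
            (one_le_pow₀ hq₁)) (one_le_rpow hq₂ zero_le_two)
        · have : A * (1 - β) ≤ A * ε' := by gcongr; linarith
          linarith
      have h7 : c * (1 - β) * ((D ^ 4 * (q₁ : ℝ) ^ 2) ^ (-(ε / 4)) * (q₂ : ℝ) ^ (-(ε / 2))) ≤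
          (LFunction χ₁ 1).re * ((LFunction χ₂ 1).re *
            (C * ((q₁ : ℝ) ^ (ε / 2) * (q₂ : ℝ) ^ (ε / 2)))) := by
        refine le_trans ?_ (h4.trans ?_)
        · gcongr
        · gcongr
      have e3 : (q₂ : ℝ) ^ (-ε) = (q₂ : ℝ) ^ (-(ε / 2)) / (q₂ : ℝ) ^ (ε / 2) := by
        rw [← rpow_sub hq₂0]; congr 1; ring
      calc min c₁ c₂ * (q₂ : ℝ) ^ (-ε) ≤ c₁ * (q₂ : ℝ) ^ (-ε) := by gcongr; exact min_le_left _ _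
        _ = c * (1 - β) * ((D ^ 4 * (q₁ : ℝ) ^ 2) ^ (-(ε / 4)) * (q₂ : ℝ) ^ (-(ε / 2))) /
            ((LFunction χ₁ 1).re * (C * ((q₁ : ℝ) ^ (ε / 2) * (q₂ : ℝ) ^ (ε / 2)))) := by
            rw [e3, hc₁]; field_simp
        _ ≤ (LFunction χ₂ 1).re := by
            rw [div_le_iff₀ (by positivity)]
            refine h7.trans (le_of_eq (by ring))
        _ ≤ _ := Complex.re_le_norm _
  · push Not at hex
    refine ⟨c * ε' * (D * D) ^ (-ε), by positivity, ?_⟩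
    intro q hq0 χ h1 hχ
    have hq : (1 : ℝ) ≤ q := by exact_mod_cast NeZero.one_le
    have h2 := siegel_of_no_zero hD hL hZ hest (β := 1 - ε') (by linarith) (by linarith)
      (hpos _ (by rw [sub_sub_cancel_left, abs_neg, abs_of_pos hε']; exact hε2)) h1 hχ
      fun x hx hx1 => hex q hq0 χ h1 hχ x hx hx1
    rw [sub_sub_cancel] at h2
    refine le_trans ?_ (h2.trans (Complex.re_le_norm _))
    rw [mul_assoc (c * ε'), ← mul_rpow (by positivity) (by positivity), mul_assoc D D]
    gcongr
    · exact one_le_mul_of_one_le_of_one_le hD (one_le_mul_of_one_le_of_one_le hD hq)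
    · linarith

/-- Zero-free disc around `1`. -/
theorem LFunction_ne_zero_near_one {ε : ℝ} (hε : 0 < ε) : ∃ c > 0, ∀ (q : ℕ) [NeZero q]
    (χ : DirichletCharacter ℂ q), χ ≠ 1 → χ ^ 2 = 1 → ∀ s : ℂ, ‖s - 1‖ ≤ c * (q : ℝ) ^ (-ε) →
      LFunction χ s ≠ 0 := by
  obtain ⟨η, hη, -, C, hC, hG⟩ := growth_LFunction_near_one (half_pos hε)
  obtain ⟨c, hc, hS⟩ := siegel (half_pos hε)
  have hC0 : 0 < C := by linarith
  refine ⟨min (η / 4) (c * (η / 4) / (2 * C)), by positivity, ?_⟩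
  intro q _ χ h1 hχ s hs h0
  have hq : (1 : ℝ) ≤ q := by exact_mod_cast NeZero.one_le
  have hq0 : (0 : ℝ) < q := by linarith
  have hL : Differentiable ℂ (LFunction χ) := differentiable_LFunction h1
  have hqε : (q : ℝ) ^ (-ε) ≤ 1 := rpow_le_one_of_one_le_of_nonpos hq (by linarith)
  have hs1 : ‖s - 1‖ ≤ η / 4 := by
    refine hs.trans ?_
    calc _ ≤ η / 4 * 1 := by gcongr; exact min_le_left _ _
      _ = η / 4 := mul_one _
  have hd : ∀ z ∈ Metric.closedBall (1 : ℂ) (η / 4), ‖deriv (LFunction χ) z‖ ≤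
      C * (q : ℝ) ^ (ε / 2) / (η / 4) := by
    intro z hz
    refine Complex.norm_deriv_le_of_forall_mem_sphere_norm_le (by positivity) hL.diffContOnCl ?_
    intro w hw
    refine hG q χ h1 w ?_
    rw [mem_closedBall_iff_norm] at hz
    rw [mem_sphere_iff_norm] at hw
    have := norm_add_le (w - z) (z - 1)
    rw [sub_add_sub_cancel] at this
    linarith
  have h2 := (convex_closedBall (1 : ℂ) (η / 4)).norm_image_sub_le_of_norm_deriv_le
    (fun z _ => hL z) hd (Metric.mem_closedBall_self (by positivity))
    (mem_closedBall_iff_norm.2 hs1)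
  rw [h0, zero_sub, norm_neg] at h2
  have h3 := hS q χ h1 hχ
  have h4 : ‖s - 1‖ ≤ c * (η / 4) / (2 * C) * (q : ℝ) ^ (-ε) := by
    refine hs.trans ?_
    gcongr
    exact min_le_right _ _
  have h5 : C * (q : ℝ) ^ (ε / 2) / (η / 4) * ‖s - 1‖ ≤ c * (q : ℝ) ^ (-(ε / 2)) / 2 := by
    calc _ ≤ C * (q : ℝ) ^ (ε / 2) / (η / 4) * (c * (η / 4) / (2 * C) * (q : ℝ) ^ (-ε)) := by gcongr
      _ = c * ((q : ℝ) ^ (ε / 2) * (q : ℝ) ^ (-ε)) / 2 := by field_simp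
      _ = _ := by rw [← rpow_add hq0]; congr 3; ring
  have h6 : 0 < c * (q : ℝ) ^ (-(ε / 2)) := by positivity
  linarith

end SiegelWalfisz

namespace SiegelWalfisz

open scoped Topology
open DirichletCharacter ArithmeticFunction

lemma zetaOne_ne_zero_of_one_le_re {s : ℂ} (hs : 1 ≤ s.re) : zetaOne s ≠ 0 := by
  rcases eq_or_ne s 1 with rfl | h
  · simp [zetaOne_one]
  · rw [zetaOne_eq h]
    exact mul_ne_zero (sub_ne_zero.2 h) (riemannZeta_ne_zero_of_one_le_re hs)

lemma LSeries_vonMangoldt_eq_zetaOne {s : ℂ} (hs : 1 < s.re) :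
    LSeries (fun n => vonMangoldt n) s = (s - 1)⁻¹ - deriv zetaOne s / zetaOne s := by
  have hs1 := ne_one_of_one_lt_re hs
  have h0 : s - 1 ≠ 0 := sub_ne_zero.2 hs1
  have hz : riemannZeta s ≠ 0 := riemannZeta_ne_zero_of_one_le_re hs.le
  have hev : zetaOne =ᶠ[𝓝 s] fun z => (z - 1) * riemannZeta z := by
    filter_upwards [isOpen_ne.mem_nhds hs1] with z hz
    exact zetaOne_eq hz
  have hd : deriv zetaOne s = riemannZeta s + (s - 1) * deriv riemannZeta s := by
    rw [hev.deriv_eq, deriv_fun_mul (by fun_prop) (differentiableAt_riemannZeta hs1)]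
    simp
  have h1 := (hasLogCoeff_riemannZeta s hs).2.2
  rw [hd, zetaOne_eq hs1, h1]
  field_simp
  ring

lemma LSeries_twist_vonMangoldt_eq_LFunction {q : ℕ} [NeZero q] (χ : DirichletCharacter ℂ q)
    {s : ℂ} (hs : 1 < s.re) :
    LSeries (fun n => χ n * vonMangoldt n) s = -(deriv (LFunction χ) s / LFunction χ s) := by
  have h1 := (hasLogCoeff_LFunction χ s hs).2.2
  have h2 := LSeries_ne_zero_of_one_lt_re χ hs
  rw [← LFunction_eq_LSeries χ hs] at h2
  rw [h1]
  field_simp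

lemma exists_zetaOne_bounds : ∃ δ > 0, ∃ C > 0, ∀ s : ℂ, ‖s - 1‖ ≤ δ → zetaOne s ≠ 0 ∧
    ‖zetaOne s‖ ≤ 2 ∧ ‖deriv zetaOne s / zetaOne s‖ ≤ C := by
  have hc : ContinuousAt zetaOne 1 := differentiable_zetaOne.continuous.continuousAt
  have h1 : zetaOne 1 ≠ 0 := by simp [zetaOne_one]
  have hd : ContinuousAt (fun s => deriv zetaOne s / zetaOne s) 1 :=
    (differentiable_zetaOne.contDiff.continuous_deriv (n := 1) le_rfl).continuousAt.div hc h1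
  have e1 := hc.eventually_ne h1
  have e2 := hc.norm.eventually (gt_mem_nhds (show ‖zetaOne 1‖ < 2 by simp [zetaOne_one]))
  have e3 := hd.norm.eventually (gt_mem_nhds (lt_add_one _))
  obtain ⟨δ, hδ, h⟩ := Metric.eventually_nhds_iff.1 (e1.and (e2.and e3))
  refine ⟨δ / 2, by positivity, ‖deriv zetaOne 1 / zetaOne 1‖ + 1, by positivity, fun s hs => ?_⟩
  obtain ⟨a, b, c⟩ := h (show dist s 1 < δ by rw [dist_eq_norm]; linarith)
  exact ⟨a, b.le, c.le⟩

/-- The classical lower bound `|L(s, χ)| ≥ 1 / ζ(σ)`. -/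
lemma one_le_norm_LFunction_mul {q : ℕ} [NeZero q] (χ : DirichletCharacter ℂ q) {s : ℂ}
    (hs : 1 < s.re) : 1 ≤ ‖LFunction χ s‖ * ‖riemannZeta (s.re : ℂ)‖ := by
  have h1 := LSeries.mul_mu_eq_one χ hs
  have h2 : ‖LSeries ((fun n : ℕ => χ n) * fun n : ℕ => (moebius n : ℂ)) s‖ ≤
      ‖riemannZeta (s.re : ℂ)‖ := by
    have hs' : 1 < ((s.re : ℂ)).re := by simpa using hs
    have h3 := (LSeriesSummable_one_iff.2 hs').norm
    have h5 : ∀ n, ‖LSeries.term ((fun n : ℕ => χ n) * fun n : ℕ => (moebius n : ℂ)) s n‖ ≤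
        ‖LSeries.term 1 (s.re : ℂ) n‖ := by
      intro n
      rcases eq_or_ne n 0 with rfl | hn
      · simp
      · rw [LSeries.norm_term_eq, LSeries.norm_term_eq, if_neg hn, if_neg hn, Complex.ofReal_re]
        gcongr
        rw [Pi.mul_apply, norm_mul, Pi.one_apply, norm_one]
        refine mul_le_one₀ (χ.norm_le_one _) (norm_nonneg _) ?_
        rw [Complex.norm_intCast]
        exact_mod_cast abs_moebius_le_one
    have h6 : riemannZeta (s.re : ℂ) = ((∑' n, ‖LSeries.term 1 (s.re : ℂ) n‖ : ℝ) : ℂ) := by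
      rw [← LSeries_one_eq_riemannZeta hs', LSeries, Complex.ofReal_tsum]
      refine tsum_congr fun n => ?_
      rcases eq_or_ne n 0 with rfl | hn
      · simp
      · rw [LSeries.norm_term_eq, if_neg hn, LSeries.term_of_ne_zero hn]
        simp [Complex.ofReal_cpow]
    rw [h6, Complex.norm_real, Real.norm_of_nonneg (tsum_nonneg fun n => norm_nonneg _), LSeries]
    refine (norm_tsum_le_tsum_norm (h3.of_nonneg_of_le (fun _ => norm_nonneg _) h5)).trans ?_
    exact Summable.tsum_le_tsum h5 (h3.of_nonneg_of_le (fun _ => norm_nonneg _) h5) h3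
  rw [← LFunction_eq_LSeries χ hs] at h1
  calc (1 : ℝ) = ‖LFunction χ s *
        LSeries ((fun n : ℕ => χ n) * fun n : ℕ => (moebius n : ℂ)) s‖ := by
        rw [h1, norm_one]
    _ ≤ _ := by rw [norm_mul]; gcongr

lemma one_le_norm_riemannZeta_mul {s : ℂ} (hs : 1 < s.re) :
    1 ≤ ‖riemannZeta s‖ * ‖riemannZeta (s.re : ℂ)‖ := by
  have := one_le_norm_LFunction_mul (1 : DirichletCharacter ℂ 1) hs
  rwa [LFunction_modOne_eq] at this

lemma three_four_one_nonneg {b c : ℂ} (h : (‖b‖ = 1 ∧ c = b ^ 2) ∨ (b = 0 ∧ ‖c‖ ≤ 1)) {z : ℂ}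
    (hz : ‖z‖ = 1) : 0 ≤ 3 + 4 * (b * z).re + (c * z ^ 2).re := by
  rcases h with ⟨hb, rfl⟩ | ⟨rfl, hc⟩
  · have h1 : ‖b * z‖ ^ 2 = 1 := by rw [norm_mul, hb, hz]; norm_num
    rw [← Complex.normSq_eq_norm_sq, Complex.normSq_apply] at h1
    rw [← mul_pow, sq (b * z), Complex.mul_re (b * z) (b * z)]
    nlinarith [sq_nonneg ((b * z).re + 1)]
  · have h1 : ‖c * z ^ 2‖ ≤ 1 := by rw [norm_mul, norm_pow, hz]; simpa using hc
    have := (abs_le.1 ((Complex.abs_re_le_norm _).trans h1)).1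
    simp only [zero_mul, Complex.zero_re]
    linarith

/-- The `3-4-1` inequality. -/
lemma three_four_one {b c : ℕ → ℂ}
    (h : ∀ n, (‖b n‖ = 1 ∧ c n = b n ^ 2) ∨ (b n = 0 ∧ ‖c n‖ ≤ 1)) {σ t : ℝ} (hσ : 1 < σ) :
    0 ≤ 3 * (LSeries (fun n => vonMangoldt n) σ).re +
      4 * (LSeries (fun n => b n * vonMangoldt n) (σ + t * Complex.I)).re +
      (LSeries (fun n => c n * vonMangoldt n) (σ + 2 * t * Complex.I)).re := by
  have hbn : ∀ n, ‖b n‖ ≤ 1 := fun n => by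
    rcases h n with ⟨h1, -⟩ | ⟨h1, -⟩
    · exact h1.le
    · simp [h1]
  have hcn : ∀ n, ‖c n‖ ≤ 1 := fun n => by
    rcases h n with ⟨h1, h2⟩ | ⟨-, h1⟩
    · rw [h2, norm_pow, h1]; norm_num
    · exact h1
  have hsum : ∀ {a : ℕ → ℂ} {s : ℂ}, (∀ n, ‖a n‖ ≤ 1) → 1 < s.re →
      LSeriesSummable (fun n => a n * vonMangoldt n) s := fun {a s} ha hs => by
    refine .of_norm <| (LSeriesSummable_vonMangoldt hs).norm.of_nonneg_of_le
      (fun _ => norm_nonneg _) fun n => LSeries.norm_term_le s ?_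
    rw [norm_mul]
    exact mul_le_of_le_one_left (norm_nonneg _) (ha n)
  have r1 : 1 < ((σ : ℂ)).re := by simpa using hσ
  have r2 : 1 < ((σ : ℂ) + t * Complex.I).re := by simpa using hσ
  have r3 : 1 < ((σ : ℂ) + 2 * t * Complex.I).re := by simpa using hσ
  have s1 := (Complex.hasSum_re (LSeriesSummable_vonMangoldt r1).hasSum).mul_left 3
  have s2 := (Complex.hasSum_re (hsum hbn r2).hasSum).mul_left 4
  have s3 := Complex.hasSum_re (hsum hcn r3).hasSum
  refine ((s1.add s2).add s3).nonneg fun n => ?_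
  rcases eq_or_ne n 0 with rfl | hn
  · simp
  have hn0 : (n : ℂ) ≠ 0 := by exact_mod_cast hn
  set z : ℂ := (n : ℂ) ^ (-(t * Complex.I)) with hz
  have hz1 : ‖z‖ = 1 := by
    rw [hz, Complex.norm_natCast_cpow_of_pos (Nat.pos_of_ne_zero hn)]
    simp
  have hp : ((n : ℂ) ^ (σ : ℂ))⁻¹ = (((n : ℝ) ^ (-σ) : ℝ) : ℂ) := by
    rw [← Complex.cpow_neg, Complex.ofReal_cpow (Nat.cast_nonneg _)]
    push_cast; rfl
  have t1 : LSeries.term (fun n => (vonMangoldt n : ℂ)) σ n =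
      ((vonMangoldt n * (n : ℝ) ^ (-σ) : ℝ) : ℂ) := by
    rw [LSeries.term_of_ne_zero hn, div_eq_mul_inv, hp]; push_cast; ring
  have t2 : LSeries.term (fun n => b n * vonMangoldt n) (σ + t * Complex.I) n =
      ((vonMangoldt n * (n : ℝ) ^ (-σ) : ℝ) : ℂ) * (b n * z) := by
    rw [LSeries.term_of_ne_zero hn, div_eq_mul_inv, Complex.cpow_add _ _ hn0, mul_inv, hp,
      ← Complex.cpow_neg]
    push_cast; ring
  have t3 : LSeries.term (fun n => c n * vonMangoldt n) (σ + 2 * t * Complex.I) n =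
      ((vonMangoldt n * (n : ℝ) ^ (-σ) : ℝ) : ℂ) * (c n * z ^ 2) := by
    have : (n : ℂ) ^ (-(2 * t * Complex.I)) = z ^ 2 := by
      rw [hz, ← Complex.cpow_nat_mul]; congr 1; push_cast; ring
    rw [LSeries.term_of_ne_zero hn, div_eq_mul_inv, Complex.cpow_add _ _ hn0, mul_inv, hp,
      ← Complex.cpow_neg, this]
    push_cast; ring
  rw [t1, t2, t3, Complex.re_ofReal_mul, Complex.re_ofReal_mul, Complex.ofReal_re]
  have h1 := three_four_one_nonneg (h n) hz1
  have h2 : 0 ≤ vonMangoldt n * (n : ℝ) ^ (-σ) := mul_nonneg vonMangoldt_nonneg (by positivity)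
  nlinarith [mul_nonneg h2 h1]

end SiegelWalfisz

namespace SiegelWalfisz

open scoped Topology
open DirichletCharacter ArithmeticFunction Filter

/-- The functions to which the zero-free region applies: `(s - 1) ζ(s)` and the `L`-functions of the
nontrivial characters of modulus at most `ℓ ^ m`. -/
def Admissible (ℓ m : ℝ) (f : ℂ → ℂ) : Prop :=
  f = zetaOne ∨ ∃ (q : ℕ) (_ : NeZero q) (χ : DirichletCharacter ℂ q),
    χ ≠ 1 ∧ (q : ℝ) ≤ ℓ ^ m ∧ f = LFunction χ

lemma Admissible.differentiable {ℓ m : ℝ} {f : ℂ → ℂ} (hf : Admissible ℓ m f) :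
    Differentiable ℂ f := by
  rcases hf with rfl | ⟨q, _, χ, hχ, -, rfl⟩
  · exact differentiable_zetaOne
  · exact differentiable_LFunction hχ

lemma Admissible.ne_zero {ℓ m : ℝ} {f : ℂ → ℂ} (hf : Admissible ℓ m f) {s : ℂ} (hs : 1 ≤ s.re) :
    f s ≠ 0 := by
  rcases hf with rfl | ⟨q, _, χ, hχ, -, rfl⟩
  · exact zetaOne_ne_zero_of_one_le_re hs
  · exact LFunction_ne_zero_of_one_le_re χ (Or.inl hχ) hs

lemma exists_norm_riemannZeta_le : ∃ δ > 0, ∀ σ : ℝ, 1 < σ → σ ≤ 1 + δ →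
    ‖riemannZeta σ‖ ≤ 2 / (σ - 1) := by
  obtain ⟨δ, hδ, C, -, h⟩ := exists_zetaOne_bounds
  refine ⟨δ, hδ, fun σ h1 h2 => ?_⟩
  have e1 : ((σ : ℂ) - 1) = ((σ - 1 : ℝ) : ℂ) := by push_cast; rfl
  have h3 := (h σ (by rw [e1, Complex.norm_real, Real.norm_of_nonneg (by linarith)]; linarith)).2.1
  rw [zetaOne_eq (by exact_mod_cast h1.ne'), norm_mul, e1, Complex.norm_real,
    Real.norm_of_nonneg (by linarith)] at h3
  rw [le_div_iff₀ (by linarith)]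
  linarith

lemma local_growth {K m D b : ℝ} (hK : 0 < K) (hm : 0 < m) (hD : 0 < D) (hb : 0 < b) :
    ∃ r, 0 < r ∧ r ≤ 1 / 2 ∧ ∀ᶠ ℓ : ℝ in atTop, ∀ f, Admissible ℓ m f → ∀ t : ℝ,
      |t| ≤ 2 * Real.exp (K * ℓ) + 1 →
      ∀ z ∈ Metric.closedBall (((1 + D / ℓ : ℝ) : ℂ) + t * Complex.I) r,
        ‖f z‖ ≤ Real.exp (b * ℓ * r / 48) * ‖f (((1 + D / ℓ : ℝ) : ℂ) + t * Complex.I)‖ := by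
  obtain ⟨δ, hδ, hζ⟩ := exists_norm_riemannZeta_le
  set M := 1 + 192 * (K + 1) / b with hM
  have hM0 : 0 < 192 * (K + 1) / b := by positivity
  obtain ⟨η, hη, hη64, C, hC, hL, hZ⟩ := growth_LFunction (M := M) (by linarith)
  refine ⟨η / 2, by positivity, by linarith, ?_⟩
  have hlim := (tendsto_rpow_mul_exp_neg_mul_atTop_nhds_zero (m + 2) (b * η / 192)
    (by positivity)).const_mul (C * (1 + 2 / D) ^ 2)
  rw [mul_zero] at hlim
  filter_upwards [eventually_ge_atTop 2, eventually_ge_atTop D, eventually_ge_atTop (D / δ),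
    hlim.eventually (gt_mem_nhds one_pos)] with ℓ h2 hDℓ hδℓ hsmall f hf t ht z hz
  have hℓ : 0 < ℓ := by linarith
  set c : ℂ := ((1 + D / ℓ : ℝ) : ℂ) + t * Complex.I with hc
  have hx : 0 < D / ℓ := by positivity
  have hx1 : D / ℓ ≤ 1 := (div_le_one hℓ).2 hDℓ
  have hxδ : D / ℓ ≤ δ := by rw [div_le_iff₀ hℓ]; rw [div_le_iff₀ hδ] at hδℓ; linarith
  have hcre : c.re = 1 + D / ℓ := by simp [hc]
  have hcim : c.im = t := by simp [hc]
  have hc1 : 1 < c.re := by rw [hcre]; linarith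
  rw [Metric.mem_closedBall, dist_eq_norm] at hz
  have hzre := (Complex.abs_re_le_norm (z - c)).trans hz
  have hzim := (Complex.abs_im_le_norm (z - c)).trans hz
  rw [Complex.sub_re, hcre, abs_le] at hzre
  rw [Complex.sub_im, hcim] at hzim
  have hz1 : 1 - η < z.re := by linarith [hzre.1]
  have hz4 : z.re < 4 := by linarith [hzre.2]
  have him : |z.im| + 2 ≤ Real.exp ((K + 1) * ℓ) := by
    have h5 : |z.im| ≤ |z.im - t| + |t| := by simpa using abs_add_le (z.im - t) t
    have h6 : (1 : ℝ) ≤ Real.exp (K * ℓ) := Real.one_le_exp (by positivity)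
    have h7 : (6 : ℝ) ≤ Real.exp ℓ := by
      have := Real.exp_one_gt_d9
      calc (6 : ℝ) ≤ Real.exp 1 ^ 2 := by nlinarith
        _ = Real.exp 2 := by rw [← Real.exp_nat_mul]; norm_num
        _ ≤ Real.exp ℓ := Real.exp_le_exp.2 h2
    rw [add_mul, one_mul, Real.exp_add]
    nlinarith
  have hG : (|z.im| + 2) ^ (η / M) ≤ Real.exp (b * ℓ * η / 192) := by
    calc (|z.im| + 2) ^ (η / M) ≤ Real.exp ((K + 1) * ℓ) ^ (η / M) := by gcongr
      _ = Real.exp ((K + 1) * ℓ * (η / M)) := by rw [← Real.exp_mul]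
      _ ≤ _ := by
        rw [Real.exp_le_exp]
        have h8 : (K + 1) / M ≤ b / 192 := by
          rw [div_le_iff₀ (by linarith), hM]
          have : b / 192 * (1 + 192 * (K + 1) / b) = b / 192 + (K + 1) := by field_simp
          rw [this]; linarith
        calc (K + 1) * ℓ * (η / M) = (K + 1) / M * (ℓ * η) := by ring
          _ ≤ b / 192 * (ℓ * η) := by gcongr
          _ = _ := by ring
  have hP : C * (ℓ ^ m * ((1 + 2 * (ℓ / D)) * (2 * (ℓ / D)))) ≤ Real.exp (b * ℓ * η / 192) := by
    have h9 : ℓ ^ m * ((1 + 2 * (ℓ / D)) * (2 * (ℓ / D))) ≤ (1 + 2 / D) ^ 2 * ℓ ^ (m + 2) := by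
      rw [Real.rpow_add hℓ, Real.rpow_two]
      have : (1 + 2 * (ℓ / D)) * (2 * (ℓ / D)) ≤ (1 + 2 / D) ^ 2 * ℓ ^ 2 := by
        have h10 : 1 + 2 * (ℓ / D) ≤ (1 + 2 / D) * ℓ := by
          have : (1 + 2 / D) * ℓ = ℓ + 2 * (ℓ / D) := by ring
          rw [this]; linarith
        have h11 : 2 * (ℓ / D) ≤ (1 + 2 / D) * ℓ := by linarith
        calc _ ≤ ((1 + 2 / D) * ℓ) * ((1 + 2 / D) * ℓ) := by gcongr
          _ = _ := by ring
      calc _ ≤ ℓ ^ m * ((1 + 2 / D) ^ 2 * ℓ ^ 2) := by gcongr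
        _ = _ := by ring
    have h12 : Real.exp (-(b * η / 192) * ℓ) * Real.exp (b * ℓ * η / 192) = 1 := by
      rw [← Real.exp_add]; convert Real.exp_zero using 2; ring
    have h13 := Real.exp_pos (b * ℓ * η / 192)
    calc _ ≤ C * ((1 + 2 / D) ^ 2 * ℓ ^ (m + 2)) := by gcongr
      _ = (C * (1 + 2 / D) ^ 2 * (ℓ ^ (m + 2) * Real.exp (-(b * η / 192) * ℓ))) *
          Real.exp (b * ℓ * η / 192) := by
          linear_combination (-(C * (1 + 2 / D) ^ 2 * ℓ ^ (m + 2))) * h12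
      _ ≤ 1 * Real.exp (b * ℓ * η / 192) := by gcongr
      _ = _ := one_mul _
  have hexp : Real.exp (b * ℓ * (η / 2) / 48) =
      Real.exp (b * ℓ * η / 192) * Real.exp (b * ℓ * η / 192) := by
    rw [← Real.exp_add]; congr 1; ring
  have hζc : ‖riemannZeta (c.re : ℂ)‖ ≤ 2 * (ℓ / D) := by
    refine (hζ c.re hc1 (by rw [hcre]; linarith)).trans_eq ?_
    rw [hcre, add_sub_cancel_left, div_div_eq_mul_div, mul_div_assoc]
  have hm1 : 1 ≤ ℓ ^ m := Real.one_le_rpow (by linarith) hm.le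
  have hG0 : (0 : ℝ) ≤ (|z.im| + 2) ^ (η / M) := by positivity
  suffices hmain : ‖f z‖ ≤ C * (ℓ ^ m * ((1 + 2 * (ℓ / D)) * (2 * (ℓ / D)))) *
      (|z.im| + 2) ^ (η / M) * ‖f c‖ by
    refine hmain.trans ?_
    rw [hexp]
    gcongr
  rcases hf with rfl | ⟨q, _, χ, hχ, hq, rfl⟩
  · have h14 := one_le_norm_riemannZeta_mul hc1
    have h15 : ‖zetaOne c‖ = ‖c - 1‖ * ‖riemannZeta c‖ := by
      rw [zetaOne_eq (ne_one_of_one_lt_re hc1), norm_mul]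
    have h16 : D / ℓ ≤ ‖c - 1‖ := by
      have := Complex.re_le_norm (c - 1)
      rw [Complex.sub_re, hcre, Complex.one_re] at this
      linarith
    have h17 : ‖z - 1‖ + 1 ≤ (1 + 2 * (ℓ / D)) * ‖c - 1‖ := by
      have h18 : ‖z - 1‖ ≤ ‖z - c‖ + ‖c - 1‖ := by simpa using norm_add_le (z - c) (c - 1)
      have h19 : 1 ≤ ℓ / D * ‖c - 1‖ := by
        calc (1 : ℝ) = ℓ / D * (D / ℓ) := by field_simp
          _ ≤ _ := by gcongr
      nlinarith
    have h20 : 1 ≤ ‖riemannZeta c‖ * (2 * (ℓ / D)) := h14.trans (by gcongr)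
    calc _ ≤ C * (‖z - 1‖ + 1) * (|z.im| + 2) ^ (η / M) := hZ z hz1 hz4
      _ ≤ C * ((1 + 2 * (ℓ / D)) * ‖c - 1‖) * (|z.im| + 2) ^ (η / M) * 1 := by
        rw [mul_one]; gcongr
      _ ≤ C * (ℓ ^ m * ((1 + 2 * (ℓ / D)) * ‖c - 1‖)) * (|z.im| + 2) ^ (η / M) *
          (‖riemannZeta c‖ * (2 * (ℓ / D))) := by
        have h22 : (1 + 2 * (ℓ / D)) * ‖c - 1‖ ≤ ℓ ^ m * ((1 + 2 * (ℓ / D)) * ‖c - 1‖) :=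
          le_mul_of_one_le_left (by positivity) hm1
        have h23 : 0 ≤ (1 + 2 * (ℓ / D)) * ‖c - 1‖ := by positivity
        generalize (1 + 2 * (ℓ / D)) * ‖c - 1‖ = X at h22 h23 ⊢
        gcongr
      _ = _ := by rw [h15]; ring
  · have h14 := one_le_norm_LFunction_mul χ hc1
    have h20 : 1 ≤ ‖LFunction χ c‖ * (2 * (ℓ / D)) := h14.trans (by gcongr)
    have h21 : 1 ≤ 1 + 2 * (ℓ / D) := by linarith [show 0 ≤ 2 * (ℓ / D) by positivity]
    calc _ ≤ C * q * (|z.im| + 2) ^ (η / M) := hL q χ hχ z hz1 hz4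
      _ ≤ C * ℓ ^ m * (|z.im| + 2) ^ (η / M) * 1 := by rw [mul_one]; gcongr
      _ ≤ C * (ℓ ^ m * (1 + 2 * (ℓ / D))) * (|z.im| + 2) ^ (η / M) *
          (‖LFunction χ c‖ * (2 * (ℓ / D))) := by
        gcongr
        exact le_mul_of_one_le_right (by positivity) h21
      _ = _ := by ring

end SiegelWalfisz

namespace SiegelWalfisz

open scoped Topology
open DirichletCharacter ArithmeticFunction Filter

/-- The contradiction coming from the `3-4-1` inequality, stated so as to cover all the types of
characters at once. -/
lemma eventually_no_zero {K m B : ℝ} (hK : 0 < K) (hm : 0 < m) (hB : 0 < B) :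
    ∀ᶠ ℓ : ℝ in atTop, ∀ f g, Admissible ℓ m f → Admissible ℓ m g → ∀ b c : ℕ → ℂ,
      (∀ n, (‖b n‖ = 1 ∧ c n = b n ^ 2) ∨ (b n = 0 ∧ ‖c n‖ ≤ 1)) → ∀ β t : ℝ,
      1 - B / ℓ ≤ β → β < 1 → |t| ≤ Real.exp (K * ℓ) → f (β + t * Complex.I) = 0 →
      (LSeries (fun n => b n * vonMangoldt n)
          (((1 + 8 * B / ℓ : ℝ) : ℂ) + t * Complex.I)).re ≤
        -(deriv f (((1 + 8 * B / ℓ : ℝ) : ℂ) + t * Complex.I) /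
          f (((1 + 8 * B / ℓ : ℝ) : ℂ) + t * Complex.I)).re + 8 * B →
      (LSeries (fun n => c n * vonMangoldt n)
          (((1 + 8 * B / ℓ : ℝ) : ℂ) + 2 * t * Complex.I)).re ≤
        -(deriv g (((1 + 8 * B / ℓ : ℝ) : ℂ) + (2 * t : ℝ) * Complex.I) /
          g (((1 + 8 * B / ℓ : ℝ) : ℂ) + (2 * t : ℝ) * Complex.I)).re + 8 * B → False := by
  obtain ⟨δ, hδ, C, hC, hζ⟩ := exists_zetaOne_bounds
  obtain ⟨r, hr, hr2, hloc⟩ := local_growth (K := K) (m := m) (D := 8 * B) (b := 1 / (200 * B))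
    hK hm (by positivity) (by positivity)
  filter_upwards [hloc, eventually_gt_atTop 0, eventually_ge_atTop (8 * B / δ),
    eventually_gt_atTop (9 * B / r), eventually_gt_atTop (100 * B * (3 * C + 4 / r + 40 * B))]
    with ℓ hloc hℓ hℓδ hℓr hbig f g hf hg b c hbc β t hβ hβ1 ht h0 hb1 hc1
  set U := 1 / (200 * B) * ℓ * r / 48 with hU
  have hU0 : 0 < U := by positivity
  have hx : 0 < 8 * B / ℓ := by positivity
  have hxδ : 8 * B / ℓ ≤ δ := by rw [div_le_iff₀ hℓ]; rw [div_le_iff₀ hδ] at hℓδ; linarith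
  have h341 := three_four_one hbc (σ := 1 + 8 * B / ℓ) (t := t) (by linarith)
  have hre : ∀ u : ℝ, (((1 + 8 * B / ℓ : ℝ) : ℂ) + u * Complex.I).re = 1 + 8 * B / ℓ := by
    intro u; simp
  have key1 : (LSeries (fun n => vonMangoldt n) ((1 + 8 * B / ℓ : ℝ) : ℂ)).re ≤
      ℓ / (8 * B) + C := by
    rw [LSeries_vonMangoldt_eq_zetaOne (by rw [Complex.ofReal_re]; linarith), Complex.sub_re]
    have e1 : (((1 + 8 * B / ℓ : ℝ) : ℂ) - 1) = ((8 * B / ℓ : ℝ) : ℂ) := by push_cast; ring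
    have h1 := (hζ ((1 + 8 * B / ℓ : ℝ) : ℂ)
      (by rw [e1, Complex.norm_real, Real.norm_of_nonneg hx.le]; exact hxδ)).2.2
    have h2 := (abs_le.1 ((Complex.abs_re_le_norm _).trans h1)).1
    rw [e1, ← Complex.ofReal_inv, Complex.ofReal_re, inv_div]
    linarith
  have hz : ∀ {h : ℂ → ℂ} {u : ℝ}, Admissible ℓ m h →
      ∀ z ∈ Metric.ball (((1 + 8 * B / ℓ : ℝ) : ℂ) + u * Complex.I) r, h z = 0 →
        z.re ≤ (((1 + 8 * B / ℓ : ℝ) : ℂ) + u * Complex.I).re := by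
    intro h u hh z _ hz0
    rw [hre]
    by_contra! hlt
    exact hh.ne_zero (by linarith) hz0
  have hexp := Real.exp_pos (K * ℓ)
  have hUr : 48 * U / r = ℓ / (200 * B) := by rw [hU]; field_simp
  have key3 := neg_re_logDeriv_le hg.differentiable hr hU0 (hg.ne_zero (by rw [hre]; linarith))
    (hloc g hg (2 * t) (by rw [abs_mul, abs_two]; linarith)) (hz hg)
  have hx0 : 0 < 1 + 8 * B / ℓ - β := by linarith
  have hx9 : 1 + 8 * B / ℓ - β ≤ 9 * B / ℓ := by
    have : 9 * B / ℓ = 8 * B / ℓ + B / ℓ := by ring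
    linarith
  have hxr : 1 + 8 * B / ℓ - β < r :=
    hx9.trans_lt (by rw [div_lt_iff₀ hℓ]; rw [div_lt_iff₀ hr] at hℓr; linarith)
  have key2 := neg_re_logDeriv_le_of_zero hf.differentiable hr hU0
    (hf.ne_zero (by rw [hre]; linarith))
    (hloc f hf t (by linarith [abs_nonneg t])) (hz hf) hx0 hxr
    (by rw [← h0]; congr 1; push_cast; ring)
  rw [hUr] at key2 key3
  have h3 : ℓ / (9 * B) ≤ 1 / (1 + 8 * B / ℓ - β) := by
    rw [div_le_div_iff₀ (by positivity) hx0]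
    calc ℓ * (1 + 8 * B / ℓ - β) ≤ ℓ * (9 * B / ℓ) := by gcongr
      _ = 1 * (9 * B) := by field_simp
  have h4 : (1 + 8 * B / ℓ - β) / r ^ 2 ≤ 1 / r := by
    rw [div_le_div_iff₀ (by positivity) hr]
    nlinarith
  have e8 : ℓ / (8 * B) = 225 * (ℓ / (1800 * B)) := by field_simp; norm_num
  have e9 : ℓ / (9 * B) = 200 * (ℓ / (1800 * B)) := by field_simp; norm_num
  have e200 : ℓ / (200 * B) = 9 * (ℓ / (1800 * B)) := by field_simp; norm_num
  have ebig : 3 * C + 4 * (1 / r) + 40 * B < 18 * (ℓ / (1800 * B)) := by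
    have : 18 * (ℓ / (1800 * B)) = ℓ / (100 * B) := by field_simp; norm_num
    rw [this, lt_div_iff₀ (by positivity)]
    have : 4 * (1 / r) = 4 / r := by ring
    rw [this]; linarith
  have hX : 0 < ℓ / (1800 * B) := by positivity
  rw [e8] at key1
  rw [e9] at h3
  rw [e200] at key2 key3
  linarith

end SiegelWalfisz

namespace SiegelWalfisz

open scoped Topology
open DirichletCharacter ArithmeticFunction Filter

lemma inv_re_le {x t : ℝ} (hx : 0 < x) {ℓ : ℝ} (hℓ : 0 < ℓ) (ht : 1 ≤ ℓ * t ^ 2) :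
    ((((1 + x : ℝ) : ℂ) + t * Complex.I - 1)⁻¹).re ≤ ℓ * x := by
  have e1 : ((1 + x : ℝ) : ℂ) + t * Complex.I - 1 = (x : ℂ) + t * Complex.I := by push_cast; ring
  rw [e1, Complex.inv_re, Complex.normSq_add_mul_I]
  simp only [Complex.add_re, Complex.ofReal_re, Complex.mul_re, Complex.I_re, Complex.ofReal_im,
    Complex.I_im, mul_zero, zero_mul, sub_zero, add_zero]
  rw [div_le_iff₀ (by positivity)]
  have : 0 ≤ ℓ * x * x ^ 2 := by positivity
  nlinarith

lemma admissible_ne_zero {K m B : ℝ} (hK : 0 < K) (hm : 0 < m) (hB : 0 < B) :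
    ∀ᶠ ℓ : ℝ in atTop, ∀ f, Admissible ℓ m f → ∀ s : ℂ, 1 - B / ℓ ≤ s.re →
      |s.im| ≤ Real.exp (K * ℓ) → f s ≠ 0 := by
  obtain ⟨δ, hδ, C, -, hζ⟩ := exists_zetaOne_bounds
  obtain ⟨c, hc, hquad⟩ := LFunction_ne_zero_near_one (ε := 1 / (4 * m)) (by positivity)
  have hlim : Tendsto (fun ℓ : ℝ => B * ℓ ^ (-1 : ℝ) + ℓ ^ (-(1 / 2) : ℝ)) atTop (𝓝 0) := by
    simpa using ((tendsto_rpow_neg_atTop (y := 1) one_pos).const_mul B).add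
      (tendsto_rpow_neg_atTop (y := 1 / 2) (by norm_num))
  have hlim2 : Tendsto (fun ℓ : ℝ => B * ℓ ^ (-(3 / 4) : ℝ) + ℓ ^ (-(1 / 4) : ℝ)) atTop (𝓝 0) := by
    simpa using ((tendsto_rpow_neg_atTop (y := 3 / 4) (by norm_num)).const_mul B).add
      (tendsto_rpow_neg_atTop (y := 1 / 4) (by norm_num))
  filter_upwards [eventually_no_zero hK hm hB, eventually_ge_atTop 1,
    hlim.eventually (gt_mem_nhds hδ), hlim2.eventually (gt_mem_nhds hc)]
    with ℓ hno hℓ1 h1 h2 f hf s hs ht hs0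
  have hℓ : 0 < ℓ := by linarith
  have hsre : s.re < 1 := by
    by_contra! h
    exact hf.ne_zero h hs0
  have hs0' : f ((s.re : ℂ) + s.im * Complex.I) = 0 := by rwa [Complex.re_add_im]
  have hx : 0 < 8 * B / ℓ := by positivity
  have hσ : ∀ u : ℝ, 1 < (((1 + 8 * B / ℓ : ℝ) : ℂ) + u * Complex.I).re := by
    intro u; simpa using hx
  have hcast : (((1 + 8 * B / ℓ : ℝ) : ℂ) + 2 * s.im * Complex.I) =
      ((1 + 8 * B / ℓ : ℝ) : ℂ) + (2 * s.im : ℝ) * Complex.I := by push_cast; rfl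
  have hℓx : ℓ * (8 * B / ℓ) = 8 * B := by field_simp
  have hzeta : ∀ u : ℝ, 1 ≤ ℓ * u ^ 2 →
      (LSeries (fun n => vonMangoldt n) (((1 + 8 * B / ℓ : ℝ) : ℂ) + u * Complex.I)).re ≤
        -(deriv zetaOne (((1 + 8 * B / ℓ : ℝ) : ℂ) + u * Complex.I) /
          zetaOne (((1 + 8 * B / ℓ : ℝ) : ℂ) + u * Complex.I)).re + 8 * B := by
    intro u hu
    rw [LSeries_vonMangoldt_eq_zetaOne (hσ u), Complex.sub_re]
    have := inv_re_le hx hℓ hu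
    rw [hℓx] at this
    linarith
  have hLf : ∀ {q : ℕ} [NeZero q] (χ : DirichletCharacter ℂ q) (u : ℝ),
      (LSeries (fun n => χ n * vonMangoldt n) (((1 + 8 * B / ℓ : ℝ) : ℂ) + u * Complex.I)).re ≤
        -(deriv (LFunction χ) (((1 + 8 * B / ℓ : ℝ) : ℂ) + u * Complex.I) /
          LFunction χ (((1 + 8 * B / ℓ : ℝ) : ℂ) + u * Complex.I)).re + 8 * B := by
    intro q _ χ u
    rw [LSeries_twist_vonMangoldt_eq_LFunction χ (hσ u), Complex.neg_re]
    linarith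
  have hone : (fun n => (1 : ℂ) * vonMangoldt n) = fun n => (vonMangoldt n : ℂ) :=
    funext fun n => one_mul _
  have hnear : ℓ * s.im ^ 2 < 1 → ‖s - 1‖ ≤ B * ℓ ^ (-1 : ℝ) + ℓ ^ (-(1 / 2) : ℝ) := by
    intro h
    have h3 := Complex.norm_le_abs_re_add_abs_im (s - 1)
    rw [Complex.sub_re, Complex.sub_im, Complex.one_re, Complex.one_im, sub_zero] at h3
    have h4 : |s.re - 1| ≤ B * ℓ ^ (-1 : ℝ) := by
      rw [abs_sub_comm, abs_of_pos (by linarith), Real.rpow_neg_one, ← div_eq_mul_inv]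
      linarith
    have h5 : |s.im| ≤ ℓ ^ (-(1 / 2) : ℝ) := by
      refine abs_le_of_sq_le_sq' ?_ (by positivity) |> abs_le.2
      have h6 : (ℓ ^ (-(1 / 2) : ℝ)) ^ 2 = ℓ ^ (-1 : ℝ) := by
        rw [← Real.rpow_natCast, ← Real.rpow_mul hℓ.le]
        norm_num
      rw [h6, Real.rpow_neg_one, ← one_div, le_div_iff₀ hℓ]
      linarith
    linarith
  have h4im : 1 ≤ ℓ * s.im ^ 2 → 1 ≤ ℓ * (2 * s.im) ^ 2 := by
    intro h; nlinarith
  rcases hf with rfl | ⟨q, _, χ, hχ, hq, rfl⟩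
  · by_cases hcase : 1 ≤ ℓ * s.im ^ 2
    · refine hno zetaOne zetaOne (Or.inl rfl) (Or.inl rfl) (fun _ => 1) (fun _ => 1)
        (fun n => Or.inl ⟨by simp, by simp⟩) s.re s.im hs hsre ht hs0' ?_ ?_
      · rw [hone]; exact hzeta _ hcase
      · rw [hone, hcast]; exact hzeta _ (h4im hcase)
    · push Not at hcase
      exact (hζ s ((hnear hcase).trans h1.le)).1 hs0
  · by_cases hχ2 : χ ^ 2 = 1
    · by_cases hcase : 1 ≤ ℓ * s.im ^ 2
      · refine hno (LFunction χ) zetaOne (Or.inr ⟨q, _, χ, hχ, hq, rfl⟩) (Or.inl rfl)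
          (fun n => χ n) (fun _ => 1) (fun n => ?_) s.re s.im hs hsre ht hs0' (hLf χ _) ?_
        · rcases quadratic_apply hχ2 (n : ZMod q) with h | h | h
          · exact Or.inr ⟨h, by simp⟩
          · exact Or.inl ⟨by simp [h], by simp [h]⟩
          · exact Or.inl ⟨by simp [h], by simp [h]⟩
        · rw [hone, hcast]; exact hzeta _ (h4im hcase)
      · push Not at hcase
        refine hquad q χ hχ hχ2 s ((hnear hcase).trans ?_) hs0
        have hq0 : (0 : ℝ) < q := by exact_mod_cast NeZero.pos q
        have h6 : ℓ ^ (-(1 / 4) : ℝ) ≤ (q : ℝ) ^ (-(1 / (4 * m)) : ℝ) := by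
          calc ℓ ^ (-(1 / 4) : ℝ) = (ℓ ^ m) ^ (-(1 / (4 * m)) : ℝ) := by
                rw [← Real.rpow_mul hℓ.le]; congr 1; field_simp
            _ ≤ _ := Real.rpow_le_rpow_of_nonpos hq0 hq (by
                rw [neg_nonpos]; positivity)
        refine le_trans ?_ (mul_le_mul_of_nonneg_left h6 hc.le)
        calc B * ℓ ^ (-1 : ℝ) + ℓ ^ (-(1 / 2) : ℝ)
            = (B * ℓ ^ (-(3 / 4) : ℝ) + ℓ ^ (-(1 / 4) : ℝ)) * ℓ ^ (-(1 / 4) : ℝ) := by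
              rw [add_mul, mul_assoc, ← Real.rpow_add hℓ, ← Real.rpow_add hℓ]; norm_num
          _ ≤ c * ℓ ^ (-(1 / 4) : ℝ) := by gcongr
    · refine hno (LFunction χ) (LFunction (χ ^ 2)) (Or.inr ⟨q, _, χ, hχ, hq, rfl⟩)
          (Or.inr ⟨q, _, χ ^ 2, hχ2, hq, rfl⟩)
          (fun n => χ n) (fun n => (χ ^ 2) n) (fun n => ?_) s.re s.im hs hsre ht hs0' (hLf χ _) ?_
      · by_cases hn : IsUnit (n : ZMod q)
        · exact Or.inl ⟨χ.unit_norm_eq_one hn.unit, MulChar.pow_apply' _ two_ne_zero _⟩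
        · exact Or.inr ⟨χ.map_nonunit hn, (χ ^ 2).norm_le_one _⟩
      · rw [hcast]; exact hLf (χ ^ 2) _

/-- Zero-free region of Vinogradov type at bounded `log`-power moduli, with the corresponding bound
for the logarithmic derivative. -/
lemma admissible_logDeriv {K m B : ℝ} (hK : 0 < K) (hm : 0 < m) (hB : 0 < B) :
    ∀ᶠ ℓ : ℝ in atTop, ∀ f, Admissible ℓ m f → ∀ s : ℂ, |s.re - 1| ≤ B / ℓ →
      |s.im| ≤ Real.exp (K * ℓ) → f s ≠ 0 ∧ ‖deriv f s / f s‖ ≤ ℓ ^ 3 := by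
  obtain ⟨r, hr, hr2, hloc⟩ := local_growth (K := K) (m := m) (D := 2 * B) (b := 1)
    hK hm (by positivity) one_pos
  filter_upwards [hloc, admissible_ne_zero (K := K + 1) (m := m) (B := 4 * B) (by positivity) hm
    (by positivity), eventually_ge_atTop 1, eventually_ge_atTop (6 * B / r),
    eventually_ge_atTop (1 / B), eventually_ge_atTop (6 * B)]
    with ℓ hloc hnz hℓ1 hℓr hℓB hℓB6 f hf s hs ht
  have hℓ : 0 < ℓ := by linarith
  have hBℓ : 0 < B / ℓ := by positivity
  have hexp : (1 : ℝ) ≤ Real.exp (K * ℓ) := Real.one_le_exp (by positivity)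
  have hexp2 : Real.exp (K * ℓ) + 1 ≤ Real.exp ((K + 1) * ℓ) := by
    rw [add_mul, one_mul, Real.exp_add]
    have : (2 : ℝ) ≤ Real.exp ℓ := by linarith [Real.add_one_le_exp ℓ]
    nlinarith
  rw [abs_le] at hs
  have e4 : 4 * B / ℓ = 4 * (B / ℓ) := by ring
  have e6 : 6 * B / ℓ = 6 * (B / ℓ) := by ring
  have e2 : 2 * B / ℓ = 2 * (B / ℓ) := by ring
  have h6r : 6 * B / ℓ ≤ r := by rw [div_le_iff₀ hℓ]; rw [div_le_iff₀ hr] at hℓr; linarith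
  have h61 : 6 * B / ℓ ≤ 1 := (div_le_one hℓ).2 hℓB6
  refine ⟨hnz f hf s (by rw [e4]; linarith [hs.1]) (by linarith), ?_⟩
  have key := norm_logDeriv_le_of_ne_zero hf.differentiable
    (c := ((1 + 2 * B / ℓ : ℝ) : ℂ) + s.im * Complex.I) (r := 6 * B / ℓ) (U := 1 * ℓ * r / 48)
    (z := s) (by positivity) (by positivity) ?_ ?_ ?_
  · refine key.trans ?_
    rw [div_le_iff₀ (by positivity)]
    have h7 : 1 ≤ B * ℓ := by rw [div_le_iff₀ hB] at hℓB; linarith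
    calc 24 * (1 * ℓ * r / 48) = ℓ * (r / 2) := by ring
      _ ≤ ℓ * (6 * (B * ℓ)) := by gcongr; linarith
      _ = ℓ ^ 2 * (6 * B) := by ring
      _ = ℓ ^ 3 * (6 * B / ℓ) := by field_simp
  · intro z hz
    rw [Metric.mem_ball, dist_eq_norm] at hz
    have h1 := (Complex.abs_re_le_norm _).trans hz.le
    have h2 := (Complex.abs_im_le_norm _).trans hz.le
    simp only [Complex.sub_re, Complex.add_re, Complex.ofReal_re, Complex.mul_re, Complex.I_re,
      mul_zero, Complex.ofReal_im, Complex.I_im, mul_one, sub_self, add_zero, Complex.sub_im,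
      Complex.add_im, Complex.mul_im, zero_add] at h1 h2
    have h3 := abs_add_le (z.im - s.im) s.im
    rw [sub_add_cancel] at h3
    refine hnz f hf z ?_ (by linarith)
    rw [abs_le] at h1
    rw [e4]
    rw [e2, e6] at h1
    linarith [h1.1]
  · intro z hz
    refine hloc f hf s.im (by linarith) z ?_
    exact Metric.closedBall_subset_closedBall h6r (Metric.ball_subset_closedBall hz)
  · have : s - (((1 + 2 * B / ℓ : ℝ) : ℂ) + s.im * Complex.I) =
        ((s.re - (1 + 2 * B / ℓ) : ℝ) : ℂ) := by
      apply Complex.ext <;> simp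
    rw [Metric.mem_closedBall, dist_eq_norm, this, Complex.norm_real, Real.norm_eq_abs, abs_le, e2,
      e6]
    constructor <;> linarith [hs.1, hs.2]

end SiegelWalfisz

namespace SiegelWalfisz

open scoped Topology
open Filter MeasureTheory

lemma norm_inv_mul_add_one_le {s : ℂ} (hs : 1 / 2 ≤ s.re) :
    ‖(s * (s + 1))⁻¹‖ ≤ 4 * (1 + s.im ^ 2)⁻¹ := by
  have h : ∀ z : ℂ, 1 / 2 ≤ z.re → z.im = s.im → √(1 + s.im ^ 2) ≤ 2 * ‖z‖ := by
    intro z hz him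
    refine Real.sqrt_le_iff.2 ⟨by positivity, ?_⟩
    rw [mul_pow, ← Complex.normSq_eq_norm_sq, Complex.normSq_apply, him]
    nlinarith
  have h1 := h s hs rfl
  have h2 := h (s + 1) (by simp; linarith) (by simp)
  have h0 : 0 < 1 + s.im ^ 2 := by positivity
  rw [norm_inv, norm_mul, ← div_eq_mul_inv, inv_eq_one_div,
    div_le_div_iff₀ _ h0]
  · calc 1 * (1 + s.im ^ 2) = √(1 + s.im ^ 2) * √(1 + s.im ^ 2) := by
          rw [Real.mul_self_sqrt h0.le, one_mul]
      _ ≤ (2 * ‖s‖) * (2 * ‖s + 1‖) := by gcongr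
      _ = _ := by ring
  · have := Real.sqrt_pos.2 h0
    have h3 : 0 < ‖s‖ := by linarith
    have h4 : 0 < ‖s + 1‖ := by linarith
    positivity

lemma continuous_vertical {g : ℂ → ℂ} {σ : ℝ} (hg : ∀ s : ℂ, s.re = σ → ContinuousAt g s) :
    Continuous fun t : ℝ => g (σ + t * Complex.I) := by
  rw [continuous_iff_continuousAt]
  intro t
  exact ContinuousAt.comp (f := fun t : ℝ => (σ : ℂ) + t * Complex.I) (hg _ (by simp)) (by fun_prop)

lemma ne_zero_of_pos_re {s : ℂ} (hs : 0 < s.re) : s ≠ 0 := by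
  rintro rfl; simp at hs

lemma integrable_vertical {g : ℂ → ℂ} {σ M : ℝ} (hg : ∀ s : ℂ, s.re = σ → ContinuousAt g s)
    (hσ : 1 / 2 ≤ σ) (hM : ∀ s : ℂ, s.re = σ → ‖g s‖ ≤ M) :
    Integrable fun t : ℝ => ((σ + t * Complex.I : ℂ) * (σ + t * Complex.I + 1))⁻¹ *
      g (σ + t * Complex.I) := by
  have hM0 : 0 ≤ M := (norm_nonneg _).trans (hM σ (by simp))
  have hc : Continuous fun t : ℝ => ((σ + t * Complex.I : ℂ) * (σ + t * Complex.I + 1))⁻¹ *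
      g (σ + t * Complex.I) := by
    refine continuous_vertical (g := fun s => (s * (s + 1))⁻¹ * g s) fun s hs => ?_
    refine ContinuousAt.mul (ContinuousAt.inv₀ (by fun_prop) ?_) (hg s hs)
    refine mul_ne_zero (ne_zero_of_pos_re (by linarith)) (ne_zero_of_pos_re ?_)
    simp; linarith
  refine (integrable_inv_one_add_sq.const_mul (4 * M)).mono' hc.aestronglyMeasurable
    (Eventually.of_forall fun t => ?_)
  have h1 := norm_inv_mul_add_one_le (s := σ + t * Complex.I) (by simpa using hσ)
  have h2 := hM (σ + t * Complex.I) (by simp)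
  rw [norm_mul]
  calc _ ≤ (4 * (1 + (σ + t * Complex.I : ℂ).im ^ 2)⁻¹) * M := by gcongr
    _ = _ := by simp; ring

lemma integral_of_hasMellin {f : ℝ → ℂ} {g : ℂ → ℂ} {σ y : ℝ} (hy : 0 < y)
    (hf : ∀ s : ℂ, s.re = σ → HasMellin f s (g s))
    (hg : Integrable fun t : ℝ => g (σ + t * Complex.I)) (hc : ContinuousAt f y) :
    ∫ t : ℝ, (y : ℂ) ^ (-(σ + t * Complex.I)) * g (σ + t * Complex.I) = 2 * Real.pi * f y := by
  have hm : ∀ t : ℝ, mellin f (σ + t * Complex.I) = g (σ + t * Complex.I) := fun t =>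
    (hf _ (by simp)).2
  have h1 := mellinInv_mellin_eq σ f hy (hf σ (by simp)).1
    (by simpa only [Complex.VerticalIntegrable, hm] using hg) hc
  simp only [mellinInv, hm, smul_eq_mul] at h1
  rw [← h1, Complex.real_smul, ← mul_assoc]
  have h2 : (2 * Real.pi : ℂ) * ((1 / (2 * Real.pi) : ℝ) : ℂ) = 1 := by
    push_cast
    field_simp
  rw [h2, one_mul]

lemma perron_kernel {σ y : ℝ} (hσ : 1 / 2 ≤ σ) (hy : 0 < y) :
    ∫ t : ℝ, (y : ℂ) ^ (-(σ + t * Complex.I)) *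
      ((σ + t * Complex.I : ℂ) * (σ + t * Complex.I + 1))⁻¹ =
      2 * Real.pi * ((max (1 - y) 0 : ℝ) : ℂ) := by
  set f : ℝ → ℂ := fun t => Set.indicator (Set.Ioc 0 1) (fun _ => 1 : ℝ → ℂ) t -
    Set.indicator (Set.Ioc 0 1) (fun t => (t : ℂ) ^ (1 : ℂ) : ℝ → ℂ) t with hf
  have hval : ∀ t : ℝ, 0 < t → f t = ((max (1 - t) 0 : ℝ) : ℂ) := by
    intro t ht
    by_cases h : t ≤ 1
    · simp [hf, ht, h]
    · simp [hf, h, (not_le.1 h).le]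
  rw [← hval y hy]
  refine integral_of_hasMellin (g := fun s => (s * (s + 1))⁻¹) hy ?_ ?_ ?_
  · intro s hs
    have h1 := hasMellin_one_Ioc (s := s) (by linarith)
    have h2 := hasMellin_cpow_Ioc 1 (s := s) (by simp; linarith)
    have := hasMellin_sub h1.1 h2.1
    rw [h1.2, h2.2] at this
    convert! this using 1
    have e1 := ne_zero_of_pos_re (s := s) (by linarith)
    have e2 := ne_zero_of_pos_re (s := s + 1) (by simp; linarith)
    field_simp
    ring
  · have := integrable_vertical (g := fun _ => 1) (σ := σ) (M := 1)
      (fun _ _ => continuousAt_const) hσ (by simp)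
    simpa using this
  · refine ContinuousAt.congr (f := fun t : ℝ => ((max (1 - t) 0 : ℝ) : ℂ)) (by fun_prop) ?_
    filter_upwards [lt_mem_nhds hy] with t ht using (hval t ht).symm

lemma perron_kernel_pole {σ y : ℝ} (hσ : 1 < σ) (hy : 0 < y) :
    ∫ t : ℝ, (y : ℂ) ^ (-(σ + t * Complex.I)) *
      (((σ + t * Complex.I : ℂ) * (σ + t * Complex.I + 1))⁻¹ * (σ + t * Complex.I - 1)⁻¹) =
      2 * Real.pi * ((max (1 - y) 0 ^ 2 / (2 * y) : ℝ) : ℂ) := by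
  set f : ℝ → ℂ := fun t => (1 / 2 : ℂ) • (
    Set.indicator (Set.Ioc 0 1) (fun t => (t : ℂ) ^ (-1 : ℂ) : ℝ → ℂ) t +
    Set.indicator (Set.Ioc 0 1) (fun t => (t : ℂ) ^ (1 : ℂ) : ℝ → ℂ) t) -
    Set.indicator (Set.Ioc 0 1) (fun _ => 1 : ℝ → ℂ) t with hf
  have hval : ∀ t : ℝ, 0 < t → f t = ((max (1 - t) 0 ^ 2 / (2 * t) : ℝ) : ℂ) := by
    intro t ht
    have ht0 : (t : ℂ) ≠ 0 := by exact_mod_cast ht.ne'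
    by_cases h : t ≤ 1
    · have hm : max (1 - t) 0 = 1 - t := max_eq_left (by linarith)
      simp only [hf, Set.indicator_of_mem (Set.mem_Ioc.2 ⟨ht, h⟩), Complex.cpow_neg_one,
        Complex.cpow_one, smul_eq_mul, hm]
      push_cast
      field_simp
      ring
    · have hm : max (1 - t) 0 = 0 := max_eq_right (by linarith)
      simp [hf, h, hm]
  rw [← hval y hy]
  refine integral_of_hasMellin (g := fun s => (s * (s + 1))⁻¹ * (s - 1)⁻¹) hy ?_ ?_ ?_
  · intro s hs
    have h0 := hasMellin_cpow_Ioc (-1) (s := s) (by simp; linarith)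
    have h1 := hasMellin_one_Ioc (s := s) (by linarith)
    have h2 := hasMellin_cpow_Ioc 1 (s := s) (by simp; linarith)
    have h3 := hasMellin_add h0.1 h2.1
    have h4 := hasMellin_const_smul h3.1 (1 / 2 : ℂ)
    have := hasMellin_sub h4.1 h1.1
    rw [h4.2, h3.2, h1.2, h2.2, h0.2] at this
    convert! this using 1
    have e0 : s - 1 ≠ 0 := ne_zero_of_pos_re (by simp; linarith)
    have e0' : s + -1 ≠ 0 := by simpa [sub_eq_add_neg] using e0
    have e1 := ne_zero_of_pos_re (s := s) (by linarith)
    have e2 := ne_zero_of_pos_re (s := s + 1) (by simp; linarith)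
    rw [smul_eq_mul]
    field_simp
    ring
  · refine integrable_vertical (g := fun s => (s - 1)⁻¹) (σ := σ) (M := (σ - 1)⁻¹)
      (fun s hs => ContinuousAt.inv₀ (by fun_prop) (ne_zero_of_pos_re (by simp; linarith)))
      (by linarith) fun s hs => ?_
    rw [norm_inv]
    have := Complex.re_le_norm (s - 1)
    rw [Complex.sub_re, Complex.one_re, hs] at this
    have h0 : 0 < σ - 1 := by linarith
    gcongr
  · refine ContinuousAt.congr (f := fun t : ℝ => ((max (1 - t) 0 ^ 2 / (2 * t) : ℝ) : ℂ)) ?_ ?_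
    · refine Complex.continuous_ofReal.continuousAt.comp (ContinuousAt.div (by fun_prop)
        (by fun_prop) (by positivity))
    · filter_upwards [lt_mem_nhds hy] with t ht using (hval t ht).symm

lemma perron_sum {a : ℕ → ℂ} (ha0 : a 0 = 0) {σ x : ℝ} (hσ : 1 / 2 ≤ σ) (hx : 0 < x)
    (ha : LSeriesSummable a σ) :
    ∫ t : ℝ, (x : ℂ) ^ (σ + t * Complex.I) *
      (((σ + t * Complex.I : ℂ) * (σ + t * Complex.I + 1))⁻¹ * LSeries a (σ + t * Complex.I)) =
      2 * Real.pi * ∑ n ∈ Finset.range (⌊x⌋₊ + 1), a n * (1 - n / x) := by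
  have hx0 : (x : ℂ) ≠ 0 := by exact_mod_cast hx.ne'
  set F : ℕ → ℝ → ℂ := fun n t => a n * ((n / x : ℝ) : ℂ) ^ (-(σ + t * Complex.I)) *
    ((σ + t * Complex.I : ℂ) * (σ + t * Complex.I + 1))⁻¹ with hF
  have hterm : ∀ n t, F n t = (x : ℂ) ^ (σ + t * Complex.I) *
      (((σ + t * Complex.I : ℂ) * (σ + t * Complex.I + 1))⁻¹ *
        LSeries.term a (σ + t * Complex.I) n) := by
    intro n t
    rcases eq_or_ne n 0 with rfl | hn
    · simp [hF, ha0]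
    · have hn0 : (n : ℂ) ≠ 0 := by exact_mod_cast hn
      have : ((n / x : ℝ) : ℂ) ^ (-(σ + t * Complex.I)) =
          (x : ℂ) ^ (σ + t * Complex.I) * ((n : ℂ) ^ (σ + t * Complex.I))⁻¹ := by
        have h1 : (n : ℂ) ^ (σ + t * Complex.I : ℂ) =
            ((n / x : ℝ) : ℂ) ^ (σ + t * Complex.I : ℂ) * (x : ℂ) ^ (σ + t * Complex.I : ℂ) := by
          rw [← Complex.mul_cpow_ofReal_nonneg (by positivity) hx.le, ← Complex.ofReal_mul,
            div_mul_cancel₀ _ hx.ne', Complex.ofReal_natCast]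
        have h2 : (x : ℂ) ^ (σ + t * Complex.I : ℂ) ≠ 0 := by simp [Complex.cpow_eq_zero_iff, hx0]
        have h3 : ((n / x : ℝ) : ℂ) ≠ 0 := by
          exact_mod_cast (by positivity : (n / x : ℝ) ≠ 0)
        have h4 : ((n / x : ℝ) : ℂ) ^ (σ + t * Complex.I : ℂ) ≠ 0 := by
          rw [Ne, Complex.cpow_eq_zero_iff]; exact fun h => h3 h.1
        rw [h1, Complex.cpow_neg]
        field_simp
      rw [LSeries.term_of_ne_zero hn]
      simp only [hF]
      rw [this]
      ring
  have hnorm : ∀ n t, ‖F n t‖ = (x ^ σ * ‖LSeries.term a σ n‖) *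
      ‖((σ + t * Complex.I : ℂ) * (σ + t * Complex.I + 1))⁻¹‖ := by
    intro n t
    rw [hterm, norm_mul, norm_mul, Complex.norm_cpow_eq_rpow_re_of_pos hx, LSeries.norm_term_eq,
      LSeries.norm_term_eq]
    simp
    ring_nf
  have hker := integrable_vertical (g := fun _ => 1) (σ := σ) (M := 1)
      (fun _ _ => continuousAt_const) hσ (by simp)
  simp only [mul_one] at hker
  have hInt : ∀ n, Integrable (F n) := by
    intro n
    rcases eq_or_ne n 0 with rfl | hn
    · simp [hF, ha0]
    · refine ((hker.norm.const_mul (x ^ σ * ‖LSeries.term a σ n‖))).mono' ?_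
        (Eventually.of_forall fun t => (hnorm n t).le)
      refine AEStronglyMeasurable.mul ?_ hker.aestronglyMeasurable
      refine (Continuous.const_mul ?_ _).aestronglyMeasurable
      refine Continuous.const_cpow (by fun_prop) (Or.inl ?_)
      exact_mod_cast (by positivity : (n / x : ℝ) ≠ 0)
  have hsum : Summable fun n => ∫ t, ‖F n t‖ := by
    simp only [hnorm, integral_const_mul]
    exact (ha.norm.mul_left _).mul_right _
  have key := hasSum_integral_of_summable_integral_norm hInt hsum
  have hI : ∀ n, ∫ t, F n t = 2 * Real.pi * (a n * ((max (1 - n / x) 0 : ℝ) : ℂ)) := by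
    intro n
    rcases eq_or_ne n 0 with rfl | hn
    · simp [hF, ha0]
    · simp only [hF, mul_assoc]
      rw [integral_const_mul, perron_kernel hσ (by positivity)]
      ring
  have hfin : HasSum (fun n => ∫ t, F n t)
      (∑ n ∈ Finset.range (⌊x⌋₊ + 1), 2 * Real.pi * (a n * (1 - n / x))) := by
    have : ∑ n ∈ Finset.range (⌊x⌋₊ + 1), 2 * Real.pi * (a n * (1 - n / x)) =
        ∑ n ∈ Finset.range (⌊x⌋₊ + 1), ∫ t, F n t := by
      refine Finset.sum_congr rfl fun n hn => ?_
      have h1 : (n : ℝ) ≤ x :=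
          (Nat.le_floor_iff hx.le).1 (Nat.lt_succ_iff.1 (Finset.mem_range.1 hn))
      rw [hI, max_eq_left (by rw [sub_nonneg]; exact (div_le_one hx).2 h1)]
      push_cast
      rfl
    rw [this]
    refine hasSum_sum_of_ne_finset_zero fun n hn => ?_
    have h1 : x < n := by
      rw [Finset.mem_range, not_lt] at hn
      exact (Nat.floor_lt hx.le).1 hn
    rw [hI, max_eq_right (by rw [sub_nonpos]; exact (one_le_div hx).2 h1.le)]
    simp
  rw [Finset.mul_sum, ← key.unique hfin]
  refine integral_congr_ae (Eventually.of_forall fun t => ?_)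
  simp only [hterm]
  rw [tsum_mul_left, tsum_mul_left]
  rfl

end SiegelWalfisz

namespace SiegelWalfisz

open scoped Topology
open Filter MeasureTheory

lemma half_pi_sub_arctan_le {T : ℝ} (hT : 0 < T) : Real.pi / 2 - Real.arctan T ≤ T⁻¹ := by
  rw [← Real.arctan_inv_of_pos hT]
  calc Real.arctan T⁻¹ ≤ Real.tan (Real.arctan T⁻¹) :=
        Real.le_tan (Real.arctan_nonneg.2 (by positivity)) (Real.arctan_lt_pi_div_two _)
    _ = T⁻¹ := Real.tan_arctan _

/-- Moving the line of integration from `1 + δ` to `1 - δ` below height `T`. -/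
lemma norm_vertical_integral_le {G : ℂ → ℂ} {δ T M x : ℝ} (hδ : 0 < δ) (hδ2 : δ ≤ 1 / 2)
    (hT : 1 ≤ T) (hM : 0 ≤ M) (hx1 : 1 ≤ x)
    (hd : ∀ s : ℂ, |s.re - 1| ≤ δ → |s.im| ≤ T → DifferentiableAt ℂ G s ∧ ‖G s‖ ≤ M)
    (hline : ∀ s : ℂ, s.re = 1 + δ → ContinuousAt G s ∧ ‖G s‖ ≤ M) :
    ‖∫ t : ℝ, (x : ℂ) ^ (((1 + δ : ℝ) : ℂ) + t * Complex.I) *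
      (((((1 + δ : ℝ) : ℂ) + t * Complex.I) * (((1 + δ : ℝ) : ℂ) + t * Complex.I + 1))⁻¹ *
        G (((1 + δ : ℝ) : ℂ) + t * Complex.I))‖ ≤
      4 * Real.pi * (x ^ (1 - δ) * M) + 16 * (x ^ (1 + δ) * M / T) := by
  have hx : 0 < x := by linarith
  have hx0 : (x : ℂ) ≠ 0 := by exact_mod_cast hx.ne'
  have hT0 : 0 < T := by linarith
  set H : ℂ → ℂ := fun s => (s * (s + 1))⁻¹ * ((x : ℂ) ^ s * G s) with hH
  have hHn : ∀ s : ℂ, 1 / 2 ≤ s.re → ‖G s‖ ≤ M →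
      ‖H s‖ ≤ 4 * (x ^ s.re * M) * (1 + s.im ^ 2)⁻¹ := by
    intro s hs hG
    rw [hH, norm_mul, norm_mul, Complex.norm_cpow_eq_rpow_re_of_pos hx]
    calc _ ≤ (4 * (1 + s.im ^ 2)⁻¹) * (x ^ s.re * M) := by
          gcongr
          exact norm_inv_mul_add_one_le hs
      _ = _ := by ring
  have hHi : Integrable fun t : ℝ => H (((1 + δ : ℝ) : ℂ) + t * Complex.I) := by
    refine integrable_vertical (g := fun s => (x : ℂ) ^ s * G s) (σ := 1 + δ)
      (M := x ^ (1 + δ) * M) (fun s hs => ?_) (by linarith) fun s hs => ?_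
    · exact ContinuousAt.mul (ContinuousAt.const_cpow continuousAt_id (Or.inl hx0)) (hline s hs).1
    · rw [norm_mul, Complex.norm_cpow_eq_rpow_re_of_pos hx, hs]
      gcongr
      exact (hline s hs).2
  have hHr : ∀ t : ℝ, ‖H (((1 + δ : ℝ) : ℂ) + t * Complex.I)‖ ≤
      4 * (x ^ (1 + δ) * M) * (1 + t ^ 2)⁻¹ := by
    intro t
    have := hHn (((1 + δ : ℝ) : ℂ) + t * Complex.I) (by simp; linarith) (hline _ (by simp)).2
    simpa using this
  have hrect := Complex.integral_boundary_rect_eq_zero_of_differentiableOn H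
    (((1 - δ : ℝ) : ℂ) + (-T : ℝ) * Complex.I) (((1 + δ : ℝ) : ℂ) + (T : ℝ) * Complex.I) (by
      intro s hs
      simp only [Complex.mem_reProdIm, Complex.add_re, Complex.ofReal_re, Complex.mul_re,
        Complex.I_re, mul_zero, Complex.ofReal_im, Complex.I_im, mul_one, sub_self, add_zero,
        Complex.add_im, Complex.mul_im, zero_add, Set.uIcc_of_le (show 1 - δ ≤ 1 + δ by linarith),
        Set.uIcc_of_le (show -T ≤ T by linarith), Set.mem_Icc] at hs
      obtain ⟨⟨h1, h2⟩, h3, h4⟩ := hs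
      have hG := (hd s (abs_le.2 ⟨by linarith, by linarith⟩) (abs_le.2 ⟨h3, h4⟩)).1
      refine DifferentiableAt.differentiableWithinAt ?_
      refine DifferentiableAt.mul (DifferentiableAt.inv (by fun_prop) ?_)
        (DifferentiableAt.mul (DifferentiableAt.const_cpow differentiableAt_id (Or.inl hx0)) hG)
      exact mul_ne_zero (ne_zero_of_pos_re (by linarith)) (ne_zero_of_pos_re (by simp; linarith)))
  simp only [Complex.add_re, Complex.ofReal_re, Complex.mul_re, Complex.I_re, mul_zero,
    Complex.ofReal_im, Complex.I_im, mul_one, sub_self, add_zero, Complex.add_im, Complex.mul_im,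
    zero_add] at hrect
  set R := ∫ y : ℝ in -T..T, H (((1 + δ : ℝ) : ℂ) + y * Complex.I) with hR
  set L := ∫ y : ℝ in -T..T, H (((1 - δ : ℝ) : ℂ) + y * Complex.I) with hL
  have hLn : ‖L‖ ≤ 4 * Real.pi * (x ^ (1 - δ) * M) := by
    have h1 : ‖L‖ ≤ ∫ y : ℝ in -T..T, 4 * (x ^ (1 - δ) * M) * (1 + y ^ 2)⁻¹ := by
      refine intervalIntegral.norm_integral_le_of_norm_le (by linarith)
        (Eventually.of_forall fun y hy => ?_)
        ((integrable_inv_one_add_sq.const_mul _).intervalIntegrable)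
      have := hHn (((1 - δ : ℝ) : ℂ) + y * Complex.I) (by simp; linarith)
        (hd _ (by simp [abs_of_pos hδ]) (by simpa using abs_le.2 ⟨hy.1.le, hy.2⟩)).2
      simpa using this
    rw [intervalIntegral.integral_const_mul, integral_inv_one_add_sq] at h1
    refine h1.trans ?_
    have h2 := Real.arctan_lt_pi_div_two T
    have h3 := Real.neg_pi_div_two_lt_arctan (-T)
    have h4 : 0 ≤ x ^ (1 - δ) * M := by positivity
    calc _ ≤ 4 * (x ^ (1 - δ) * M) * Real.pi := by gcongr; linarith
      _ = _ := by ring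
  have hhor : ∀ y : ℝ, |y| = T → ‖∫ u : ℝ in (1 - δ)..(1 + δ), H (u + y * Complex.I)‖ ≤
      4 * (x ^ (1 + δ) * M / T) := by
    intro y hy
    have hy2 : y ^ 2 = T ^ 2 := by rw [← sq_abs, hy]
    have h1 := intervalIntegral.norm_integral_le_of_norm_le_const (a := 1 - δ) (b := 1 + δ)
      (f := fun u : ℝ => H (u + y * Complex.I))
      (C := 4 * (x ^ (1 + δ) * M) * (1 + T ^ 2)⁻¹) (fun u hu => by
        rw [Set.uIoc_of_le (by linarith)] at hu
        have := hHn (u + y * Complex.I) (by simp; linarith [hu.1])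
          (hd _ (by simp; exact abs_le.2 ⟨by linarith [hu.1], by linarith [hu.2]⟩)
            (by simp [hy])).2
        simp only [Complex.add_re, Complex.ofReal_re, Complex.mul_re, Complex.I_re, mul_zero,
          Complex.ofReal_im, Complex.I_im, mul_one, sub_self, add_zero, Complex.add_im,
          Complex.mul_im, zero_add, hy2] at this
        refine this.trans ?_
        gcongr
        exact hu.2)
    refine h1.trans ?_
    have e1 : |1 + δ - (1 - δ)| = 2 * δ := by rw [abs_of_pos] <;> linarith
    have e2 : (1 + T ^ 2)⁻¹ ≤ T⁻¹ := by gcongr; nlinarith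
    rw [e1]
    calc _ ≤ 4 * (x ^ (1 + δ) * M) * T⁻¹ * 1 := by gcongr; linarith
      _ = _ := by ring
  have hRn : ‖R‖ ≤ 4 * Real.pi * (x ^ (1 - δ) * M) + 8 * (x ^ (1 + δ) * M / T) := by
    have h1 := hhor (-T) (by rw [abs_neg, abs_of_pos hT0])
    have h2 := hhor T (abs_of_pos hT0)
    set P₁ := ∫ u : ℝ in (1 - δ)..(1 + δ), H (u + ((-T : ℝ) : ℂ) * Complex.I) with hP₁
    set P₂ := ∫ u : ℝ in (1 - δ)..(1 + δ), H (u + (T : ℂ) * Complex.I) with hP₂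
    have h3 : Complex.I * R = Complex.I * L - P₁ + P₂ := by
      simp only [smul_eq_mul] at hrect
      linear_combination hrect
    have h4 : ‖R‖ ≤ ‖L‖ + ‖P₁‖ + ‖P₂‖ := by
      calc ‖R‖ = ‖Complex.I * L - P₁ + P₂‖ := by rw [← h3, norm_mul, Complex.norm_I, one_mul]
        _ ≤ ‖Complex.I * L - P₁‖ + ‖P₂‖ := norm_add_le _ _
        _ ≤ ‖Complex.I * L‖ + ‖P₁‖ + ‖P₂‖ := by gcongr; exact norm_sub_le _ _
        _ = _ := by rw [norm_mul, Complex.norm_I, one_mul]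
    linarith
  have hatan : Real.pi / 2 - Real.arctan T ≤ T⁻¹ := half_pi_sub_arctan_le hT0
  have hc : 0 ≤ x ^ (1 + δ) * M := by positivity
  have hlow : ‖∫ t : ℝ in Set.Iic (-T), H (((1 + δ : ℝ) : ℂ) + t * Complex.I)‖ ≤
      4 * (x ^ (1 + δ) * M / T) := by
    calc _ ≤ ∫ t : ℝ in Set.Iic (-T), 4 * (x ^ (1 + δ) * M) * (1 + t ^ 2)⁻¹ :=
          norm_integral_le_of_norm_le (integrable_inv_one_add_sq.const_mul _).integrableOn
            (Eventually.of_forall hHr)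
      _ = 4 * (x ^ (1 + δ) * M) * (Real.pi / 2 - Real.arctan T) := by
          rw [integral_const_mul, integral_Iic_inv_one_add_sq, Real.arctan_neg]; ring
      _ ≤ 4 * (x ^ (1 + δ) * M) * T⁻¹ := by gcongr
      _ = _ := by ring
  have hhigh : ‖∫ t : ℝ in Set.Ioi T, H (((1 + δ : ℝ) : ℂ) + t * Complex.I)‖ ≤
      4 * (x ^ (1 + δ) * M / T) := by
    calc _ ≤ ∫ t : ℝ in Set.Ioi T, 4 * (x ^ (1 + δ) * M) * (1 + t ^ 2)⁻¹ :=
          norm_integral_le_of_norm_le (integrable_inv_one_add_sq.const_mul _).integrableOn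
            (Eventually.of_forall hHr)
      _ = 4 * (x ^ (1 + δ) * M) * (Real.pi / 2 - Real.arctan T) := by
          rw [integral_const_mul, integral_Ioi_inv_one_add_sq]
      _ ≤ 4 * (x ^ (1 + δ) * M) * T⁻¹ := by gcongr
      _ = _ := by ring
  have hsplit : ∫ t : ℝ, H (((1 + δ : ℝ) : ℂ) + t * Complex.I) =
      (∫ t : ℝ in Set.Iic (-T), H (((1 + δ : ℝ) : ℂ) + t * Complex.I)) +
        (R + ∫ t : ℝ in Set.Ioi T, H (((1 + δ : ℝ) : ℂ) + t * Complex.I)) := by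
    rw [hR, intervalIntegral.integral_interval_add_Ioi hHi.integrableOn hHi.integrableOn,
      intervalIntegral.integral_Iic_add_Ioi hHi.integrableOn hHi.integrableOn]
  have hconv : ∀ t : ℝ, (x : ℂ) ^ (((1 + δ : ℝ) : ℂ) + t * Complex.I) *
      (((((1 + δ : ℝ) : ℂ) + t * Complex.I) * (((1 + δ : ℝ) : ℂ) + t * Complex.I + 1))⁻¹ *
        G (((1 + δ : ℝ) : ℂ) + t * Complex.I)) = H (((1 + δ : ℝ) : ℂ) + t * Complex.I) :=
    fun t => mul_left_comm _ _ _
  simp_rw [hconv]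
  rw [hsplit]
  refine (norm_add_le _ _).trans ((add_le_add_right (norm_add_le _ _) _).trans ?_)
  linarith

end SiegelWalfisz

namespace SiegelWalfisz

open scoped Topology
open DirichletCharacter ArithmeticFunction Filter MeasureTheory

/-- The sequences `Λ` and `χ Λ`, with `χ` nontrivial of modulus at most `ℓ ^ m`, together with their
mean value `c`. -/
def Twist (ℓ m : ℝ) (a : ℕ → ℂ) (c : ℝ) : Prop :=
  ((a = fun n => (vonMangoldt n : ℂ)) ∧ c = 1) ∨ ∃ (q : ℕ) (_ : NeZero q)
    (χ : DirichletCharacter ℂ q), χ ≠ 1 ∧ (q : ℝ) ≤ ℓ ^ m ∧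
      (a = fun n : ℕ => χ n * (vonMangoldt n : ℂ)) ∧ c = 0

lemma Twist.mono {ℓ ℓ' m : ℝ} {a : ℕ → ℂ} {c : ℝ} (h : Twist ℓ m a c) (h0 : 0 ≤ ℓ) (hℓ : ℓ ≤ ℓ')
    (hm : 0 ≤ m) : Twist ℓ' m a c := by
  rcases h with h | ⟨q, hq, χ, hχ, hqm, h⟩
  · exact Or.inl h
  · exact Or.inr ⟨q, hq, χ, hχ, hqm.trans (Real.rpow_le_rpow h0 hℓ hm), h⟩

lemma Twist.norm_le {ℓ m : ℝ} {a : ℕ → ℂ} {c : ℝ} (h : Twist ℓ m a c) (n : ℕ) :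
    ‖a n‖ ≤ vonMangoldt n := by
  have hv : ‖(vonMangoldt n : ℂ)‖ = vonMangoldt n := by
    rw [Complex.norm_real, Real.norm_of_nonneg vonMangoldt_nonneg]
  rcases h with ⟨rfl, -⟩ | ⟨q, hq, χ, -, -, rfl, -⟩
  · exact hv.le
  · rw [norm_mul, hv]
    exact mul_le_of_le_one_left vonMangoldt_nonneg (χ.norm_le_one _)

lemma Twist.mean_mem {ℓ m : ℝ} {a : ℕ → ℂ} {c : ℝ} (h : Twist ℓ m a c) : 0 ≤ c ∧ c ≤ 1 := by
  rcases h with ⟨-, rfl⟩ | ⟨q, hq, χ, -, -, -, rfl⟩ <;> norm_num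

lemma Twist.exists_admissible {ℓ m : ℝ} {a : ℕ → ℂ} {c : ℝ} (h : Twist ℓ m a c) :
    ∃ f, Admissible ℓ m f ∧
      ∀ s : ℂ, 1 < s.re → LSeries a s = c * (s - 1)⁻¹ - deriv f s / f s := by
  rcases h with ⟨rfl, rfl⟩ | ⟨q, hq, χ, hχ, hqm, rfl, rfl⟩
  · exact ⟨zetaOne, Or.inl rfl, fun s hs => by simp [LSeries_vonMangoldt_eq_zetaOne hs]⟩
  · exact ⟨LFunction χ, Or.inr ⟨q, hq, χ, hχ, hqm, rfl⟩, fun s hs => by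
      simp [LSeries_twist_vonMangoldt_eq_LFunction χ hs]⟩

lemma norm_term_le_vonMangoldt {a : ℕ → ℂ} (ha : ∀ n, ‖a n‖ ≤ vonMangoldt n) (s : ℂ) (n : ℕ) :
    ‖LSeries.term a s n‖ ≤ ‖LSeries.term (fun n => (vonMangoldt n : ℂ)) s n‖ := by
  refine LSeries.norm_term_le s ?_
  rw [Complex.norm_real, Real.norm_of_nonneg vonMangoldt_nonneg]
  exact ha n

lemma lseriesSummable_of_norm_le_vonMangoldt {a : ℕ → ℂ} (ha : ∀ n, ‖a n‖ ≤ vonMangoldt n) {s : ℂ}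
    (hs : 1 < s.re) : LSeriesSummable a s :=
  .of_norm <| (LSeriesSummable_vonMangoldt hs).norm.of_nonneg_of_le (fun _ => norm_nonneg _)
    (norm_term_le_vonMangoldt ha s)

lemma norm_LSeries_le_vonMangoldt {a : ℕ → ℂ} (ha : ∀ n, ‖a n‖ ≤ vonMangoldt n) {s : ℂ}
    (hs : 1 < s.re) : ‖LSeries a s‖ ≤ ‖LSeries (fun n => (vonMangoldt n : ℂ)) (s.re : ℂ)‖ := by
  have hS := (LSeriesSummable_vonMangoldt hs).norm
  have h1 : ‖LSeries a s‖ ≤ ∑' n, ‖LSeries.term (fun n => (vonMangoldt n : ℂ)) s n‖ :=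
    tsum_of_norm_bounded hS.hasSum (norm_term_le_vonMangoldt ha s)
  have h2 : LSeries (fun n => (vonMangoldt n : ℂ)) (s.re : ℂ) =
      ((∑' n, ‖LSeries.term (fun n => (vonMangoldt n : ℂ)) s n‖ : ℝ) : ℂ) := by
    rw [LSeries, Complex.ofReal_tsum]
    refine tsum_congr fun n => ?_
    rcases eq_or_ne n 0 with rfl | hn
    · simp
    · rw [LSeries.norm_term_eq, LSeries.term_of_ne_zero hn, if_neg hn, Complex.norm_real,
        Real.norm_of_nonneg vonMangoldt_nonneg, Complex.ofReal_div,
        Complex.ofReal_cpow (Nat.cast_nonneg n)]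
      simp
  rw [h2, Complex.norm_real]
  exact h1.trans (le_abs_self _)

lemma logDeriv_line_le {m B : ℝ} (hB : 0 < B) : ∀ᶠ ℓ : ℝ in atTop, ∀ a c f, Twist ℓ m a c →
    (∀ s : ℂ, 1 < s.re → LSeries a s = c * (s - 1)⁻¹ - deriv f s / f s) →
      ∀ s : ℂ, s.re = 1 + B / ℓ → ‖deriv f s / f s‖ ≤ ℓ ^ 3 := by
  obtain ⟨δ, hδ, C, hC, hz⟩ := exists_zetaOne_bounds
  filter_upwards [eventually_ge_atTop 1, eventually_ge_atTop (B / δ),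
    eventually_ge_atTop (2 / B + C)] with ℓ h1 h2 h3 a c f hT hL s hs
  have hℓ : 0 < ℓ := by linarith
  have hd : 0 < B / ℓ := by positivity
  have hs1 : 1 < s.re := by linarith
  have hre : ∀ z : ℂ, z.re = 1 + B / ℓ → ‖(z - 1)⁻¹‖ ≤ ℓ / B := by
    intro z hz
    rw [norm_inv, ← inv_div]
    have := Complex.re_le_norm (z - 1)
    rw [Complex.sub_re, hz, Complex.one_re] at this
    exact inv_anti₀ hd (by linarith)
  have h4 : ‖LSeries (fun n => (vonMangoldt n : ℂ)) (s.re : ℂ)‖ ≤ ℓ / B + C := by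
    rw [LSeries_vonMangoldt_eq_zetaOne (by simpa using hs1)]
    refine (norm_sub_le _ _).trans (add_le_add (hre _ (by simpa using hs)) (hz _ ?_).2.2)
    have e1 : ((s.re : ℂ) - 1) = ((s.re - 1 : ℝ) : ℂ) := by push_cast; rfl
    rw [e1, Complex.norm_real, Real.norm_of_nonneg (by linarith), hs]
    rw [div_le_iff₀ hδ] at h2
    rw [add_sub_cancel_left, div_le_iff₀ hℓ]
    linarith
  have h5 : deriv f s / f s = c * (s - 1)⁻¹ - LSeries a s := by rw [hL s hs1]; ring
  rw [h5]
  have hc : ‖(c : ℂ) * (s - 1)⁻¹‖ ≤ ℓ / B := by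
    rw [norm_mul, Complex.norm_real, Real.norm_of_nonneg hT.mean_mem.1]
    exact (mul_le_of_le_one_left (norm_nonneg _) hT.mean_mem.2).trans (hre s hs)
  calc _ ≤ ℓ / B + (ℓ / B + C) := (norm_sub_le _ _).trans
        (add_le_add hc ((norm_LSeries_le_vonMangoldt hT.norm_le hs1).trans h4))
    _ ≤ ℓ * (2 / B + C) := by
        have : C ≤ ℓ * C := le_mul_of_one_le_left hC.le h1
        have e : ℓ * (2 / B + C) = ℓ / B + ℓ / B + ℓ * C := by ring
        linarith
    _ ≤ ℓ * ℓ := by gcongr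
    _ ≤ ℓ ^ 3 := by nlinarith [mul_pos hℓ hℓ]

lemma inv_cpow_neg_of_pos {x : ℝ} (hx : 0 < x) (s : ℂ) : ((x⁻¹ : ℝ) : ℂ) ^ (-s) = (x : ℂ) ^ s := by
  rw [Complex.ofReal_inv, Complex.cpow_neg, Complex.inv_cpow, inv_inv]
  rw [Complex.arg_ofReal_of_nonneg hx.le]
  exact Real.pi_pos.ne

/-- The smoothed prime number theorem for twists of `Λ`. -/
lemma smooth_sum_le {m B : ℝ} (hm : 0 < m) (hB : 0 < B) : ∀ᶠ ℓ : ℝ in atTop, ∀ a c,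
    Twist ℓ m a c →
      ‖∑ n ∈ Finset.range (⌊Real.exp (ℓ ^ 2)⌋₊ + 1), a n * (1 - n / (Real.exp (ℓ ^ 2) : ℝ)) -
        ((c * ((Real.exp (ℓ ^ 2) - 1) ^ 2 / (2 * Real.exp (ℓ ^ 2))) : ℝ) : ℂ)‖ ≤
        Real.exp (ℓ ^ 2 - B * ℓ) := by
  have hpow : ∀ᶠ ℓ : ℝ in atTop, 64 * ℓ ^ 3 ≤ Real.exp ℓ := by
    filter_upwards [(Real.isLittleO_pow_exp_atTop (n := 3)).bound
      (show (0 : ℝ) < 1 / 64 by norm_num),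
      eventually_ge_atTop 0] with ℓ h h0
    rw [Real.norm_of_nonneg (by positivity), Real.norm_of_nonneg (by positivity)] at h
    linarith
  filter_upwards [admissible_logDeriv (K := 2 * (B + 1)) (m := m) (B := B + 1) (by positivity) hm
    (by positivity), logDeriv_line_le (m := m) (B := B + 1) (by positivity), hpow,
    eventually_ge_atTop 1, eventually_ge_atTop (2 * (B + 1))] with ℓ hlog hline h64 h1 h2 a c hT
  have hℓ : 0 < ℓ := by linarith
  obtain ⟨f, hf, hL⟩ := hT.exists_admissible
  set δ := (B + 1) / ℓ with hδ
  set x := Real.exp (ℓ ^ 2) with hx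
  have hδ0 : 0 < δ := by positivity
  have hx0 : 0 < x := Real.exp_pos _
  have hx1 : 1 ≤ x := Real.one_le_exp (by positivity)
  have hδ2 : δ ≤ 1 / 2 := by rw [hδ, div_le_iff₀ hℓ]; linarith
  have hlf := hline a c f hT hL
  have hcont : ∀ s : ℂ, s.re = 1 + δ → ContinuousAt (fun s => deriv f s / f s) s := fun s hs =>
    ((hf.differentiable.contDiff.continuous_deriv (n := 1) le_rfl).continuousAt.div
      hf.differentiable.continuous.continuousAt (hf.ne_zero (by linarith)))
  have hInt := norm_vertical_integral_le (G := fun s => deriv f s / f s) (δ := δ)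
    (T := Real.exp (2 * (B + 1) * ℓ)) (M := ℓ ^ 3) (x := x) hδ0 hδ2
    (Real.one_le_exp (by positivity)) (by positivity) hx1 (fun s h3 h4 => by
      obtain ⟨h5, h6⟩ := hlog f hf s h3 h4
      exact ⟨hf.differentiable.deriv.differentiableAt.div
        hf.differentiable.differentiableAt h5, h6⟩) fun s hs => ⟨hcont s hs, hlf s hs⟩
  have e1 : x ^ (1 - δ) = Real.exp (ℓ ^ 2 - (B + 1) * ℓ) := by
    rw [hx, ← Real.exp_mul, hδ]; congr 1; field_simp
  have e2 : x ^ (1 + δ) * ℓ ^ 3 / Real.exp (2 * (B + 1) * ℓ) =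
      Real.exp (ℓ ^ 2 - (B + 1) * ℓ) * ℓ ^ 3 := by
    rw [mul_div_right_comm, hx, ← Real.exp_mul, ← Real.exp_sub, hδ]; congr 2; field_simp; ring
  rw [e1, e2] at hInt
  have hP := perron_sum (a := a) (σ := 1 + δ) (x := x)
    (norm_le_zero_iff.1 (by simpa using hT.norm_le 0)) (by linarith) hx0
    (lseriesSummable_of_norm_le_vonMangoldt hT.norm_le (by simpa using hδ0))
  have hpole := perron_kernel_pole (σ := 1 + δ) (y := x⁻¹) (by linarith) (by positivity)
  simp only [inv_cpow_neg_of_pos hx0] at hpole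
  have hI : ∀ g : ℂ → ℂ, (∀ s : ℂ, s.re = 1 + δ → ContinuousAt g s) →
      (∃ M, ∀ s : ℂ, s.re = 1 + δ → ‖g s‖ ≤ M) →
      Integrable fun t : ℝ => (x : ℂ) ^ (((1 + δ : ℝ) : ℂ) + t * Complex.I) *
        (((((1 + δ : ℝ) : ℂ) + t * Complex.I) * (((1 + δ : ℝ) : ℂ) + t * Complex.I + 1))⁻¹ *
          g (((1 + δ : ℝ) : ℂ) + t * Complex.I)) := by
    rintro g hg ⟨M, hM⟩
    have hx0' : (x : ℂ) ≠ 0 := by exact_mod_cast hx0.ne'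
    have := integrable_vertical (g := fun s => (x : ℂ) ^ s * g s) (σ := 1 + δ)
      (M := x ^ (1 + δ) * M) (fun s hs => ContinuousAt.mul
        (ContinuousAt.const_cpow continuousAt_id (Or.inl hx0')) (hg s hs)) (by linarith)
      fun s hs => by
        rw [norm_mul, Complex.norm_cpow_eq_rpow_re_of_pos hx0, hs]
        gcongr
        exact hM s hs
    exact this.congr (Eventually.of_forall fun t => mul_left_comm _ _ _)
  have hI1 := hI (fun s => (s - 1)⁻¹) (fun s hs => by
      refine ContinuousAt.inv₀ (by fun_prop) (sub_ne_zero.2 ?_)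
      rintro rfl
      simp at hs
      linarith) ⟨δ⁻¹, fun s hs => by
      rw [norm_inv]
      have := Complex.re_le_norm (s - 1)
      rw [Complex.sub_re, hs, Complex.one_re] at this
      exact inv_anti₀ hδ0 (by linarith)⟩
  have hI2 := hI _ hcont ⟨_, hlf⟩
  have hmax : max (1 - x⁻¹) 0 ^ 2 / (2 * x⁻¹) = (x - 1) ^ 2 / (2 * x) := by
    rw [max_eq_left (sub_nonneg.2 (inv_le_one_of_one_le₀ hx1))]
    field_simp
  rw [hmax] at hpole
  have hcomb : (2 * Real.pi * ∑ n ∈ Finset.range (⌊x⌋₊ + 1), a n * (1 - n / (x : ℂ)) : ℂ) =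
      c * (2 * Real.pi * (((x - 1) ^ 2 / (2 * x) : ℝ) : ℂ)) -
      ∫ t : ℝ, (x : ℂ) ^ (((1 + δ : ℝ) : ℂ) + t * Complex.I) *
        (((((1 + δ : ℝ) : ℂ) + t * Complex.I) * (((1 + δ : ℝ) : ℂ) + t * Complex.I + 1))⁻¹ *
          (deriv f (((1 + δ : ℝ) : ℂ) + t * Complex.I) /
            f (((1 + δ : ℝ) : ℂ) + t * Complex.I))) := by
    rw [← hP, ← hpole, ← integral_const_mul, ← integral_sub (hI1.const_mul _) hI2]
    refine integral_congr_ae (Eventually.of_forall fun t => ?_)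
    simp only
    rw [hL _ (by simpa using hδ0)]
    ring
  set J := ∫ t : ℝ, (x : ℂ) ^ (((1 + δ : ℝ) : ℂ) + t * Complex.I) *
        (((((1 + δ : ℝ) : ℂ) + t * Complex.I) * (((1 + δ : ℝ) : ℂ) + t * Complex.I + 1))⁻¹ *
          (deriv f (((1 + δ : ℝ) : ℂ) + t * Complex.I) /
            f (((1 + δ : ℝ) : ℂ) + t * Complex.I))) with hJ
  have hpi : (2 * Real.pi : ℂ) ≠ 0 := by exact_mod_cast Real.two_pi_pos.ne'
  have hfin : ∑ n ∈ Finset.range (⌊x⌋₊ + 1), a n * (1 - n / (x : ℂ)) -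
      ((c * ((x - 1) ^ 2 / (2 * x)) : ℝ) : ℂ) = -(J / (2 * Real.pi)) := by
    rw [Complex.ofReal_mul]
    generalize (((x - 1) ^ 2 / (2 * x) : ℝ) : ℂ) = P at hcomb ⊢
    field_simp
    linear_combination hcomb
  rw [hfin, norm_neg, norm_div]
  have hpin : ‖(2 * Real.pi : ℂ)‖ = 2 * Real.pi := by
    rw [← Complex.ofReal_ofNat, ← Complex.ofReal_mul, Complex.norm_real,
      Real.norm_of_nonneg Real.two_pi_pos.le]
  rw [hpin, div_le_iff₀ Real.two_pi_pos]
  set E := Real.exp (ℓ ^ 2 - (B + 1) * ℓ) with hE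
  have hE0 : 0 < E := Real.exp_pos _
  have hEe : Real.exp (ℓ ^ 2 - B * ℓ) = E * Real.exp ℓ := by
    rw [hE, ← Real.exp_add]; congr 1; ring
  rw [hEe]
  have hq : 0 < E * ℓ ^ 3 := by positivity
  calc ‖J‖ ≤ 4 * Real.pi * (E * ℓ ^ 3) + 16 * (E * ℓ ^ 3) := hInt
    _ ≤ 64 * (E * ℓ ^ 3) * 1 := by nlinarith [Real.pi_lt_four]
    _ = E * (64 * ℓ ^ 3) * 1 := by ring
    _ ≤ E * Real.exp ℓ * (2 * Real.pi) := by gcongr; linarith [Real.pi_gt_three]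

end SiegelWalfisz

namespace SiegelWalfisz

open scoped Topology
open ArithmeticFunction Filter

lemma norm_riesz_sum_sub_le {a : ℕ → ℂ} (ha : ∀ n, ‖a n‖ ≤ vonMangoldt n) {x h : ℝ} (hx : 1 ≤ x)
    (hh : 0 ≤ h) :
    ‖∑ n ∈ Finset.range (⌊x + h⌋₊ + 1), a n * ((x + h : ℝ) - n) -
      ∑ n ∈ Finset.range (⌊x⌋₊ + 1), a n * (x - n) -
        h * ∑ n ∈ Finset.range (⌊x⌋₊ + 1), a n‖ ≤ (h + 1) * (h * Real.log (x + h)) := by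
  have hfl : ⌊x⌋₊ + 1 ≤ ⌊x + h⌋₊ + 1 := by gcongr; linarith
  rw [← Finset.sum_range_add_sum_Ico _ hfl]
  have e1 : ∑ n ∈ Finset.range (⌊x⌋₊ + 1), a n * ((x + h : ℝ) - n) -
      ∑ n ∈ Finset.range (⌊x⌋₊ + 1), a n * (x - n) -
        h * ∑ n ∈ Finset.range (⌊x⌋₊ + 1), a n = 0 := by
    rw [Finset.mul_sum, ← Finset.sum_sub_distrib, ← Finset.sum_sub_distrib]
    refine Finset.sum_eq_zero fun n _ => ?_
    push_cast
    ring
  set P := ∑ n ∈ Finset.Ico (⌊x⌋₊ + 1) (⌊x + h⌋₊ + 1), a n * (((x + h : ℝ) : ℂ) - n) with hP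
  have e2 : ∀ u v w : ℂ, u - v - w = 0 → u + P - v - w = P := fun u v w h => by
    linear_combination h
  rw [e2 _ _ _ e1]
  have hlog : 0 ≤ Real.log (x + h) := Real.log_nonneg (by linarith)
  refine (norm_sum_le_of_le (f := fun n => a n * (((x + h : ℝ) : ℂ) - n))
    (n := fun _ => h * Real.log (x + h)) _ fun n hn => ?_).trans ?_
  · rw [Finset.mem_Ico, Nat.add_one_le_iff, Nat.lt_add_one_iff, Nat.floor_lt (by linarith)] at hn
    have hn2 : (n : ℝ) ≤ x + h := (Nat.le_floor_iff (by linarith)).1 hn.2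
    have hn0 : (0 : ℝ) < n := by linarith [hn.1]
    have e3 : ‖((x + h : ℝ) : ℂ) - n‖ ≤ h := by
      rw [← Complex.ofReal_natCast, ← Complex.ofReal_sub, Complex.norm_real,
        Real.norm_of_nonneg (by linarith)]
      linarith [hn.1]
    rw [norm_mul, mul_comm h]
    gcongr
    exact (ha n).trans (vonMangoldt_le_log.trans (Real.log_le_log hn0 hn2))
  · rw [Finset.sum_const, Nat.card_Ico, nsmul_eq_mul, Nat.cast_sub hfl]
    gcongr
    push_cast
    linarith [Nat.floor_le (show 0 ≤ x + h by linarith), Nat.lt_floor_add_one x]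

/-- The prime number theorem for `Λ` and for its twists by nontrivial characters. -/
lemma sum_twist_le {m B : ℝ} (hm : 0 < m) (hB : 0 < B) : ∀ᶠ ℓ : ℝ in atTop, ∀ a c,
    Twist ℓ m a c →
      ‖∑ n ∈ Finset.range (⌊Real.exp (ℓ ^ 2)⌋₊ + 1), a n - ((c * Real.exp (ℓ ^ 2) : ℝ) : ℂ)‖ ≤
        Real.exp (ℓ ^ 2 - B * ℓ) := by
  obtain ⟨ℓ₀, hℓ₀⟩ := eventually_atTop.1
    (smooth_sum_le (m := m) (B := 2 * B + 4) hm (by positivity))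
  filter_upwards [eventually_ge_atTop ℓ₀, eventually_ge_atTop (B + 2), eventually_ge_atTop 4] with
    ℓ h0 hBℓ h4 a c hT
  have hℓ : 0 < ℓ := by linarith
  set x := Real.exp (ℓ ^ 2) with hx
  have hx0 : 0 < x := Real.exp_pos _
  have hx1 : 1 ≤ x := Real.one_le_exp (by positivity)
  have key : ∀ y, x ≤ y → ‖∑ n ∈ Finset.range (⌊y⌋₊ + 1), a n * (y - n) -
      ((c * ((y - 1) ^ 2 / 2) : ℝ) : ℂ)‖ ≤ y ^ 2 * Real.exp (-(2 * B + 4) * ℓ) := by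
    intro y hy
    have hy0 : 0 < y := by linarith
    have hyl : ℓ ^ 2 ≤ Real.log y := by rwa [Real.le_log_iff_exp_le hy0]
    have hℓ' : ℓ ≤ √(Real.log y) := Real.le_sqrt_of_sq_le hyl
    have h1 := hℓ₀ (√(Real.log y)) (h0.trans hℓ') a c (hT.mono hℓ.le hℓ' hm.le)
    rw [Real.sq_sqrt ((sq_nonneg ℓ).trans hyl), Real.exp_log hy0] at h1
    have hy0' : (y : ℂ) ≠ 0 := by exact_mod_cast hy0.ne'
    have e1 : ∑ n ∈ Finset.range (⌊y⌋₊ + 1), a n * (y - n) - ((c * ((y - 1) ^ 2 / 2) : ℝ) : ℂ) =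
        y * (∑ n ∈ Finset.range (⌊y⌋₊ + 1), a n * (1 - n / y) -
          ((c * ((y - 1) ^ 2 / (2 * y)) : ℝ) : ℂ)) := by
      rw [mul_sub, Finset.mul_sum]
      congr 1
      · refine Finset.sum_congr rfl fun n _ => ?_
        field_simp
      · push_cast
        field_simp
    rw [e1, norm_mul, Complex.norm_real, Real.norm_of_nonneg hy0.le]
    calc _ ≤ y * Real.exp (Real.log y - (2 * B + 4) * √(Real.log y)) := by gcongr
      _ = y ^ 2 * Real.exp (-(2 * B + 4) * √(Real.log y)) := by
          rw [sub_eq_add_neg, Real.exp_add, Real.exp_log hy0, neg_mul]; ring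
      _ ≤ _ := by
          gcongr y ^ 2 * Real.exp ?_
          nlinarith
  set h := Real.exp (ℓ ^ 2 - (B + 2) * ℓ) with hh
  have hh0 : 0 < h := Real.exp_pos _
  have hh1 : 1 ≤ h := Real.one_le_exp (by nlinarith)
  have hhx : h ≤ x := Real.exp_le_exp.2 (by nlinarith)
  have hh2 : x ^ 2 * Real.exp (-(2 * B + 4) * ℓ) = h ^ 2 := by
    rw [hx, hh, ← Real.exp_nat_mul, ← Real.exp_nat_mul, ← Real.exp_add]
    congr 1
    push_cast
    ring
  have k1 := key x le_rfl
  have k2 := key (x + h) (by linarith)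
  have k3 := norm_riesz_sum_sub_le hT.norm_le hx1 hh0.le
  rw [hh2] at k1
  have k2' : (x + h) ^ 2 * Real.exp (-(2 * B + 4) * ℓ) ≤ 4 * h ^ 2 := by
    calc _ ≤ (x + x) ^ 2 * Real.exp (-(2 * B + 4) * ℓ) := by gcongr
      _ = 4 * h ^ 2 := by rw [← hh2]; ring
  have hlog : Real.log (x + h) ≤ ℓ ^ 2 + 1 := by
    calc _ ≤ Real.log (2 * x) := Real.log_le_log (by positivity) (by linarith)
      _ = Real.log 2 + ℓ ^ 2 := by rw [Real.log_mul two_ne_zero hx0.ne', hx, Real.log_exp]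
      _ ≤ _ := by linarith [Real.log_two_lt_d9]
  set S₁ := ∑ n ∈ Finset.range (⌊x⌋₊ + 1), a n * ((x : ℂ) - n) with hS₁
  set S₂ := ∑ n ∈ Finset.range (⌊x + h⌋₊ + 1), a n * (((x + h : ℝ) : ℂ) - n) with hS₂
  set Ψ := ∑ n ∈ Finset.range (⌊x⌋₊ + 1), a n with hΨ
  have hid : (h : ℂ) * (Ψ - ((c * x : ℝ) : ℂ)) = -(S₂ - S₁ - h * Ψ) +
      (S₂ - ((c * ((x + h - 1) ^ 2 / 2) : ℝ) : ℂ)) - (S₁ - ((c * ((x - 1) ^ 2 / 2) : ℝ) : ℂ)) +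
      ((c * (h ^ 2 / 2 - h) : ℝ) : ℂ) := by
    push_cast
    ring
  have hlast : ‖((c * (h ^ 2 / 2 - h) : ℝ) : ℂ)‖ ≤ h ^ 2 := by
    rw [Complex.norm_real, norm_mul, Real.norm_of_nonneg hT.mean_mem.1]
    refine (mul_le_of_le_one_left (norm_nonneg _) hT.mean_mem.2).trans ?_
    rw [Real.norm_eq_abs, abs_le]
    constructor <;> nlinarith
  have hfin : h * ‖Ψ - ((c * x : ℝ) : ℂ)‖ ≤ h * (h * (2 * ℓ ^ 2 + 9)) := by
    calc _ = ‖(h : ℂ) * (Ψ - ((c * x : ℝ) : ℂ))‖ := by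
          rw [norm_mul, Complex.norm_real, Real.norm_of_nonneg hh0.le]
      _ ≤ ‖S₂ - S₁ - h * Ψ‖ + ‖S₂ - ((c * ((x + h - 1) ^ 2 / 2) : ℝ) : ℂ)‖ +
          ‖S₁ - ((c * ((x - 1) ^ 2 / 2) : ℝ) : ℂ)‖ + ‖((c * (h ^ 2 / 2 - h) : ℝ) : ℂ)‖ := by
          rw [hid]
          refine (norm_add_le _ _).trans ?_
          gcongr
          refine (norm_sub_le _ _).trans ?_
          gcongr
          refine (norm_add_le _ _).trans ?_
          rw [norm_neg]
      _ ≤ (h + h) * (h * (ℓ ^ 2 + 1)) + 4 * h ^ 2 + h ^ 2 + h ^ 2 := by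
          refine add_le_add (add_le_add (add_le_add (k3.trans ?_) (k2.trans k2')) k1) hlast
          have : 0 ≤ h * Real.log (x + h) :=
            mul_nonneg hh0.le (Real.log_nonneg (by linarith))
          gcongr
      _ ≤ h * (h * (2 * ℓ ^ 2 + 9)) := by nlinarith
  have hfin' := le_of_mul_le_mul_left hfin hh0
  refine hfin'.trans ?_
  have hexp : 2 * ℓ ^ 2 + 9 ≤ Real.exp (2 * ℓ) := by
    have := Real.quadratic_le_exp_of_nonneg (show 0 ≤ 2 * ℓ by positivity)
    nlinarith
  calc _ ≤ h * Real.exp (2 * ℓ) := by gcongr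
    _ = _ := by rw [hh, ← Real.exp_add]; congr 1; ring

end SiegelWalfisz

namespace SiegelWalfisz

open ArithmeticFunction

lemma sum_nthRootsFinset_one {n : ℕ} (hn : n ≠ 0) :
    ∑ x ∈ Polynomial.nthRootsFinset n (1 : ℂ), x = if n = 1 then 1 else 0 := by
  split_ifs with h
  · have h1 : Polynomial.nthRootsFinset 1 (1 : ℂ) = {1} := by
      ext x
      simp [Polynomial.mem_nthRootsFinset one_pos]
    rw [h, h1, Finset.sum_singleton]
  have hpos := Nat.pos_of_ne_zero hn
  have hζ := Complex.isPrimitiveRoot_exp n hn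
  set ζ := Complex.exp (2 * Real.pi * Complex.I / n)
  have hζ0 : ζ ≠ 0 := hζ.ne_zero hn
  have h1 : ∑ x ∈ Polynomial.nthRootsFinset n (1 : ℂ), x =
      ∑ x ∈ Polynomial.nthRootsFinset n (1 : ℂ), ζ * x := by
    refine Finset.sum_nbij' (fun x => ζ⁻¹ * x) (fun x => ζ * x) ?_ ?_ ?_ ?_ ?_
    · intro x hx
      rw [Polynomial.mem_nthRootsFinset hpos] at hx ⊢
      rw [mul_pow, hx, inv_pow, hζ.pow_eq_one, inv_one, one_mul]
    · intro x hx
      rw [Polynomial.mem_nthRootsFinset hpos] at hx ⊢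
      rw [mul_pow, hx, hζ.pow_eq_one, one_mul]
    · intro x _
      rw [mul_inv_cancel_left₀ hζ0]
    · intro x _
      rw [inv_mul_cancel_left₀ hζ0]
    · intro x _
      rw [mul_inv_cancel_left₀ hζ0]
  rw [← Finset.mul_sum] at h1
  by_contra hS
  exact hζ.ne_one (by omega) (mul_right_cancel₀ hS (by rw [one_mul]; exact h1.symm))

lemma sum_primitiveRoots {n : ℕ} (hn : n ≠ 0) : ∑ x ∈ primitiveRoots n ℂ, x = moebius n := by
  have h := (sum_eq_iff_sum_mul_moebius_eq (f := fun n => ∑ x ∈ primitiveRoots n ℂ, x)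
    (g := fun n => if n = 1 then (1 : ℂ) else 0)).1 (fun n hn => by
      rw [← sum_nthRootsFinset_one hn.ne', IsPrimitiveRoot.nthRoots_one_eq_biUnion_primitiveRoots,
        Finset.sum_biUnion]
      exact fun i _ j _ hij => IsPrimitiveRoot.disjoint hij) n (Nat.pos_of_ne_zero hn)
  rw [← h, Finset.sum_eq_single (n, 1)]
  · simp
  · rintro ⟨i, j⟩ hij hne
    rw [Nat.mem_divisorsAntidiagonal] at hij
    have hj : j ≠ 1 := by
      rintro rfl
      exact hne (by simpa using hij.1)
    simp [hj]
  · intro h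
    simp [hn] at h

lemma stdAddChar_natCast {q : ℕ} [NeZero q] (j : ℕ) :
    ZMod.stdAddChar (j : ZMod q) = Complex.exp (2 * Real.pi * Complex.I * (j / q)) := by
  have := ZMod.stdAddChar_coe (N := q) (j : ℤ)
  rw [Int.cast_natCast] at this
  rw [this]
  congr 1
  push_cast
  ring

/-- The Ramanujan sum at a unit is the Möbius function. -/
lemma sum_units_stdAddChar {q : ℕ} [NeZero q] {a : ZMod q} (ha : IsUnit a) :
    ∑ r : (ZMod q)ˣ, ZMod.stdAddChar (a * (r : ZMod q)) = (moebius q : ℂ) := by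
  obtain ⟨b, rfl⟩ := ha
  have h1 : ∑ r : (ZMod q)ˣ, ZMod.stdAddChar ((b : ZMod q) * (r : ZMod q)) =
      ∑ r : (ZMod q)ˣ, ZMod.stdAddChar (r : ZMod q) :=
    Fintype.sum_equiv (Equiv.mulLeft b) _ _ fun r => by simp
  rw [h1, ← sum_primitiveRoots (NeZero.ne q)]
  refine Finset.sum_nbij (fun r => ZMod.stdAddChar (r : ZMod q)) ?_ ?_ ?_ fun _ _ => rfl
  · intro r _
    rw [mem_primitiveRoots (NeZero.pos q), ← ZMod.natCast_zmod_val (r : ZMod q),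
      stdAddChar_natCast]
    exact Complex.isPrimitiveRoot_exp_of_coprime _ _ (NeZero.ne q) (ZMod.val_coe_unit_coprime r)
  · intro r _ r' _ h
    exact Units.ext (ZMod.injective_stdAddChar h)
  · intro ξ hξ
    obtain ⟨i, -, hi, rfl⟩ := (Complex.isPrimitiveRoot_iff ξ q (NeZero.ne q)).1
      (isPrimitiveRoot_of_mem_primitiveRoots hξ)
    exact ⟨ZMod.unitOfCoprime i hi, by simp, by
      simp only [ZMod.coe_unitOfCoprime]
      exact stdAddChar_natCast i⟩

/-- The coefficient of `χ` in the expansion of `k ↦ e(ak/q)` on the units, up to a factor `φ(q)`. -/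
noncomputable def charCoeff {q : ℕ} [NeZero q] (a : ZMod q) (χ : DirichletCharacter ℂ q) : ℂ :=
  ∑ r : (ZMod q)ˣ, χ (r : ZMod q)⁻¹ * ZMod.stdAddChar (a * (r : ZMod q))

lemma sum_charCoeff_mul {q : ℕ} [NeZero q] (a : ZMod q) {k : ZMod q} (hk : IsUnit k) :
    ∑ χ : DirichletCharacter ℂ q, charCoeff a χ * χ k =
      Nat.totient q * ZMod.stdAddChar (a * k) := by
  obtain ⟨u, rfl⟩ := hk
  simp_rw [charCoeff, Finset.sum_mul]
  rw [Finset.sum_comm]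
  have h : ∀ r : (ZMod q)ˣ, ∑ χ : DirichletCharacter ℂ q,
      χ (r : ZMod q)⁻¹ * ZMod.stdAddChar (a * (r : ZMod q)) * χ u =
        if r = u then Nat.totient q * ZMod.stdAddChar (a * (r : ZMod q)) else 0 := by
    intro r
    have h2 := DirichletCharacter.sum_char_inv_mul_char_eq ℂ r.isUnit (u : ZMod q)
    calc _ = (∑ χ : DirichletCharacter ℂ q, χ (r : ZMod q)⁻¹ * χ u) *
          ZMod.stdAddChar (a * (r : ZMod q)) := by
          rw [Finset.sum_mul]
          exact Finset.sum_congr rfl fun χ _ => by ring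
      _ = _ := by
          rw [h2]
          simp only [Units.ext_iff, ite_mul, zero_mul]
  simp_rw [h]
  simp

lemma norm_charCoeff_le {q : ℕ} [NeZero q] (a : ZMod q) (χ : DirichletCharacter ℂ q) :
    ‖charCoeff a χ‖ ≤ Nat.totient q := by
  refine (norm_sum_le_of_le (n := fun _ : (ZMod q)ˣ => (1 : ℝ)) _ fun r _ => ?_).trans ?_
  · rw [norm_mul, ZMod.stdAddChar_apply, Circle.norm_coe, mul_one]
    exact χ.norm_le_one _
  · simp [ZMod.card_units_eq_totient]

lemma charCoeff_one {q : ℕ} [NeZero q] {a : ZMod q} (ha : IsUnit a) :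
    charCoeff a 1 = (moebius q : ℂ) := by
  rw [charCoeff, ← sum_units_stdAddChar ha]
  refine Finset.sum_congr rfl fun r _ => ?_
  rw [ZMod.inv_coe_unit, MulChar.one_apply_coe, one_mul]

end SiegelWalfisz

namespace SiegelWalfisz

open scoped Topology
open ArithmeticFunction Filter

lemma norm_sum_sub_sum_prime_le {a : ℕ → ℂ} (ha : ∀ n, ‖a n‖ ≤ vonMangoldt n) {x : ℝ} (hx : 1 ≤ x) :
    ‖∑ n ∈ Finset.range (⌊x⌋₊ + 1), a n -
      ∑ n ∈ Finset.range (⌊x⌋₊ + 1), (if n.Prime then a n else 0)‖ ≤ 2 * √x * Real.log x := by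
  refine le_trans ?_ (Chebyshev.psi_sub_theta_le hx)
  rw [Chebyshev.psi_eq_sum_Icc, Chebyshev.theta_eq_sum_Icc, Finset.sum_filter,
    ← Finset.sum_sub_distrib, ← Finset.sum_sub_distrib, ← Nat.range_succ_eq_Icc_zero]
  refine norm_sum_le_of_le _ fun n _ => ?_
  split_ifs with h
  · simp [vonMangoldt_apply_prime h]
  · simpa using ha n

lemma sum_prime_twist_le {m B : ℝ} (hm : 0 < m) (hB : 0 < B) : ∀ᶠ ℓ : ℝ in atTop, ∀ a c,
    Twist ℓ m a c →
      ‖∑ n ∈ Finset.range (⌊Real.exp (ℓ ^ 2)⌋₊ + 1), (if n.Prime then a n else 0) -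
        ((c * Real.exp (ℓ ^ 2) : ℝ) : ℂ)‖ ≤ Real.exp (ℓ ^ 2 - B * ℓ) := by
  filter_upwards [sum_twist_le (m := m) (B := B + 2) hm (by positivity), eventually_ge_atTop 4,
    eventually_ge_atTop (2 * (B + 2))] with ℓ h h4 hBℓ a c hT
  have hx1 : 1 ≤ Real.exp (ℓ ^ 2) := Real.one_le_exp (by positivity)
  have h1 := norm_sum_sub_sum_prime_le hT.norm_le hx1
  have h2 := h a c hT
  have h3 : √(Real.exp (ℓ ^ 2)) ≤ Real.exp (ℓ ^ 2 - (B + 2) * ℓ) := by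
    rw [← Real.exp_half]
    refine Real.exp_le_exp.2 ?_
    nlinarith
  rw [Real.log_exp] at h1
  have hexp : 2 * ℓ ^ 2 + 1 ≤ Real.exp (2 * ℓ) := by
    have := Real.quadratic_le_exp_of_nonneg (show 0 ≤ 2 * ℓ by positivity)
    nlinarith
  set S₁ := ∑ n ∈ Finset.range (⌊Real.exp (ℓ ^ 2)⌋₊ + 1), a n
  set S₂ := ∑ n ∈ Finset.range (⌊Real.exp (ℓ ^ 2)⌋₊ + 1), (if n.Prime then a n else 0)
  set E := Real.exp (ℓ ^ 2 - (B + 2) * ℓ) with hE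
  have hE0 : 0 < E := Real.exp_pos _
  calc ‖S₂ - ((c * Real.exp (ℓ ^ 2) : ℝ) : ℂ)‖
      = ‖(S₁ - ((c * Real.exp (ℓ ^ 2) : ℝ) : ℂ)) - (S₁ - S₂)‖ := by congr 1; ring
    _ ≤ E + 2 * √(Real.exp (ℓ ^ 2)) * ℓ ^ 2 := (norm_sub_le _ _).trans (add_le_add h2 h1)
    _ ≤ E + 2 * E * ℓ ^ 2 := by gcongr
    _ = E * (2 * ℓ ^ 2 + 1) := by ring
    _ ≤ E * Real.exp (2 * ℓ) := by gcongr
    _ = _ := by rw [hE, ← Real.exp_add]; congr 1; ring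

lemma sum_prime_not_isUnit_le {q : ℕ} (hq : q ≠ 0) (M : ℕ) :
    ∑ k ∈ Finset.range M, (if k.Prime ∧ ¬ IsUnit (k : ZMod q) then Real.log k else 0) ≤
      Real.log q := by
  rw [← vonMangoldt_sum, ← Finset.sum_filter]
  calc _ = ∑ k ∈ (Finset.range M).filter fun k : ℕ => k.Prime ∧ ¬ IsUnit (k : ZMod q),
        vonMangoldt k := by
        refine Finset.sum_congr rfl fun k hk => ?_
        rw [vonMangoldt_apply_prime (Finset.mem_filter.1 hk).2.1]
    _ ≤ _ := by
        refine Finset.sum_le_sum_of_subset_of_nonneg (fun k hk => ?_) fun _ _ _ =>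
          vonMangoldt_nonneg
        obtain ⟨hp, hu⟩ := (Finset.mem_filter.1 hk).2
        rw [ZMod.isUnit_iff_coprime, hp.coprime_iff_not_dvd, not_not] at hu
        exact Nat.mem_divisors.2 ⟨hu, hq⟩

lemma norm_stdAddChar {q : ℕ} [NeZero q] (k : ZMod q) : ‖ZMod.stdAddChar k‖ = 1 := by
  rw [ZMod.stdAddChar_apply, Circle.norm_coe]

lemma norm_sum_prime_char_sub_le {ℓ m B : ℝ} (h : ∀ a c, Twist ℓ m a c →
      ‖∑ n ∈ Finset.range (⌊Real.exp (ℓ ^ 2)⌋₊ + 1), (if n.Prime then a n else 0) -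
        ((c * Real.exp (ℓ ^ 2) : ℝ) : ℂ)‖ ≤ Real.exp (ℓ ^ 2 - B * ℓ)) {q : ℕ} [NeZero q]
    (hq : (q : ℝ) ≤ ℓ ^ m) (χ : DirichletCharacter ℂ q) :
    ‖∑ k ∈ Finset.range (⌊Real.exp (ℓ ^ 2)⌋₊ + 1), (if k.Prime then (Real.log k : ℂ) else 0) * χ k -
      (if χ = 1 then (Real.exp (ℓ ^ 2) : ℂ) else 0)‖ ≤
      Real.exp (ℓ ^ 2 - B * ℓ) + Real.log q := by
  have hq1 : (1 : ℝ) ≤ q := by exact_mod_cast NeZero.one_le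
  split_ifs with hχ
  · have h1 := h _ 1 (Or.inl ⟨rfl, rfl⟩)
    rw [one_mul] at h1
    set M := ⌊Real.exp (ℓ ^ 2)⌋₊ + 1
    have h2 : ‖∑ k ∈ Finset.range M, (if k.Prime then (Real.log k : ℂ) else 0) * χ k -
        ∑ n ∈ Finset.range M, (if n.Prime then (vonMangoldt n : ℂ) else 0)‖ ≤ Real.log q := by
      rw [← Finset.sum_sub_distrib]
      refine (norm_sum_le_of_le _ fun k _ => ?_).trans (sum_prime_not_isUnit_le (NeZero.ne q) M)
      by_cases hp : k.Prime
      · by_cases hu : IsUnit (k : ZMod q)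
        · simp [hp, hu, hχ, vonMangoldt_apply_prime hp, MulChar.one_apply hu]
        · simp only [hp, if_true, MulChar.map_nonunit χ hu, mul_zero, zero_sub, norm_neg, hu,
            not_false_eq_true, and_self, vonMangoldt_apply_prime hp, Complex.norm_real]
          rw [Real.norm_of_nonneg (Real.log_natCast_nonneg k)]
      · simp [hp]
    have h3 := norm_add_le _ _ |>.trans (add_le_add h1 h2)
    refine le_trans (le_of_eq ?_) h3
    congr 1
    ring
  · have h1 := h _ 0 (Or.inr ⟨q, inferInstance, χ, hχ, hq, rfl, rfl⟩)
    have h2 : ∑ k ∈ Finset.range (⌊Real.exp (ℓ ^ 2)⌋₊ + 1),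
        (if k.Prime then (Real.log k : ℂ) else 0) * χ k =
        ∑ n ∈ Finset.range (⌊Real.exp (ℓ ^ 2)⌋₊ + 1),
          (if n.Prime then χ n * (vonMangoldt n : ℂ) else 0) := by
      refine Finset.sum_congr rfl fun k _ => ?_
      split_ifs with hp
      · rw [vonMangoldt_apply_prime hp, mul_comm]
      · rw [zero_mul]
    rw [h2]
    simp only [zero_mul, Complex.ofReal_zero] at h1
    exact h1.trans (le_add_of_nonneg_right (Real.log_nonneg hq1))

/-- Siegel-Walfisz in exponential-sum form at the rational points `a / q`. -/
lemma sum_prime_stdAddChar_le {m B : ℝ} (hm : 0 < m) (hB : 0 < B) : ∀ᶠ ℓ : ℝ in atTop,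
    ∀ (q : ℕ) [NeZero q], (q : ℝ) ≤ ℓ ^ m → ∀ a : ZMod q, IsUnit a →
      ‖∑ k ∈ Finset.range (⌊Real.exp (ℓ ^ 2)⌋₊ + 1),
          (if k.Prime then (Real.log k : ℂ) else 0) * ZMod.stdAddChar (a * (k : ZMod q)) -
        (moebius q : ℂ) / Nat.totient q * (Real.exp (ℓ ^ 2) : ℂ)‖ ≤
          Real.exp (ℓ ^ 2 - B * ℓ) := by
  have hpow : ∀ᶠ ℓ : ℝ in atTop, ℓ ^ m ≤ Real.exp ℓ := by
    filter_upwards [(isLittleO_rpow_exp_atTop m).bound one_pos, eventually_ge_atTop 0] with ℓ h h0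
    rwa [Real.norm_of_nonneg (by positivity), Real.norm_of_nonneg (by positivity), one_mul] at h
  filter_upwards [sum_prime_twist_le (m := m) (B := B + 3) hm (by positivity), hpow,
    eventually_ge_atTop 1, eventually_ge_atTop (B + 4)] with ℓ h hpw h1 hBℓ q _ hq a ha
  set x := Real.exp (ℓ ^ 2) with hx
  set M := ⌊x⌋₊ + 1 with hM
  set E := Real.exp (ℓ ^ 2 - (B + 3) * ℓ) with hE
  have hE0 : 0 < E := Real.exp_pos _
  have hφ0 : (0 : ℝ) < Nat.totient q := by exact_mod_cast Nat.totient_pos.2 (NeZero.pos q)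
  have hφ0' : (Nat.totient q : ℂ) ≠ 0 := by exact_mod_cast hφ0.ne'
  have hφq : (Nat.totient q : ℝ) ≤ q := by exact_mod_cast Nat.totient_le q
  have hq0 : (0 : ℝ) < q := by exact_mod_cast NeZero.pos q
  have hqe : (q : ℝ) ≤ Real.exp ℓ := hq.trans hpw
  have heE : Real.exp ℓ ≤ E := Real.exp_le_exp.2 (by nlinarith)
  have hlogq : Real.log q ≤ E := (Real.log_le_self hq0.le).trans (hqe.trans heE)
  set S : DirichletCharacter ℂ q → ℂ := fun χ =>
    ∑ k ∈ Finset.range M, (if k.Prime then (Real.log k : ℂ) else 0) * χ k with hS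
  have hSχ := fun χ => norm_sum_prime_char_sub_le h hq χ
  set T := ∑ k ∈ Finset.range M,
    (if k.Prime then (Real.log k : ℂ) else 0) * ZMod.stdAddChar (a * (k : ZMod q)) with hT
  have hfirst : ‖T - (Nat.totient q : ℂ)⁻¹ * ∑ χ, charCoeff a χ * S χ‖ ≤ Real.log q := by
    have e1 : (Nat.totient q : ℂ)⁻¹ * ∑ χ, charCoeff a χ * S χ =
        ∑ k ∈ Finset.range M, (if k.Prime then (Real.log k : ℂ) else 0) *
          ((Nat.totient q : ℂ)⁻¹ * ∑ χ, charCoeff a χ * χ k) := by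
      simp_rw [hS, Finset.mul_sum]
      rw [Finset.sum_comm]
      refine Finset.sum_congr rfl fun k _ => Finset.sum_congr rfl fun χ _ => by ring
    rw [e1, hT, ← Finset.sum_sub_distrib]
    refine (norm_sum_le_of_le _ fun k _ => ?_).trans (sum_prime_not_isUnit_le (NeZero.ne q) M)
    by_cases hp : k.Prime
    · by_cases hu : IsUnit (k : ZMod q)
      · rw [sum_charCoeff_mul a hu, inv_mul_cancel_left₀ hφ0']
        simp [hu]
      · simp only [hp, if_true, MulChar.map_nonunit _ hu, mul_zero, Finset.sum_const_zero, sub_zero,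
          hu, not_false_eq_true, and_self, norm_mul, Complex.norm_real, norm_stdAddChar, mul_one]
        rw [Real.norm_of_nonneg (Real.log_natCast_nonneg k)]
    · simp [hp]
  have hsecond : ‖(Nat.totient q : ℂ)⁻¹ * ∑ χ, charCoeff a χ * S χ -
      (moebius q : ℂ) / Nat.totient q * (x : ℂ)‖ ≤ q * (E + Real.log q) := by
    have e1 : (Nat.totient q : ℂ)⁻¹ * ∑ χ, charCoeff a χ * S χ -
        (moebius q : ℂ) / Nat.totient q * (x : ℂ) = (Nat.totient q : ℂ)⁻¹ *
          ∑ χ, charCoeff a χ * (S χ - if χ = 1 then (x : ℂ) else 0) := by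
      simp_rw [mul_sub, Finset.sum_sub_distrib, mul_ite, mul_zero]
      rw [Finset.sum_ite_eq' Finset.univ (1 : DirichletCharacter ℂ q)]
      simp only [Finset.mem_univ, if_true, charCoeff_one ha]
      ring
    rw [e1, norm_mul, norm_inv, Complex.norm_natCast, inv_mul_le_iff₀ hφ0]
    refine (norm_sum_le_of_le (n := fun _ => (Nat.totient q : ℝ) * (E + Real.log q)) _
      fun χ _ => ?_).trans ?_
    · rw [norm_mul]
      gcongr
      · exact norm_charCoeff_le a χ
      · exact hSχ χ
    · rw [Finset.sum_const, Finset.card_univ, ← Nat.card_eq_fintype_card,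
        DirichletCharacter.card_eq_totient_of_hasEnoughRootsOfUnity, nsmul_eq_mul]
      have : 0 ≤ E + Real.log q := add_nonneg hE0.le (Real.log_natCast_nonneg q)
      calc _ = (Nat.totient q : ℝ) * (Nat.totient q * (E + Real.log q)) := rfl
        _ ≤ _ := by gcongr
  have h3 : T - (moebius q : ℂ) / Nat.totient q * (x : ℂ) =
      (T - (Nat.totient q : ℂ)⁻¹ * ∑ χ, charCoeff a χ * S χ) +
      ((Nat.totient q : ℂ)⁻¹ * ∑ χ, charCoeff a χ * S χ -
        (moebius q : ℂ) / Nat.totient q * (x : ℂ)) := by ring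
  have he1 : 1 ≤ Real.exp ℓ := Real.one_le_exp (by linarith)
  have he2 : (3 : ℝ) ≤ Real.exp (2 * ℓ) := by
    have := Real.add_one_le_exp (2 * ℓ)
    linarith
  rw [h3]
  calc _ ≤ Real.log q + q * (E + Real.log q) := (norm_add_le _ _).trans (add_le_add hfirst hsecond)
    _ ≤ E + Real.exp ℓ * (E + E) := by gcongr
    _ ≤ Real.exp ℓ * E + Real.exp ℓ * (E + E) := by
        gcongr
        exact le_mul_of_one_le_left hE0.le he1
    _ = E * Real.exp ℓ * 3 := by ring
    _ ≤ E * Real.exp ℓ * Real.exp (2 * ℓ) := by gcongr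
    _ = _ := by rw [hE, ← Real.exp_add, ← Real.exp_add]; congr 1; ring

end SiegelWalfisz

namespace SiegelWalfisz

open scoped Topology
open ArithmeticFunction Filter

lemma norm_sum_Ico_mul_le {c g : ℕ → ℂ} {m n : ℕ} (hmn : m ≤ n) {E δ : ℝ} (hE : 0 ≤ E)
    (hD : ∀ k, m ≤ k → k ≤ n → ‖∑ j ∈ Finset.range k, c j‖ ≤ E) (hg : ∀ k, ‖g k‖ ≤ 1)
    (hδ : ∀ k, ‖g (k + 1) - g k‖ ≤ δ) :
    ‖∑ k ∈ Finset.Ico m n, c k * g k‖ ≤ E * (2 + δ * (n - m)) := by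
  set D : ℕ → ℂ := fun k => ∑ j ∈ Finset.range k, c j with hDdef
  have habel : ∑ k ∈ Finset.Ico m n, c k * g k =
      D n * g n - D m * g m - ∑ k ∈ Finset.Ico m n, D (k + 1) * (g (k + 1) - g k) := by
    clear hD
    induction n, hmn using Nat.le_induction with
    | base => simp
    | succ n hmn ih =>
      rw [Finset.sum_Ico_succ_top hmn, Finset.sum_Ico_succ_top hmn, ih]
      simp only [hDdef, Finset.sum_range_succ]
      ring
  have h1 : ∀ k, m ≤ k → k ≤ n → ‖D k * g k‖ ≤ E := fun k h1 h2 => by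
    rw [norm_mul]
    exact (mul_le_of_le_one_right (norm_nonneg _) (hg k)).trans (hD k h1 h2)
  have h2 : ‖∑ k ∈ Finset.Ico m n, D (k + 1) * (g (k + 1) - g k)‖ ≤ (n - m) * (E * δ) := by
    refine (norm_sum_le_of_le (n := fun _ => E * δ) _ fun k hk => ?_).trans ?_
    · rw [Finset.mem_Ico] at hk
      rw [norm_mul]
      gcongr
      · exact hD _ (by omega) (by omega)
      · exact hδ k
    · rw [Finset.sum_const, Nat.card_Ico, nsmul_eq_mul, Nat.cast_sub hmn]
  rw [habel]
  refine (norm_sub_le _ _).trans ((add_le_add ((norm_sub_le _ _).trans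
    (add_le_add (h1 n hmn le_rfl) (h1 m le_rfl hmn))) h2).trans (le_of_eq ?_))
  ring

lemma norm_moebius_div_totient_le (q : ℕ) : ‖(moebius q : ℂ) / Nat.totient q‖ ≤ 1 := by
  rcases eq_or_ne q 0 with rfl | hq
  · simp
  have h1 : (1 : ℝ) ≤ Nat.totient q := by
    exact_mod_cast Nat.totient_pos.2 (Nat.pos_of_ne_zero hq)
  have h2 : ‖(moebius q : ℂ)‖ ≤ 1 := by
    rw [Complex.norm_intCast]
    exact_mod_cast abs_moebius_le_one
  rw [norm_div, Complex.norm_natCast]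
  exact div_le_one_of_le₀ (h2.trans h1) (by positivity)

lemma norm_initial_sum_le {lam : ℝ} (hlam : 0 < lam) : ∀ᶠ ℓ : ℝ in atTop, ∀ (q : ℕ) [NeZero q],
    (q : ℝ) ≤ ℓ ^ (2 * lam) → ∀ a : ZMod q, IsUnit a → ∀ n : ℕ, Real.exp (ℓ ^ 2) / 4 ≤ n →
      n ≤ Real.exp (ℓ ^ 2) →
        ‖∑ k ∈ Finset.range (n + 1), ((if k.Prime then (Real.log k : ℂ) else 0) *
            ZMod.stdAddChar (a * (k : ZMod q)) - (moebius q : ℂ) / Nat.totient q)‖ ≤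
          2 * Real.exp (ℓ ^ 2 - 6 * ℓ) := by
  obtain ⟨ℓ₀, h⟩ := eventually_atTop.1
    (sum_prime_stdAddChar_le (m := 2 * lam + 1) (B := 12) (by positivity) (by positivity))
  filter_upwards [eventually_ge_atTop (2 * ℓ₀), eventually_ge_atTop 6,
    eventually_ge_atTop ((2 : ℝ) ^ (2 * lam + 1))] with ℓ h0 h6 h2 q _ hq a ha n hn1 hn2
  have hℓ : 0 < ℓ := by linarith
  have hx0 : 0 < Real.exp (ℓ ^ 2) := Real.exp_pos _
  have hn0 : (0 : ℝ) < n := by linarith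
  have hlog : (ℓ / 2) ^ 2 ≤ Real.log n := by
    have h3 : Real.log 4 ≤ 2 := by
      rw [show (4 : ℝ) = 2 ^ 2 by norm_num, Real.log_pow]
      push_cast
      linarith [Real.log_two_lt_d9]
    have h4 : Real.log (Real.exp (ℓ ^ 2) / 4) ≤ Real.log n := Real.log_le_log (by positivity) hn1
    rw [Real.log_div hx0.ne' (by norm_num), Real.log_exp] at h4
    nlinarith
  have hL : ℓ / 2 ≤ √(Real.log n) := Real.le_sqrt_of_sq_le hlog
  have hqL : (q : ℝ) ≤ √(Real.log n) ^ (2 * lam + 1) := by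
    calc (q : ℝ) ≤ ℓ ^ (2 * lam) := hq
      _ ≤ (ℓ / 2) ^ (2 * lam + 1) := by
          rw [Real.div_rpow hℓ.le zero_le_two, le_div_iff₀ (by positivity),
            Real.rpow_add_one hℓ.ne']
          gcongr
      _ ≤ _ := Real.rpow_le_rpow (by positivity) hL (by positivity)
  have h1 := h (√(Real.log n)) (by linarith) q hqL a ha
  rw [Real.sq_sqrt ((sq_nonneg _).trans hlog), Real.exp_log hn0, Nat.floor_natCast] at h1
  set κ := (moebius q : ℂ) / Nat.totient q with hκ
  have hκ1 : ‖κ‖ ≤ 1 := norm_moebius_div_totient_le q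
  rw [Finset.sum_sub_distrib, Finset.sum_const, Finset.card_range, nsmul_eq_mul]
  set S := ∑ k ∈ Finset.range (n + 1), (if k.Prime then (Real.log k : ℂ) else 0) *
            ZMod.stdAddChar (a * (k : ZMod q)) with hS
  have e1 : S - ((n + 1 : ℕ) : ℂ) * κ = (S - κ * ((n : ℝ) : ℂ)) - κ := by push_cast; ring
  rw [e1]
  have h5 : Real.exp (Real.log n - 12 * √(Real.log n)) ≤ Real.exp (ℓ ^ 2 - 6 * ℓ) := by
    have : Real.log n ≤ ℓ ^ 2 := by rwa [Real.log_le_iff_le_exp hn0]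
    exact Real.exp_le_exp.2 (by linarith)
  have h7 : 1 ≤ Real.exp (ℓ ^ 2 - 6 * ℓ) := Real.one_le_exp (by nlinarith)
  refine (norm_sub_le _ _).trans ((add_le_add (h1.trans h5) (hκ1.trans h7)).trans (le_of_eq ?_))
  ring

lemma norm_e_sub_one_le (x : ℝ) : ‖e x - 1‖ ≤ 2 * Real.pi * |x| := by
  have h := Real.norm_exp_I_mul_ofReal_sub_one_le (x := 2 * Real.pi * x)
  have : e x = Complex.exp (Complex.I * (2 * Real.pi * x : ℝ)) := by
    rw [e]
    congr 1
    push_cast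
    ring
  rw [this]
  refine h.trans (le_of_eq ?_)
  rw [Real.norm_eq_abs, abs_mul, abs_of_pos Real.two_pi_pos]

lemma e_div_mul_natCast {q : ℕ} [NeZero q] (a k : ℕ) :
    e ((a : ℝ) / q * k) = ZMod.stdAddChar ((a : ZMod q) * (k : ZMod q)) := by
  rw [← Nat.cast_mul, stdAddChar_natCast, e]
  congr 1
  push_cast
  ring

lemma mem_window_iff {N n : ℕ} {A : ℝ} (hA : 0 ≤ A) (hAN : A ≤ N / 2) :
    (n < 2 * N + 2 ∧ (N : ℝ) / 2 - A < n ∧ (n : ℝ) ≤ N / 2 + A) ↔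
      n ∈ Finset.Ico (⌊(N : ℝ) / 2 - A⌋₊ + 1) (⌊(N : ℝ) / 2 + A⌋₊ + 1) := by
  rw [Finset.mem_Ico, Nat.add_one_le_iff, Nat.lt_add_one_iff (n := ⌊(N : ℝ) / 2 + A⌋₊),
    Nat.floor_lt (by linarith), Nat.le_floor_iff (by positivity)]
  refine ⟨fun h => h.2, fun h => ⟨?_, h⟩⟩
  have : (n : ℝ) ≤ N := by linarith [h.2]
  have : n ≤ N := by exact_mod_cast this
  omega

lemma F_eq_sum_Ico {N : ℕ} {A : ℝ} (hA : 0 ≤ A) (hAN : A ≤ N / 2) (α : ℝ) :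
    F N A α = ∑ k ∈ Finset.Ico (⌊(N : ℝ) / 2 - A⌋₊ + 1) (⌊(N : ℝ) / 2 + A⌋₊ + 1),
      (if k.Prime then (Real.log k : ℂ) else 0) * e (α * k) := by
  simp_rw [ite_mul, zero_mul]
  rw [← Finset.sum_filter, F]
  refine Finset.sum_congr ?_ fun _ _ => rfl
  ext n
  rw [Finset.mem_filter, Finset.mem_filter, ← mem_window_iff hA hAN, Finset.mem_range]
  tauto

lemma u_eq_sum_Ico {N : ℕ} {A : ℝ} (hA : 0 ≤ A) (hAN : A ≤ N / 2) (β : ℝ) :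
    u N A β = ∑ k ∈ Finset.Ico (⌊(N : ℝ) / 2 - A⌋₊ + 1) (⌊(N : ℝ) / 2 + A⌋₊ + 1), e (β * k) := by
  have h : (Finset.Ico (⌊(N : ℝ) / 2 - A⌋₊ + 1) (⌊(N : ℝ) / 2 + A⌋₊ + 1)).image
      (Nat.cast : ℕ → ℝ) = (do let a ← Finset.range (2 * N + 2); pure (a : ℝ)).filter
        (fun n => (N : ℝ) / 2 - A < n ∧ n ≤ (N : ℝ) / 2 + A) := by
    ext x
    simp only [Finset.mem_image, ← mem_window_iff hA hAN, Finset.mem_filter, Finset.bind_def,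
      Finset.mem_sup, Finset.mem_range, Finset.pure_def, Finset.mem_singleton]
    constructor
    · rintro ⟨n, ⟨h1, h2⟩, rfl⟩
      exact ⟨⟨n, h1, rfl⟩, h2⟩
    · rintro ⟨⟨n, h1, rfl⟩, h2⟩
      exact ⟨n, ⟨h1, h2⟩, rfl⟩
  rw [u, ← Finset.sum_image (g := (Nat.cast : ℕ → ℝ)) (f := fun x => e (β * x))
    Nat.cast_injective.injOn, h]

/-- The window sum is `∑ c(k) e(βk)` with `c(k) = log k · e(ak/q) - μ(q)/φ(q)`, the first
term being present only for prime `k`. -/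
lemma F_sub_eq_sum_Ico {N q : ℕ} [NeZero q] {A : ℝ} (hA : 0 ≤ A) (hAN : A ≤ N / 2) (a : ℕ)
    (α : ℝ) (κ : ℂ) : F N A α - κ * u N A (α - (a : ℝ) / q) =
      ∑ k ∈ Finset.Ico (⌊(N : ℝ) / 2 - A⌋₊ + 1) (⌊(N : ℝ) / 2 + A⌋₊ + 1),
        ((if k.Prime then (Real.log k : ℂ) else 0) *
          ZMod.stdAddChar ((a : ZMod q) * (k : ZMod q)) - κ) * e ((α - (a : ℝ) / q) * k) := by
  rw [F_eq_sum_Ico hA hAN, u_eq_sum_Ico hA hAN, Finset.mul_sum, ← Finset.sum_sub_distrib]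
  refine Finset.sum_congr rfl fun k _ => ?_
  have h : e (α * k) = e ((a : ℝ) / q * k) * e ((α - (a : ℝ) / q) * k) := by
    rw [← e_add]
    congr 1
    ring
  rw [h, ← e_div_mul_natCast]
  ring

end SiegelWalfisz

open Filter SiegelWalfisz

theorem stmt8 (lam ε : ℝ) (hlam : 0 < lam) (hε : ε ∈ Set.Ioo (0 : ℝ) 1) :
    ∃ c₄ > (0 : ℝ), ∃ C > (0 : ℝ), ∃ N₀ : ℕ, ∀ N : ℕ, N₀ ≤ N → Even N →
      ∀ q a : ℕ, 1 ≤ q → (q : ℝ) ≤ Qof lam N → a < q → Nat.gcd a q = 1 →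
        ∀ α : ℝ, |α - (a : ℝ) / q| ≤ 1 / tauof ε lam N →
          ‖F N (Aof ε N) α -
              ((ArithmeticFunction.moebius q : ℂ) / (Nat.totient q : ℂ)) *
                u N (Aof ε N) (α - (a : ℝ) / q)‖ ≤
            C * Aof ε N * Real.exp (-c₄ * Real.sqrt (Real.log N)) := by
  obtain ⟨hε0, hε1⟩ := hε
  have hpow : ∀ᶠ ℓ : ℝ in atTop, ℓ ^ (2 * lam) ≤ Real.exp ℓ := by
    filter_upwards [(isLittleO_rpow_exp_atTop (2 * lam)).bound one_pos, eventually_ge_atTop 0] with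
      ℓ h h0
    rwa [Real.norm_of_nonneg (by positivity), Real.norm_of_nonneg (by positivity), one_mul] at h
  have hlim : Tendsto (fun N : ℕ => √(Real.log N)) atTop atTop :=
    Real.tendsto_sqrt_atTop.comp (Real.tendsto_log_atTop.comp tendsto_natCast_atTop_atTop)
  obtain ⟨N₀, hN₀⟩ := eventually_atTop.1 ((hlim.eventually ((norm_initial_sum_le hlam).and
    (hpow.and ((eventually_ge_atTop 6).and (eventually_ge_atTop (7 / ε)))))).and
      (eventually_ge_atTop 8))
  refine ⟨1, one_pos, 52, by norm_num, N₀, fun N hN _ q a hq hqQ _ hgcd α hα => ?_⟩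
  obtain ⟨⟨hpre, hQ, h6, h7⟩, hN8⟩ := hN₀ N hN
  have : NeZero q := ⟨by omega⟩
  have hN8' : (8 : ℝ) ≤ N := by exact_mod_cast hN8
  have hN0 : (0 : ℝ) < N := by linarith
  set ℓ := √(Real.log N) with hℓ
  have hℓ2 : ℓ ^ 2 = Real.log N := Real.sq_sqrt (Real.log_nonneg (by linarith))
  have hNe : Real.exp (ℓ ^ 2) = N := by rw [hℓ2, Real.exp_log hN0]
  have hℓ0 : 0 < ℓ := by linarith
  have hQℓ : Qof lam N = ℓ ^ (2 * lam) := by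
    rw [Qof, ← hℓ2, ← Real.rpow_natCast ℓ 2, ← Real.rpow_mul hℓ0.le]
    norm_num
  set A := Aof ε N with hA
  have hAe : A = N * Real.exp (-(ε * ℓ)) := by rw [hA, Aof, neg_mul]
  have hA0 : 0 < A := by rw [hAe]; positivity
  have hA1 : 1 ≤ A := by
    rw [hAe, ← hNe, ← Real.exp_add]
    exact Real.one_le_exp (by nlinarith)
  have hA8 : A ≤ N / 8 := by
    have h8 : (8 : ℝ) ≤ Real.exp (ε * ℓ) := by
      have h1 := Real.add_one_le_exp (ε * ℓ)
      rw [div_le_iff₀ hε0] at h7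
      linarith
    rw [hAe, Real.exp_neg, div_eq_mul_inv]
    gcongr
  have hNA : (N : ℝ) ≤ A * Real.exp ℓ := by
    rw [hAe, mul_assoc, ← Real.exp_add]
    exact le_mul_of_one_le_right hN0.le (Real.one_le_exp (by nlinarith))
  rw [F_sub_eq_sum_Ico hA0.le (by linarith)]
  set β := α - (a : ℝ) / q with hβ
  set L := ⌊(N : ℝ) / 2 - A⌋₊ with hL
  set U := ⌊(N : ℝ) / 2 + A⌋₊ with hU
  have hLU : L ≤ U := Nat.floor_le_floor (by linarith)
  have hL4 : (N : ℝ) / 4 ≤ L := by linarith [Nat.lt_floor_add_one ((N : ℝ) / 2 - A)]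
  have hUN : (U : ℝ) ≤ N / 2 + A := Nat.floor_le (by linarith)
  have hUL : ((U + 1 : ℕ) : ℝ) - ((L + 1 : ℕ) : ℝ) ≤ 3 * A := by
    push_cast
    linarith [Nat.lt_floor_add_one ((N : ℝ) / 2 - A)]
  have hmain := norm_sum_Ico_mul_le (m := L + 1) (n := U + 1) (by omega)
    (E := 2 * Real.exp (ℓ ^ 2 - 6 * ℓ)) (δ := 2 * Real.pi * |β|)
    (g := fun k => e (β * k)) (by positivity) (fun k hk1 hk2 => by
      obtain ⟨n, rfl⟩ : ∃ n, k = n + 1 := ⟨k - 1, by omega⟩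
      have hn1 : (L : ℝ) ≤ n := by exact_mod_cast (by omega : L ≤ n)
      have hn2 : (n : ℝ) ≤ U := by exact_mod_cast (by omega : n ≤ U)
      exact hpre q (hQℓ ▸ hqQ) (a : ZMod q) ((ZMod.isUnit_iff_coprime a q).2 hgcd) n
        (by rw [hNe]; linarith) (by rw [hNe]; linarith)) (fun k => (norm_e _).le) fun k => by
      have : e (β * ((k + 1 : ℕ) : ℝ)) = e (β * k) * e β := by
        rw [← e_add]
        congr 1
        push_cast
        ring
      rw [this, ← mul_sub_one, norm_mul, norm_e, one_mul]
      exact norm_e_sub_one_le β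
  refine hmain.trans ?_
  have hβA : |β| * A ≤ Real.exp (2 * ℓ) := by
    have h1 : 1 / tauof ε lam N * A = Qof lam N * (N / A) := by
      have : Qof lam N ≠ 0 := by rw [hQℓ]; positivity
      rw [tauof, ← hA]
      field_simp
    calc |β| * A ≤ 1 / tauof ε lam N * A := by gcongr
      _ = Qof lam N * (N / A) := h1
      _ ≤ Real.exp ℓ * Real.exp ℓ := by
          gcongr
          · rwa [hQℓ]
          · rwa [div_le_iff₀' hA0]
      _ = _ := by rw [← Real.exp_add]; congr 1; ring
  have he : 1 ≤ Real.exp (2 * ℓ) := Real.one_le_exp (by positivity)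
  have hfac : 2 + 2 * Real.pi * |β| * (((U + 1 : ℕ) : ℝ) - ((L + 1 : ℕ) : ℝ)) ≤
      26 * Real.exp (2 * ℓ) := by
    have h0 : (0 : ℝ) ≤ ((U + 1 : ℕ) : ℝ) - ((L + 1 : ℕ) : ℝ) :=
      sub_nonneg.2 (by exact_mod_cast (by omega : L + 1 ≤ U + 1))
    calc _ ≤ 2 + 2 * 4 * |β| * (3 * A) := by gcongr; exact Real.pi_le_four
      _ = 2 * 1 + 24 * (|β| * A) := by ring
      _ ≤ 2 * Real.exp (2 * ℓ) + 24 * Real.exp (2 * ℓ) := by gcongr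
      _ = _ := by ring
  calc _ ≤ 2 * Real.exp (ℓ ^ 2 - 6 * ℓ) * (26 * Real.exp (2 * ℓ)) := by gcongr
    _ = 52 * N * Real.exp (-4 * ℓ) := by
        have : Real.exp (ℓ ^ 2 - 6 * ℓ) * Real.exp (2 * ℓ) = N * Real.exp (-4 * ℓ) := by
          rw [← hNe, ← Real.exp_add, ← Real.exp_add]; congr 1; ring
        linear_combination 52 * this
    _ ≤ 52 * (A * Real.exp ℓ) * Real.exp (-4 * ℓ) := by gcongr
    _ = 52 * A * Real.exp (-3 * ℓ) := by
        have : Real.exp ℓ * Real.exp (-4 * ℓ) = Real.exp (-3 * ℓ) := by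
          rw [← Real.exp_add]; congr 1; ring
        linear_combination 52 * A * this
    _ ≤ 52 * A * Real.exp (-1 * ℓ) := by gcongr; norm_num
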